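/- Let u₀ ∈ Ḣ^{1/2}(ℝ³;ℝ³) and let δ > 0 be a sufficiently small constant. Then there exists a sufficiently small time t₁ > 0 such that the generalized Navier–Stokes system with data u₀ has a unique mild solution u on [0, t₁], and there is a constant C such that for every T ∈ (0, t₁]: ‖u‖_{Y_T} ≤ C e^{10^{−4} λ(T)²} ‖u_h‖_{L^∞_T(Ḣ^{1/2})}, where λ(T) = √( 3 · min{ |ln ζ^{1/2}_{T^{−1/4}}(T)| , |ln T| } ) with ζ_J^{1/2}(T) := max_{0≤t≤T} ‖ 1_{|ξ| ≥ J} |ξ|^{1/2} û(t,ξ) ‖_{L²_ξ} (and |ln ζ^{1/2}_{T^{−1/4}}(T)| interpreted as +∞ if ζ^{1/2}_{T^{−1/4}}(T) = 0), and û_h(t,ξ) = û(t,ξ)·1_{|ξ| ≥ T^{−1/4}}. -/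

import Mathlib

noncomputable section

open MeasureTheory Set Filter
open scoped ENNReal Topology

/-- Frequency space ℝ³ (as functions `Fin 3 → ℝ`, with the product Lebesgue measure). -/
abbrev V3 : Type := Fin 3 → ℝ

/-- The Euclidean norm on `V3`. -/
def en (ξ : V3) : ℝ := Real.sqrt (∑ i, ξ i ^ 2)

/-- Squared Euclidean magnitude of a vector in ℂ³. -/
def vnSq (v : Fin 3 → ℂ) : ℝ := ∑ j, ‖v j‖ ^ 2

/-- Weighted L²-norm in the frequency variable, valued in `ℝ≥0∞`:
`wnorm w f = ( ∫ (w ξ)² |f ξ|² dξ )^{1/2}`. -/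
def wnorm (w : V3 → ℝ) (f : V3 → Fin 3 → ℂ) : ℝ≥0∞ :=
  (∫⁻ ξ : V3, ENNReal.ofReal (w ξ ^ 2 * vnSq (f ξ))) ^ ((1 : ℝ) / 2)

/-- Weight of the inhomogeneous Sobolev norm `H^γ`, i.e. `⟨ξ⟩^γ`. -/
def wH (γ : ℝ) : V3 → ℝ := fun ξ => (1 + en ξ ^ 2) ^ (γ / 2)

/-- Weight of the homogeneous Sobolev norm `Ḣ^s`, i.e. `|ξ|^s`. -/
def wD (s : ℝ) : V3 → ℝ := fun ξ => en ξ ^ s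

/-- Coefficients `α^{j,m,n,p}_{k,ℓ}` of the bilinear form `Q`
(order of arguments: `α j m n p k l`). -/
abbrev Coeffs : Type := Fin 3 → Fin 3 → Fin 3 → Fin 3 → Fin 3 → Fin 3 → ℝ

/-- The symbol `q^{j,m}_{k,ℓ}(ξ) = Σ_{n,p} α^{j,m,n,p}_{k,ℓ} ξ_n ξ_p / |ξ|²`. -/
def qsym (α : Coeffs) (j m k l : Fin 3) (ξ : V3) : ℝ :=
  ∑ n, ∑ p, α j m n p k l * (ξ n * ξ p) / en ξ ^ 2

/-- Fourier side of the bilinear term `Q(u,v)`: with the convention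
`f̂(ξ) = ∫ f(x) e^{-ix·ξ} dx`, the product `u^k v^ℓ` has Fourier transform
`(2π)⁻³ (û^k ∗ v̂^ℓ)(ξ)`, so that
`(Q^j(u,v))^(ξ) = Σ_{k,ℓ,m} q^{j,m}_{k,ℓ}(ξ) · iξ_m · (2π)⁻³ (û^k ∗ v̂^ℓ)(ξ)`. -/
def Qhat (α : Coeffs) (U W : V3 → Fin 3 → ℂ) : V3 → Fin 3 → ℂ := fun ξ j =>
  ∑ k : Fin 3, ∑ l : Fin 3, ∑ m : Fin 3,
    (qsym α j m k l ξ : ℂ) * (Complex.I * (ξ m : ℂ)) *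
      ((((2 * Real.pi) ^ (3 : ℕ))⁻¹ : ℝ) : ℂ) * ∫ η : V3, U η k * W (ξ - η) l

/-- `U` is (the Fourier transform of) a mild solution of the generalized Navier–Stokes
equations on `[0,T]` with (Fourier-side) data `U₀`:
`û(t,ξ) = e^{-t|ξ|²} û₀(ξ) + ∫₀^t e^{-(t-s)|ξ|²} (Q(u,u))^(s,ξ) ds`. -/
def IsMildSol (α : Coeffs) (U₀ : V3 → Fin 3 → ℂ) (U : ℝ → V3 → Fin 3 → ℂ) (T : ℝ) : Prop :=
  ∀ t ∈ Icc (0 : ℝ) T, ∀ ξ : V3, ∀ j : Fin 3,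
    U t ξ j = (Real.exp (-(t * en ξ ^ 2)) : ℂ) * U₀ ξ j
      + ∫ s in (0 : ℝ)..t, (Real.exp (-((t - s) * en ξ ^ 2)) : ℂ) * Qhat α (U s) (U s) ξ j

/-- Continuity on `[0,T]` with values in the weighted L²-space with weight `w`
(this encodes `u ∈ C([0,T]; H)` for the corresponding Sobolev space `H`). -/
def ContInW (w : V3 → ℝ) (U : ℝ → V3 → Fin 3 → ℂ) (T : ℝ) : Prop :=
  (∀ t ∈ Icc (0 : ℝ) T, wnorm w (U t) < ⊤) ∧
  ∀ t ∈ Icc (0 : ℝ) T, ∀ ε : ℝ≥0∞, 0 < ε → ∃ d > (0 : ℝ), ∀ s ∈ Icc (0 : ℝ) T,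
    |s - t| < d → wnorm w (fun ξ j => U s ξ j - U t ξ j) < ε

/-- Membership in `L²((0,T); H)` for the weighted space `H` with weight `w`. -/
def MemL2W (w : V3 → ℝ) (U : ℝ → V3 → Fin 3 → ℂ) (T : ℝ) : Prop :=
  ∫⁻ t in Ioo (0 : ℝ) T, wnorm w (U t) ^ (2 : ℕ) < ⊤

/-- Joint measurability of a time-dependent (Fourier-side) vector field. -/
def MeasVF (U : ℝ → V3 → Fin 3 → ℂ) : Prop :=
  ∀ j : Fin 3, Measurable (Function.uncurry fun t ξ => U t ξ j)

/-- Divergence-free condition on the Fourier side: `ξ · û₀(ξ) = 0`. -/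
def DivFree (U₀ : V3 → Fin 3 → ℂ) : Prop := ∀ ξ : V3, ∑ j : Fin 3, (ξ j : ℂ) * U₀ ξ j = 0

/-- `U₀` is the Fourier transform of a real (ℝ³-valued) vector field. -/
def RealField (U₀ : V3 → Fin 3 → ℂ) : Prop :=
  ∀ ξ : V3, ∀ j : Fin 3, U₀ (-ξ) j = (starRingEnd ℂ) (U₀ ξ j)

/-- `ζ_J^{1/2}(t) = max_{0≤τ≤t} ‖ 1_{|ξ|≥J} |ξ|^{1/2} û(τ,ξ) ‖_{L²_ξ}`. -/
def zetaSup (U : ℝ → V3 → Fin 3 → ℂ) (J t : ℝ) : ℝ≥0∞ :=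
  ⨆ τ ∈ Icc (0 : ℝ) t, wnorm (fun ξ => if J ≤ en ξ then en ξ ^ ((1 : ℝ) / 2) else 0) (U τ)

/-- `λ(T) = √( 3 min{ |ln ζ^{1/2}_{T^{-1/4}}(T)|, |ln T| } )`, with `|ln 0| = +∞`. -/
def lamCrit (U : ℝ → V3 → Fin 3 → ℂ) (t : ℝ) : ℝ :=
  Real.sqrt (3 * (if zetaSup U (t ^ (-(1 : ℝ) / 4)) t = 0 then |Real.log t|
    else min |Real.log ((zetaSup U (t ^ (-(1 : ℝ) / 4)) t).toReal)| |Real.log t|))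

/-- The critical working norm `Y_T` from \eqref{S3eq9}, with `λ = λ(T)`. -/
def Ynorm (δ T : ℝ) (U : ℝ → V3 → Fin 3 → ℂ) : ℝ≥0∞ :=
  ⨆ t ∈ Ioc (0 : ℝ) T,
    wnorm (fun ξ => if T ^ (-(1 : ℝ) / 4) ≤ en ξ then
        t ^ (δ / 2) * en ξ ^ (δ + 1 / 2) *
          Real.exp (-(lamCrit U T ^ 2 * t / (4 * T)) + lamCrit U T * t / Real.sqrt T * en ξ)
      else 0) (U t)

theorem lintegral_mul_sq_le {β : Type*} [MeasurableSpace β] {μ : Measure β} {f g : β → ℝ≥0∞}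
    (hf : AEMeasurable f μ) (hg : AEMeasurable g μ) :
    (∫⁻ x, f x * g x ∂μ) ^ 2 ≤ (∫⁻ x, f x ^ 2 ∂μ) * ∫⁻ x, g x ^ 2 ∂μ := by
  have h := ENNReal.lintegral_mul_le_Lp_mul_Lq μ (p := 2) (q := 2)
    Real.HolderConjugate.two_two hf hg
  simp only [Pi.mul_apply, ENNReal.rpow_ofNat] at h
  calc (∫⁻ x, f x * g x ∂μ) ^ 2
      ≤ ((∫⁻ x, f x ^ 2 ∂μ) ^ ((1 : ℝ) / 2) * (∫⁻ x, g x ^ 2 ∂μ) ^ ((1 : ℝ) / 2)) ^ 2 := by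
        gcongr
    _ = _ := by
        rw [mul_pow, ← ENNReal.rpow_natCast, ← ENNReal.rpow_natCast, ← ENNReal.rpow_mul,
          ← ENNReal.rpow_mul]
        norm_num

theorem ENNReal.add_sq_le_two_mul (a b : ℝ≥0∞) : (a + b) ^ 2 ≤ 2 * a ^ 2 + 2 * b ^ 2 := by
  have h := ENNReal.rpow_add_le_mul_rpow_add_rpow a b (p := 2) (by norm_num)
  have h2 : (2 : ℝ≥0∞) ^ ((2 : ℝ) - 1) = 2 := by norm_num
  rw [h2] at h
  simp only [ENNReal.rpow_ofNat] at h
  rwa [mul_add] at h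

theorem en_nonneg (ξ : V3) : 0 ≤ en ξ := Real.sqrt_nonneg _

theorem en_eq_norm (ξ : V3) : en ξ = ‖WithLp.toLp 2 ξ‖ := by
  rw [EuclideanSpace.norm_eq, en]
  simp

theorem continuous_en : Continuous en := by
  unfold en
  fun_prop

@[fun_prop]
theorem measurable_en : Measurable en := continuous_en.measurable

theorem en_add_le (ξ η : V3) : en (ξ + η) ≤ en ξ + en η := by
  simp only [en_eq_norm, WithLp.toLp_add]
  exact norm_add_le _ _

theorem en_le_add_sub (ξ η : V3) : en ξ ≤ en η + en (ξ - η) := by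
  simpa using en_add_le η (ξ - η)

theorem en_eq_zero {ξ : V3} : en ξ = 0 ↔ ξ = 0 := by
  rw [en_eq_norm, norm_eq_zero]
  simp

theorem en_pos {ξ : V3} (h : ξ ≠ 0) : 0 < en ξ :=
  lt_of_le_of_ne (en_nonneg ξ) fun h' => h (en_eq_zero.1 h'.symm)

theorem abs_le_en (ξ : V3) (i : Fin 3) : |ξ i| ≤ en ξ := by
  rw [en, ← Real.sqrt_sq_eq_abs]
  exact Real.sqrt_le_sqrt
    (Finset.single_le_sum (f := fun i => ξ i ^ 2) (fun i _ => sq_nonneg _) (Finset.mem_univ i))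

theorem norm_le_en (ξ : V3) : ‖ξ‖ ≤ en ξ :=
  (pi_norm_le_iff_of_nonneg (en_nonneg ξ)).2 fun i => by simpa using abs_le_en ξ i

theorem en_le_two_mul_norm (ξ : V3) : en ξ ≤ 2 * ‖ξ‖ := by
  rw [en, Real.sqrt_le_left (by positivity)]
  have h (i : Fin 3) : ξ i ^ 2 ≤ ‖ξ‖ ^ 2 := by
    rw [← sq_abs (ξ i)]
    have := norm_le_pi_norm ξ i
    rw [Real.norm_eq_abs] at this
    gcongr
  rw [Fin.sum_univ_three]
  nlinarith [h 0, h 1, h 2, sq_nonneg ‖ξ‖]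

/-- The Euclidean norm with values in `ℝ≥0∞`. -/
def ee (ξ : V3) : ℝ≥0∞ := ENNReal.ofReal (en ξ)

@[fun_prop]
theorem measurable_ee : Measurable ee := measurable_en.ennreal_ofReal

theorem ee_ne_top (ξ : V3) : ee ξ ≠ ⊤ := ENNReal.ofReal_ne_top

theorem ee_ne_zero {ξ : V3} (h : ξ ≠ 0) : ee ξ ≠ 0 := by
  simpa [ee] using en_pos h

/-- Convolution of nonnegative functions on frequency space. -/
def conv (f g : V3 → ℝ≥0∞) (ξ : V3) : ℝ≥0∞ := ∫⁻ η, f η * g (ξ - η)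

/-- Radial majorant, relative to the scale `r`, of the inverse-square kernel product. -/
def radKer (r y : ℝ) : ℝ := if y ≤ r then 4 / r ^ 2 * (y ^ 2)⁻¹ else (y ^ 4)⁻¹

theorem measurable_radKer (r : ℝ) : Measurable (radKer r) := by
  unfold radKer
  exact Measurable.ite measurableSet_Iic (by fun_prop) (by fun_prop)

theorem radKer_nonneg (r y : ℝ) : 0 ≤ radKer r y := by
  unfold radKer
  split_ifs <;> positivity

theorem lintegral_radKer {r : ℝ} (hr : 0 < r) :
    ∫⁻ ξ : V3, ENNReal.ofReal (radKer r ‖ξ‖)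
      = ENNReal.ofReal (15 * (volume : Measure V3).real (Metric.ball 0 1)) *
        (ENNReal.ofReal r)⁻¹ := by
  have hdim : Module.finrank ℝ V3 = 3 := by simp
  have e1 : EqOn (fun y : ℝ => y ^ (Module.finrank ℝ V3 - 1) • radKer r y)
      (fun _ => 4 / r ^ 2) (Ioc 0 r) := by
    intro y hy
    have := hy.1
    simp only [hdim, radKer, if_pos hy.2, smul_eq_mul]
    field_simp
  have e2 : EqOn (fun y : ℝ => y ^ (Module.finrank ℝ V3 - 1) • radKer r y)
      (fun y => y ^ (-2 : ℝ)) (Ioi r) := by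
    intro y hy
    have hy0 : 0 < y := hr.trans hy
    have : ¬ y ≤ r := not_le.2 hy
    simp only [hdim, radKer, if_neg this, smul_eq_mul]
    rw [Real.rpow_neg hy0.le]
    norm_num
    field_simp
  have i1 : IntegrableOn (fun y : ℝ => y ^ (Module.finrank ℝ V3 - 1) • radKer r y) (Ioc 0 r) :=
    (integrableOn_congr_fun e1 measurableSet_Ioc).2 (integrableOn_const (by simp))
  have i2 : IntegrableOn (fun y : ℝ => y ^ (Module.finrank ℝ V3 - 1) • radKer r y) (Ioi r) :=
    (integrableOn_congr_fun e2 measurableSet_Ioi).2 (integrableOn_Ioi_rpow_of_lt (by norm_num) hr)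
  have hint : Integrable (fun ξ : V3 => radKer r ‖ξ‖) := by
    rw [integrable_fun_norm_addHaar (volume : Measure V3), ← Ioc_union_Ioi_eq_Ioi hr.le]
    exact i1.union i2
  rw [← ofReal_integral_eq_lintegral_ofReal hint (ae_of_all _ fun _ => radKer_nonneg _ _),
    integral_fun_norm_addHaar (volume : Measure V3), ← Ioc_union_Ioi_eq_Ioi hr.le,
    setIntegral_union (by simp) measurableSet_Ioi i1 i2,
    setIntegral_congr_fun measurableSet_Ioc e1, setIntegral_congr_fun measurableSet_Ioi e2,
    integral_Ioi_rpow_of_lt (by norm_num) hr, hdim, ← ENNReal.ofReal_inv_of_pos hr,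
    ← ENNReal.ofReal_mul (by positivity)]
  congr 1
  have : r ^ ((-2 : ℝ) + 1) = r⁻¹ := by
    rw [show (-2 : ℝ) + 1 = -1 by norm_num, Real.rpow_neg_one]
  rw [this]
  simp
  rw [max_eq_left hr.le]
  field_simp
  ring

theorem inv_sq_mul_inv_sq_le {r a b : ℝ} (hr : 0 < r) (ha : 0 < a) (hb : 0 < b)
    (h : r ≤ a + b) :
    (a ^ 2)⁻¹ * (b ^ 2)⁻¹ ≤ radKer r a + radKer r b := by
  wlog hab : a ≤ b generalizing a b
  · rw [mul_comm, add_comm]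
    exact this hb ha (by linarith) (by linarith)
  refine le_trans ?_ (le_add_of_nonneg_right (radKer_nonneg r b))
  unfold radKer
  split_ifs with har
  · rw [mul_comm]
    gcongr
    have hb2 : r / 2 ≤ b := by linarith
    calc (b ^ 2)⁻¹ ≤ ((r / 2) ^ 2)⁻¹ := by gcongr
      _ = _ := by field_simp; norm_num
  · rw [← mul_inv, show a ^ 4 = a ^ 2 * a ^ 2 by ring]
    gcongr

theorem lintegral_inv_sq_conv_le {ξ : V3} (hξ : ξ ≠ 0) :
    ∫⁻ η, ((ee η)⁻¹ * (ee (ξ - η))⁻¹) ^ 2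
      ≤ ENNReal.ofReal (60 * (volume : Measure V3).real (Metric.ball 0 1)) * (ee ξ)⁻¹ := by
  have hr : 0 < ‖ξ‖ := norm_pos_iff.2 hξ
  set c := (volume : Measure V3).real (Metric.ball 0 1)
  have key : ∀ᵐ η : V3, ((ee η)⁻¹ * (ee (ξ - η))⁻¹) ^ 2
      ≤ ENNReal.ofReal (radKer ‖ξ‖ ‖η‖) + ENNReal.ofReal (radKer ‖ξ‖ ‖ξ - η‖) := by
    have h0 : ∀ᵐ η : V3, η ≠ 0 := by simp [ae_iff]
    have h1 : ∀ᵐ η : V3, η ≠ ξ := by simp [ae_iff]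
    filter_upwards [h0, h1] with η hη hη'
    have hb : 0 < ‖ξ - η‖ := norm_pos_iff.2 (sub_ne_zero.2 hη'.symm)
    have ha : 0 < ‖η‖ := norm_pos_iff.2 hη
    rw [← ENNReal.ofReal_add (radKer_nonneg _ _) (radKer_nonneg _ _)]
    refine le_trans ?_ (ENNReal.ofReal_le_ofReal (inv_sq_mul_inv_sq_le hr ha hb ?_))
    · rw [ENNReal.ofReal_mul (by positivity), mul_pow, ENNReal.ofReal_inv_of_pos (by positivity),
        ENNReal.ofReal_inv_of_pos (by positivity), ENNReal.ofReal_pow (by positivity),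
        ENNReal.ofReal_pow (by positivity), ← ENNReal.inv_pow, ← ENNReal.inv_pow]
      unfold ee
      gcongr <;> exact norm_le_en _
    · simpa using norm_add_le η (ξ - η)
  have m : Measurable fun η : V3 => ENNReal.ofReal (radKer ‖ξ‖ ‖η‖) :=
    ((measurable_radKer _).comp measurable_norm).ennreal_ofReal
  refine (lintegral_mono_ae key).trans ?_
  rw [lintegral_add_left m,
    lintegral_sub_left_eq_self (fun η : V3 => ENNReal.ofReal (radKer ‖ξ‖ ‖η‖)) ξ,
    lintegral_radKer hr, ← ENNReal.ofReal_inv_of_pos hr, ee,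
    ← ENNReal.ofReal_inv_of_pos (en_pos hξ),
    ← ENNReal.ofReal_mul (by positivity), ← ENNReal.ofReal_add (by positivity) (by positivity),
    ← ENNReal.ofReal_mul (by positivity)]
  apply ENNReal.ofReal_le_ofReal
  have h2 : ‖ξ‖⁻¹ ≤ 2 * (en ξ)⁻¹ := by
    have := en_pos hξ
    rw [inv_le_comm₀ hr (by positivity), mul_inv, inv_inv]
    linarith [en_le_two_mul_norm ξ]
  have hc : 0 ≤ c := by positivity
  nlinarith [mul_le_mul_of_nonneg_left h2 hc]

/-- Product law: multiplication maps `Ḣ¹ × Ḣ¹` into `Ḣ^{1/2}`. -/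
theorem lintegral_conv_sq_le {f g : V3 → ℝ≥0∞} (hf : Measurable f) (hg : Measurable g) :
    ∫⁻ ξ, ee ξ * conv f g ξ ^ 2
      ≤ ENNReal.ofReal (60 * (volume : Measure V3).real (Metric.ball 0 1)) *
        ((∫⁻ ξ, (ee ξ * f ξ) ^ 2) * ∫⁻ ξ, (ee ξ * g ξ) ^ 2) := by
  set C := ENNReal.ofReal (60 * (volume : Measure V3).real (Metric.ball 0 1))
  have h0 : ∀ᵐ η : V3, η ≠ 0 := by simp [ae_iff]
  have pt (ξ : V3) : ee ξ * conv f g ξ ^ 2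
      ≤ C * ∫⁻ η, (ee η * f η) ^ 2 * (ee (ξ - η) * g (ξ - η)) ^ 2 := by
    rcases eq_or_ne ξ 0 with rfl | hξ
    · simp [ee, en]
    have h1 : ∀ᵐ η : V3, η ≠ ξ := by simp [ae_iff]
    have e : conv f g ξ = ∫⁻ η, (ee η * f η * (ee (ξ - η) * g (ξ - η))) *
        ((ee η)⁻¹ * (ee (ξ - η))⁻¹) := by
      refine lintegral_congr_ae ?_
      filter_upwards [h0, h1] with η hη hη'
      have a1 := ENNReal.mul_inv_cancel (ee_ne_zero hη) (ee_ne_top η)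
      have a2 := ENNReal.mul_inv_cancel (ee_ne_zero (sub_ne_zero.2 hη'.symm)) (ee_ne_top (ξ - η))
      calc f η * g (ξ - η) = (ee η * (ee η)⁻¹) * (ee (ξ - η) * (ee (ξ - η))⁻¹) *
            (f η * g (ξ - η)) := by rw [a1, a2]; simp
        _ = _ := by ring
    calc ee ξ * conv f g ξ ^ 2
        ≤ ee ξ * ((∫⁻ η, (ee η * f η * (ee (ξ - η) * g (ξ - η))) ^ 2) *
            ∫⁻ η, ((ee η)⁻¹ * (ee (ξ - η))⁻¹) ^ 2) := by
          rw [e]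
          gcongr
          exact lintegral_mul_sq_le (by fun_prop) (by fun_prop)
      _ ≤ ee ξ * ((∫⁻ η, (ee η * f η * (ee (ξ - η) * g (ξ - η))) ^ 2) * (C * (ee ξ)⁻¹)) := by
          gcongr
          exact lintegral_inv_sq_conv_le hξ
      _ = (ee ξ * (ee ξ)⁻¹) * (C * ∫⁻ η, (ee η * f η * (ee (ξ - η) * g (ξ - η))) ^ 2) := by ring
      _ = _ := by
          rw [ENNReal.mul_inv_cancel (ee_ne_zero hξ) (ee_ne_top ξ), one_mul]
          simp_rw [mul_pow]
  refine (lintegral_mono pt).trans ?_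
  have m : Measurable fun p : V3 × V3 =>
      (ee p.2 * f p.2) ^ 2 * (ee (p.1 - p.2) * g (p.1 - p.2)) ^ 2 := by fun_prop
  rw [lintegral_const_mul _ m.lintegral_prod_right']
  gcongr
  rw [lintegral_lintegral_swap m.aemeasurable]
  have (η : V3) : ∫⁻ ξ, (ee η * f η) ^ 2 * (ee (ξ - η) * g (ξ - η)) ^ 2
      = (ee η * f η) ^ 2 * ∫⁻ ξ, (ee ξ * g ξ) ^ 2 := by
    rw [lintegral_const_mul _ (by fun_prop),
      lintegral_sub_right_eq_self (fun ξ => (ee ξ * g ξ) ^ 2) η]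
  simp_rw [this]
  rw [lintegral_mul_const _ (by fun_prop)]

theorem lintegral_rpow_kernel_le {p t : ℝ} (hp : 1 / 2 ≤ p) (hp' : p ≤ 3 / 4) (ht : 0 < t) :
    ∫⁻ s in Ioc 0 t, ENNReal.ofReal ((t - s) ^ (-p) * s ^ (-(1 : ℝ) / 2))
      ≤ ENNReal.ofReal (12 * t ^ (1 / 2 - p)) := by
  have ht2 : 0 < t / 2 := by positivity
  have i1 : IntervalIntegrable (fun s : ℝ => s ^ (-(1 : ℝ) / 2)) volume 0 t :=
    intervalIntegral.intervalIntegrable_rpow' (by norm_num)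
  have i2' : IntervalIntegrable (fun s : ℝ => s ^ (-p)) volume 0 t :=
    intervalIntegral.intervalIntegrable_rpow' (by linarith)
  have i2 : IntervalIntegrable (fun s : ℝ => (t - s) ^ (-p)) volume 0 t := by
    simpa using (i2'.comp_sub_left t).symm
  have pt : ∀ s ∈ Ioc 0 t, (t - s) ^ (-p) * s ^ (-(1 : ℝ) / 2)
      ≤ (t / 2) ^ (-p) * s ^ (-(1 : ℝ) / 2) + (t / 2) ^ (-(1 : ℝ) / 2) * (t - s) ^ (-p) := by
    intro s hs
    have hs0 := hs.1
    have hst : 0 ≤ t - s := sub_nonneg.2 hs.2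
    rcases le_total s (t / 2) with h | h
    · refine le_trans ?_ (le_add_of_nonneg_right (by positivity))
      gcongr ?_ * _
      exact Real.rpow_le_rpow_of_nonpos ht2 (by linarith) (by linarith)
    · refine le_trans ?_ (le_add_of_nonneg_left (by positivity))
      rw [mul_comm]
      gcongr ?_ * _
      exact Real.rpow_le_rpow_of_nonpos ht2 h (by norm_num)
  have i3 : IntervalIntegrable (fun s : ℝ => (t / 2) ^ (-p) * s ^ (-(1 : ℝ) / 2) +
      (t / 2) ^ (-(1 : ℝ) / 2) * (t - s) ^ (-p)) volume 0 t :=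
    (i1.const_mul _).add (i2.const_mul _)
  refine (setLIntegral_mono' measurableSet_Ioc
    fun s hs => ENNReal.ofReal_le_ofReal (pt s hs)).trans ?_
  have i4 := (intervalIntegrable_iff_integrableOn_Ioc_of_le ht.le).1 i3
  rw [← ofReal_integral_eq_lintegral_ofReal i4, ← intervalIntegral.integral_of_le ht.le]
  swap
  · filter_upwards [ae_restrict_mem measurableSet_Ioc] with s hs
    have hs0 := hs.1
    have hst : 0 ≤ t - s := sub_nonneg.2 hs.2
    positivity
  apply ENNReal.ofReal_le_ofReal
  rw [intervalIntegral.integral_add (i1.const_mul _) (i2.const_mul _),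
    intervalIntegral.integral_const_mul, intervalIntegral.integral_const_mul,
    intervalIntegral.integral_comp_sub_left (fun s => s ^ (-p)) t,
    integral_rpow (Or.inl (by norm_num)), sub_self, sub_zero,
    integral_rpow (Or.inl (by linarith)), Real.zero_rpow (by norm_num),
    Real.zero_rpow (by linarith)]
  have e1 : (t / 2) ^ (-p) = t ^ (-p) * 2 ^ p := by
    rw [Real.div_rpow ht.le (by norm_num), Real.rpow_neg (by norm_num : (0 : ℝ) ≤ 2),
      div_inv_eq_mul]
  have e2 : (t / 2) ^ (-(1 : ℝ) / 2) = t ^ (-(1 : ℝ) / 2) * 2 ^ ((1 : ℝ) / 2) := by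
    rw [Real.div_rpow ht.le (by norm_num), neg_div, Real.rpow_neg (by norm_num : (0 : ℝ) ≤ 2),
      div_inv_eq_mul]
  have f1 : t ^ (-p) * t ^ (-(1 : ℝ) / 2 + 1) = t ^ (1 / 2 - p) := by
    rw [← Real.rpow_add ht]
    ring_nf
  have f2 : t ^ (-(1 : ℝ) / 2) * t ^ (-p + 1) = t ^ (1 / 2 - p) := by
    rw [← Real.rpow_add ht]
    ring_nf
  have g1 : (2 : ℝ) ^ p ≤ 2 := by
    simpa using Real.rpow_le_rpow_of_exponent_le (x := 2) (by norm_num) (by linarith : p ≤ 1)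
  have g2 : (2 : ℝ) ^ ((1 : ℝ) / 2) ≤ 2 := by
    simpa using Real.rpow_le_rpow_of_exponent_le (x := 2) (by norm_num)
      (by norm_num : (1 : ℝ) / 2 ≤ 1)
  have g3 : (-p + 1)⁻¹ ≤ 4 := by
    rw [inv_le_comm₀ (by linarith) (by norm_num)]
    linarith
  have g4 : 0 ≤ (-p + 1)⁻¹ := inv_nonneg.2 (by linarith)
  have q : 0 ≤ t ^ (1 / 2 - p) := by positivity
  calc _ = 2 * 2 ^ p * (t ^ (-p) * t ^ (-(1 : ℝ) / 2 + 1)) +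
        2 ^ ((1 : ℝ) / 2) * (-p + 1)⁻¹ * (t ^ (-(1 : ℝ) / 2) * t ^ (-p + 1)) := by
        rw [e1, e2]
        norm_num
        ring
    _ = (2 * 2 ^ p + 2 ^ ((1 : ℝ) / 2) * (-p + 1)⁻¹) * t ^ (1 / 2 - p) := by
        rw [f1, f2]
        ring
    _ ≤ (2 * 2 + 2 * 4) * t ^ (1 / 2 - p) := by gcongr
    _ = _ := by norm_num

/-- Kato-type estimate: convolution in time with the kernel `τ ^ (-p)`, in `L²` of frequency. -/
theorem lintegral_kernel_sq_le {p t : ℝ} (hp : 1 / 2 ≤ p) (hp' : p ≤ 3 / 4) (ht : 0 < t)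
    {G : ℝ → V3 → ℝ≥0∞} (hG : Measurable (Function.uncurry G)) {A : ℝ≥0∞}
    (hA : ∀ s ∈ Ioc 0 t, ENNReal.ofReal s * ∫⁻ ξ, G s ξ ^ 2 ≤ A) :
    ∫⁻ ξ, (∫⁻ s in Ioc 0 t, ENNReal.ofReal ((t - s) ^ (-p)) * G s ξ) ^ 2
      ≤ ENNReal.ofReal (144 * t ^ (1 - 2 * p)) * A := by
  set I := ENNReal.ofReal (12 * t ^ (1 / 2 - p)) with hI
  have hG' (ξ : V3) : Measurable fun s => G s ξ := hG.comp (measurable_id.prodMk measurable_const)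
  have pt (ξ : V3) : (∫⁻ s in Ioc 0 t, ENNReal.ofReal ((t - s) ^ (-p)) * G s ξ) ^ 2
      ≤ I * ∫⁻ s in Ioc 0 t, ENNReal.ofReal ((t - s) ^ (-p) * s ^ ((1 : ℝ) / 2)) * G s ξ ^ 2 := by
    have e : ∫⁻ s in Ioc 0 t, ENNReal.ofReal ((t - s) ^ (-p)) * G s ξ
        = ∫⁻ s in Ioc 0 t, ENNReal.ofReal ((t - s) ^ (-p / 2) * s ^ (-(1 : ℝ) / 4)) *
          (ENNReal.ofReal ((t - s) ^ (-p / 2) * s ^ ((1 : ℝ) / 4)) * G s ξ) := by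
      refine setLIntegral_congr_fun measurableSet_Ioc fun s hs => ?_
      have hs0 := hs.1
      have hst : 0 ≤ t - s := sub_nonneg.2 hs.2
      rw [← mul_assoc, ← ENNReal.ofReal_mul (by positivity)]
      congr 2
      have a1 : (t - s) ^ (-p) = (t - s) ^ (-p / 2) * (t - s) ^ (-p / 2) := by
        rw [← sq, ← Real.rpow_mul_natCast hst]
        congr 1
        push_cast
        ring
      have a2 : s ^ (-(1 : ℝ) / 4) * s ^ ((1 : ℝ) / 4) = 1 := by
        rw [← Real.rpow_add hs0]
        norm_num
      rw [a1]
      linear_combination (-(t - s) ^ (-p / 2) * (t - s) ^ (-p / 2)) * a2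
    rw [e]
    refine (lintegral_mul_sq_le (by fun_prop) (by fun_prop)).trans ?_
    gcongr ?_ * ?_
    · refine le_trans (le_of_eq ?_) (lintegral_rpow_kernel_le hp hp' ht)
      refine setLIntegral_congr_fun measurableSet_Ioc fun s hs => ?_
      have hs0 := hs.1
      have hst : 0 ≤ t - s := sub_nonneg.2 hs.2
      rw [← ENNReal.ofReal_pow (by positivity), mul_pow, ← Real.rpow_mul_natCast hst,
        ← Real.rpow_mul_natCast hs0.le]
      congr 3 <;> push_cast <;> ring
    · refine le_of_eq (setLIntegral_congr_fun measurableSet_Ioc fun s hs => ?_)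
      have hs0 := hs.1
      have hst : 0 ≤ t - s := sub_nonneg.2 hs.2
      rw [mul_pow, ← ENNReal.ofReal_pow (by positivity), mul_pow, ← Real.rpow_mul_natCast hst,
        ← Real.rpow_mul_natCast hs0.le]
      congr 4 <;> push_cast <;> ring
  have m : Measurable fun q : V3 × ℝ =>
      ENNReal.ofReal ((t - q.2) ^ (-p) * q.2 ^ ((1 : ℝ) / 2)) * G q.2 q.1 ^ 2 := by
    have : Measurable fun q : V3 × ℝ => G q.2 q.1 := hG.comp measurable_swap
    fun_prop
  calc _ ≤ ∫⁻ ξ, I * ∫⁻ s in Ioc 0 t,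
          ENNReal.ofReal ((t - s) ^ (-p) * s ^ ((1 : ℝ) / 2)) * G s ξ ^ 2 := lintegral_mono pt
    _ = I * ∫⁻ s in Ioc 0 t, ∫⁻ ξ,
          ENNReal.ofReal ((t - s) ^ (-p) * s ^ ((1 : ℝ) / 2)) * G s ξ ^ 2 := by
        rw [lintegral_const_mul _ m.lintegral_prod_right',
          lintegral_lintegral_swap m.aemeasurable]
    _ ≤ I * ∫⁻ s in Ioc 0 t, ENNReal.ofReal ((t - s) ^ (-p) * s ^ (-(1 : ℝ) / 2)) * A := by
        gcongr I * ?_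
        refine setLIntegral_mono' measurableSet_Ioc fun s hs => ?_
        have hs0 := hs.1
        have hst : 0 ≤ t - s := sub_nonneg.2 hs.2
        have hGs : Measurable (G s) := hG.comp (measurable_const.prodMk measurable_id)
        rw [lintegral_const_mul _ (by fun_prop)]
        refine le_trans (le_of_eq ?_) (mul_le_mul_right (hA s hs) _)
        rw [← mul_assoc, ← ENNReal.ofReal_mul (by positivity), mul_assoc]
        congr 3
        nth_rw 3 [← Real.rpow_one s]
        rw [← Real.rpow_add hs0]
        norm_num
    _ ≤ I * (I * A) := by
        rw [lintegral_mul_const _ (by fun_prop)]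
        gcongr
        exact lintegral_rpow_kernel_le hp hp' ht
    _ = _ := by
        rw [← mul_assoc, hI, ← ENNReal.ofReal_mul (by positivity)]
        congr 2
        rw [show 1 - 2 * p = (1 / 2 - p) + (1 / 2 - p) by ring, Real.rpow_add ht]
        ring

/-- The causal kernel of the heat semigroup at frequency `√b`. -/
def heatKer (b x : ℝ) : ℝ≥0∞ :=
  (Ici 0).indicator (fun x => ENNReal.ofReal (b * Real.exp (-(x * b)))) x

@[fun_prop]
theorem measurable_heatKer (b : ℝ) : Measurable (heatKer b) :=
  Measurable.indicator (by fun_prop) measurableSet_Ici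

theorem lintegral_heatKer_le {b : ℝ} (hb : 0 ≤ b) : ∫⁻ x, heatKer b x ≤ 1 := by
  unfold heatKer
  rw [lintegral_indicator measurableSet_Ici, setLIntegral_congr Ioi_ae_eq_Ici.symm]
  rcases hb.eq_or_lt with rfl | hb
  · simp
  have hi : IntegrableOn (fun x => b * Real.exp (-(x * b))) (Ioi 0) := by
    have := (integrableOn_exp_mul_Ioi (a := -b) (by linarith) 0).const_mul b
    refine this.congr (ae_of_all _ fun x => ?_)
    ring_nf
  rw [← ofReal_integral_eq_lintegral_ofReal hi (ae_of_all _ fun x => by positivity)]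
  have : ∫ x in Ioi (0 : ℝ), b * Real.exp (-(x * b)) = 1 := by
    have h := integral_exp_mul_Ioi (a := -b) (by linarith) 0
    rw [integral_const_mul]
    simp_rw [show ∀ x : ℝ, -(x * b) = -b * x by intro x; ring]
    rw [h]
    simp
    field_simp
  rw [this]
  simp

theorem heatKer_sub {b s t : ℝ} (h : s ≤ t) :
    heatKer b (t - s) = ENNReal.ofReal (b * Real.exp (-((t - s) * b))) := by
  simp [heatKer, h]

theorem lintegral_heat_sq_le {a t : ℝ} (ha : 0 ≤ a) {g : ℝ → ℝ≥0∞} (hg : Measurable g) :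
    (∫⁻ s in Ioc 0 t, ENNReal.ofReal (Real.exp (-((t - s) * a ^ 2))) * (ENNReal.ofReal a * g s)) ^ 2
      ≤ ∫⁻ s in Ioc 0 t, g s ^ 2 := by
  simp_rw [← mul_assoc]
  refine (lintegral_mul_sq_le (by fun_prop) hg.aemeasurable).trans ?_
  refine mul_le_of_le_one_left' ?_
  calc _ ≤ ∫⁻ s in Ioc 0 t, heatKer (a ^ 2) (t - s) := by
        refine setLIntegral_mono' measurableSet_Ioc fun s hs => ?_
        rw [heatKer_sub hs.2, ← ENNReal.ofReal_mul (by positivity),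
          ← ENNReal.ofReal_pow (by positivity)]
        apply ENNReal.ofReal_le_ofReal
        have h1 : Real.exp (-((t - s) * a ^ 2)) ≤ 1 := by
          rw [Real.exp_le_one_iff]
          have : 0 ≤ t - s := sub_nonneg.2 hs.2
          have : 0 ≤ (t - s) * a ^ 2 := by positivity
          linarith
        have h0 := Real.exp_pos (-((t - s) * a ^ 2))
        have : 0 ≤ a ^ 2 * Real.exp (-((t - s) * a ^ 2)) := by positivity
        nlinarith [mul_le_mul_of_nonneg_left h1 this]
    _ ≤ ∫⁻ s, heatKer (a ^ 2) (t - s) := setLIntegral_le_lintegral _ _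
    _ ≤ 1 := by
        rw [lintegral_sub_left_eq_self (heatKer (a ^ 2)) t]
        exact lintegral_heatKer_le (by positivity)

theorem lintegral_lintegral_heat_sq_le {a T : ℝ} (ha : 0 ≤ a) {g : ℝ → ℝ≥0∞} (hg : Measurable g) :
    ∫⁻ t in Ioc 0 T, ENNReal.ofReal a ^ 2 *
      (∫⁻ s in Ioc 0 t, ENNReal.ofReal (Real.exp (-((t - s) * a ^ 2))) *
        (ENNReal.ofReal a * g s)) ^ 2 ≤ ∫⁻ s in Ioc 0 T, g s ^ 2 := by
  have pt : ∀ t ∈ Ioc 0 T, ENNReal.ofReal a ^ 2 *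
      (∫⁻ s in Ioc 0 t, ENNReal.ofReal (Real.exp (-((t - s) * a ^ 2))) *
        (ENNReal.ofReal a * g s)) ^ 2 ≤ ∫⁻ s in Ioc 0 T, heatKer (a ^ 2) (t - s) * g s ^ 2 := by
    intro t ht
    have hk2 (s : ℝ) : (heatKer (a ^ 2) (t - s) ^ ((1 : ℝ) / 2)) ^ 2 = heatKer (a ^ 2) (t - s) := by
      rw [← ENNReal.rpow_natCast, ← ENNReal.rpow_mul]
      norm_num
    rw [← mul_pow, ← lintegral_const_mul _ (by fun_prop)]
    calc _ = (∫⁻ s in Ioc 0 t, heatKer (a ^ 2) (t - s) ^ ((1 : ℝ) / 2) *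
            (heatKer (a ^ 2) (t - s) ^ ((1 : ℝ) / 2) * g s)) ^ 2 := by
          congr 1
          refine setLIntegral_congr_fun measurableSet_Ioc fun s hs => ?_
          rw [← mul_assoc (heatKer (a ^ 2) (t - s) ^ ((1 : ℝ) / 2)), ← sq, hk2, heatKer_sub hs.2,
            ENNReal.ofReal_mul (by positivity), ENNReal.ofReal_pow ha]
          ring
      _ ≤ (∫⁻ s in Ioc 0 t, heatKer (a ^ 2) (t - s)) *
            ∫⁻ s in Ioc 0 t, heatKer (a ^ 2) (t - s) * g s ^ 2 := by
          refine (lintegral_mul_sq_le (by fun_prop) (by fun_prop)).trans (le_of_eq ?_)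
          simp_rw [mul_pow, hk2]
      _ ≤ 1 * ∫⁻ s in Ioc 0 T, heatKer (a ^ 2) (t - s) * g s ^ 2 := by
          gcongr ?_ * ?_
          · refine (setLIntegral_le_lintegral _ _).trans ?_
            rw [lintegral_sub_left_eq_self (heatKer (a ^ 2)) t]
            exact lintegral_heatKer_le (by positivity)
          · exact lintegral_mono_set (Ioc_subset_Ioc_right ht.2)
      _ = _ := one_mul _
  refine (setLIntegral_mono' measurableSet_Ioc pt).trans ?_
  have m : Measurable fun q : ℝ × ℝ => heatKer (a ^ 2) (q.1 - q.2) * g q.2 ^ 2 := by fun_prop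
  rw [lintegral_lintegral_swap m.aemeasurable]
  refine lintegral_mono fun s => ?_
  rw [lintegral_mul_const _ (by fun_prop)]
  refine mul_le_of_le_one_left' ?_
  refine (setLIntegral_le_lintegral _ _).trans ?_
  rw [lintegral_sub_right_eq_self (heatKer (a ^ 2)) s]
  exact lintegral_heatKer_le (by positivity)

/-- Constant in the product law `Ḣ¹ × Ḣ¹ → Ḣ^{1/2}`. -/
def prodConst : ℝ≥0∞ := ENNReal.ofReal (60 * (volume : Measure V3).real (Metric.ball 0 1))

theorem prodConst_ne_top : prodConst ≠ ⊤ := ENNReal.ofReal_ne_top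

/-- Squared homogeneous Sobolev norm of order `k / 2` of a nonnegative frequency profile. -/
def hn (k : ℕ) (f : V3 → ℝ≥0∞) : ℝ≥0∞ := ∫⁻ ξ, ee ξ ^ k * f ξ ^ 2

theorem hn_mono {k : ℕ} {f g : V3 → ℝ≥0∞} (h : ∀ ξ, f ξ ≤ g ξ) : hn k f ≤ hn k g := by
  unfold hn
  gcongr with ξ
  exact h ξ

theorem hn_mono_ae {k : ℕ} {f g : V3 → ℝ≥0∞} (h : ∀ᵐ ξ, f ξ ≤ g ξ) : hn k f ≤ hn k g := by
  refine lintegral_mono_ae (h.mono fun ξ hξ => ?_)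
  gcongr

theorem hn_add_le {k : ℕ} {f g : V3 → ℝ≥0∞} (hf : Measurable f) :
    hn k (fun ξ => f ξ + g ξ) ≤ 2 * hn k f + 2 * hn k g := by
  unfold hn
  rw [← lintegral_const_mul' _ _ (by norm_num), ← lintegral_const_mul' _ _ (by norm_num),
    ← lintegral_add_left (by fun_prop)]
  refine lintegral_mono fun ξ => ?_
  calc ee ξ ^ k * (f ξ + g ξ) ^ 2 ≤ ee ξ ^ k * (2 * f ξ ^ 2 + 2 * g ξ ^ 2) := by
        gcongr
        exact ENNReal.add_sq_le_two_mul _ _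
    _ = _ := by ring

theorem hn_const_mul {k : ℕ} {c : ℝ≥0∞} (hc : c ≠ ⊤) (f : V3 → ℝ≥0∞) :
    hn k (fun ξ => c * f ξ) = c ^ 2 * hn k f := by
  unfold hn
  rw [← lintegral_const_mul' _ _ (by finiteness)]
  congr 1 with ξ
  ring

theorem hn_conv_le {f g : V3 → ℝ≥0∞} (hf : Measurable f) (hg : Measurable g) :
    hn 1 (conv f g) ≤ prodConst * (hn 2 f * hn 2 g) := by
  have := lintegral_conv_sq_le hf hg
  simpa [hn, prodConst, mul_pow] using this

theorem hn_two_sq_le {f : V3 → ℝ≥0∞} (hf : Measurable f) : hn 2 f ^ 2 ≤ hn 1 f * hn 3 f := by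
  unfold hn
  have hs (x : ℝ≥0∞) : (x ^ ((1 : ℝ) / 2)) ^ 2 = x := by
    rw [← ENNReal.rpow_natCast, ← ENNReal.rpow_mul]
    norm_num
  calc (∫⁻ ξ, ee ξ ^ 2 * f ξ ^ 2) ^ 2
      = (∫⁻ ξ, ((ee ξ ^ ((1 : ℝ) / 2)) * f ξ) * ((ee ξ ^ ((1 : ℝ) / 2)) * ee ξ * f ξ)) ^ 2 := by
        congr 2 with ξ
        calc ee ξ ^ 2 * f ξ ^ 2 = ee ξ * (ee ξ * f ξ ^ 2) := by ring
          _ = (ee ξ ^ ((1 : ℝ) / 2)) ^ 2 * (ee ξ * f ξ ^ 2) := by rw [hs]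
          _ = _ := by ring
    _ ≤ _ := by
        refine (lintegral_mul_sq_le (by fun_prop) (by fun_prop)).trans (le_of_eq ?_)
        congr 2 with ξ
        · rw [mul_pow, hs, pow_one]
        · rw [mul_pow, mul_pow, hs]
          ring

theorem measurable_lintegral_Ioc {β : Type*} [MeasurableSpace β] {h : ℝ → β → ℝ → ℝ≥0∞}
    (hh : Measurable fun q : (ℝ × β) × ℝ => h q.1.1 q.1.2 q.2) :
    Measurable fun p : ℝ × β => ∫⁻ s in Ioc 0 p.1, h p.1 p.2 s := by
  have hS : MeasurableSet {q : (ℝ × β) × ℝ | q.2 ∈ Ioc 0 q.1.1} :=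
    (measurableSet_lt measurable_const measurable_snd).inter
      (measurableSet_le measurable_snd (measurable_fst.comp measurable_fst))
  have := (hh.indicator hS).lintegral_prod_right' (ν := (volume : Measure ℝ))
  convert this using 2 with p
  rw [← lintegral_indicator measurableSet_Ioc]
  rfl

/-- Duhamel operator with one derivative, on nonnegative frequency profiles. -/
def duh (g : ℝ → V3 → ℝ≥0∞) (t : ℝ) (ξ : V3) : ℝ≥0∞ :=
  ∫⁻ s in Ioc 0 t, ENNReal.ofReal (Real.exp (-((t - s) * en ξ ^ 2))) * (ee ξ * g s ξ)

theorem measurable_duh {g : ℝ → V3 → ℝ≥0∞} (hg : Measurable (Function.uncurry g)) :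
    Measurable (Function.uncurry (duh g)) := by
  refine measurable_lintegral_Ioc (h := fun t ξ s =>
    ENNReal.ofReal (Real.exp (-((t - s) * en ξ ^ 2))) * (ee ξ * g s ξ)) ?_
  have : Measurable fun q : (ℝ × V3) × ℝ => g q.2 q.1.2 :=
    hg.comp (f := fun q : (ℝ × V3) × ℝ => (q.2, q.1.2)) (by fun_prop)
  fun_prop

theorem measurable_slice {g : ℝ → V3 → ℝ≥0∞} (hg : Measurable (Function.uncurry g)) (t : ℝ) :
    Measurable (g t) := hg.comp (measurable_const.prodMk measurable_id)

theorem measurable_time {g : ℝ → V3 → ℝ≥0∞} (hg : Measurable (Function.uncurry g)) (ξ : V3) :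
    Measurable fun t => g t ξ := hg.comp (measurable_id.prodMk measurable_const)

theorem measurable_hn {k : ℕ} {g : ℝ → V3 → ℝ≥0∞} (hg : Measurable (Function.uncurry g)) :
    Measurable fun t => hn k (g t) := by
  have : Measurable fun q : ℝ × V3 => ee q.2 ^ k * g q.1 q.2 ^ 2 := by
    have : Measurable fun q : ℝ × V3 => g q.1 q.2 := hg
    fun_prop
  exact Measurable.lintegral_prod_right' (ν := volume) this

theorem hn_lintegral_swap {k : ℕ} {S : Set ℝ} {g : ℝ → V3 → ℝ≥0∞}
    (hg : Measurable (Function.uncurry g)) :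
    ∫⁻ t in S, hn k (g t) = ∫⁻ ξ, ee ξ ^ k * ∫⁻ t in S, g t ξ ^ 2 := by
  have hg' : Measurable fun q : ℝ × V3 => g q.1 q.2 := hg
  have : Measurable fun q : ℝ × V3 => ee q.2 ^ k * g q.1 q.2 ^ 2 := by
    fun_prop
  unfold hn
  rw [lintegral_lintegral_swap this.aemeasurable]
  congr 1 with ξ
  rw [lintegral_const_mul]
  have := measurable_time hg ξ
  fun_prop

theorem duh_sq_le {g : ℝ → V3 → ℝ≥0∞} (hg : Measurable (Function.uncurry g)) (t : ℝ) (ξ : V3) :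
    duh g t ξ ^ 2 ≤ ∫⁻ s in Ioc 0 t, g s ξ ^ 2 :=
  lintegral_heat_sq_le (en_nonneg ξ) (measurable_time hg ξ)

theorem hn_one_duh_le {g : ℝ → V3 → ℝ≥0∞} (hg : Measurable (Function.uncurry g)) (t : ℝ) :
    hn 1 (duh g t) ≤ ∫⁻ s in Ioc 0 t, hn 1 (g s) := by
  rw [hn_lintegral_swap hg]
  unfold hn
  gcongr with ξ
  exact duh_sq_le hg t ξ

theorem lintegral_hn_three_duh_le {g : ℝ → V3 → ℝ≥0∞} (hg : Measurable (Function.uncurry g))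
    (T : ℝ) :
    ∫⁻ t in Ioc 0 T, hn 3 (duh g t) ≤ ∫⁻ s in Ioc 0 T, hn 1 (g s) := by
  rw [hn_lintegral_swap hg, hn_lintegral_swap (measurable_duh hg)]
  refine lintegral_mono fun ξ => ?_
  have hd := measurable_time (measurable_duh hg) ξ
  rw [show 3 = 1 + 2 from rfl, pow_add, mul_assoc, ← lintegral_const_mul _ (by fun_prop)]
  gcongr ee ξ ^ 1 * ?_
  exact lintegral_lintegral_heat_sq_le (en_nonneg ξ) (measurable_time hg ξ)

theorem lintegral_hn_two_sq_le {f : ℝ → V3 → ℝ≥0∞} (hf : Measurable (Function.uncurry f))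
    {S : Set ℝ} (hS : MeasurableSet S) {M : ℝ≥0∞} (h : ∀ t ∈ S, hn 1 (f t) ≤ M) :
    ∫⁻ t in S, hn 2 (f t) ^ 2 ≤ M * ∫⁻ t in S, hn 3 (f t) := by
  rw [← lintegral_const_mul _ (measurable_hn hf)]
  refine setLIntegral_mono' hS fun t ht => ?_
  refine (hn_two_sq_le (measurable_slice hf t)).trans ?_
  gcongr
  exact h t ht

theorem lintegral_hn_two_sq_duh_le {g : ℝ → V3 → ℝ≥0∞} (hg : Measurable (Function.uncurry g))
    (T : ℝ) :
    ∫⁻ t in Ioc 0 T, hn 2 (duh g t) ^ 2 ≤ (∫⁻ s in Ioc 0 T, hn 1 (g s)) ^ 2 := by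
  refine (lintegral_hn_two_sq_le (measurable_duh hg) measurableSet_Ioc
    (M := ∫⁻ s in Ioc 0 T, hn 1 (g s)) fun t ht => ?_).trans ?_
  · exact (hn_one_duh_le hg t).trans (lintegral_mono_set (Ioc_subset_Ioc_right ht.2))
  · rw [sq]
    gcongr _ * ?_
    exact lintegral_hn_three_duh_le hg T

/-- Heat flow of a nonnegative frequency profile. -/
def lin (a : V3 → ℝ≥0∞) (t : ℝ) (ξ : V3) : ℝ≥0∞ :=
  ENNReal.ofReal (Real.exp (-(t * en ξ ^ 2))) * a ξ

theorem measurable_lin {a : V3 → ℝ≥0∞} (ha : Measurable a) :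
    Measurable (Function.uncurry (lin a)) := by
  unfold lin Function.uncurry
  fun_prop

theorem lin_le (a : V3 → ℝ≥0∞) {t : ℝ} (ht : 0 ≤ t) (ξ : V3) : lin a t ξ ≤ a ξ := by
  refine mul_le_of_le_one_left' ?_
  rw [ENNReal.ofReal_le_one, Real.exp_le_one_iff]
  have : 0 ≤ t * en ξ ^ 2 := by positivity
  linarith

theorem lintegral_hn_three_lin_le {a : V3 → ℝ≥0∞} (ha : Measurable a) (T : ℝ) :
    ∫⁻ t in Ioc 0 T, hn 3 (lin a t) ≤ hn 1 a := by
  rw [hn_lintegral_swap (measurable_lin ha)]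
  unfold hn
  refine lintegral_mono fun ξ => ?_
  have hd := measurable_time (measurable_lin ha) ξ
  rw [show 3 = 1 + 2 from rfl, pow_add, mul_assoc, ← lintegral_const_mul _ (by fun_prop)]
  gcongr
  calc ∫⁻ t in Ioc 0 T, ee ξ ^ 2 * lin a t ξ ^ 2
      ≤ ∫⁻ t in Ioc 0 T, heatKer (en ξ ^ 2) t * a ξ ^ 2 := by
        refine setLIntegral_mono' measurableSet_Ioc fun t ht => ?_
        have h := heatKer_sub (b := en ξ ^ 2) ht.1.le
        rw [sub_zero] at h
        rw [h, ENNReal.ofReal_mul (by positivity), ENNReal.ofReal_pow (en_nonneg ξ), mul_assoc]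
        gcongr ee ξ ^ 2 * ?_
        calc lin a t ξ ^ 2 = lin a t ξ * lin a t ξ := sq _
          _ ≤ lin a t ξ * a ξ := mul_le_mul_right (lin_le a ht.1.le ξ) _
          _ = _ := by
            unfold lin
            ring
    _ ≤ ∫⁻ t, heatKer (en ξ ^ 2) t * a ξ ^ 2 := setLIntegral_le_lintegral _ _
    _ ≤ a ξ ^ 2 := by
        rw [lintegral_mul_const _ (by fun_prop)]
        exact mul_le_of_le_one_left' (lintegral_heatKer_le (by positivity))

theorem exists_lintegral_Ioc_lt {f : ℝ → ℝ≥0∞} {T : ℝ} (hT : 0 < T)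
    (h : ∫⁻ t in Ioc 0 T, f t ≠ ⊤) {ε : ℝ≥0∞} (hε : 0 < ε) :
    ∃ τ, 0 < τ ∧ τ ≤ T ∧ ∫⁻ t in Ioc 0 τ, f t < ε := by
  obtain ⟨d, hd, H⟩ := exists_pos_setLIntegral_lt_of_measure_lt h hε.ne'
  obtain ⟨r, hr0, hrd⟩ : ∃ r : ℝ, 0 < r ∧ ENNReal.ofReal r < d := by
    obtain ⟨r, hr0, hr⟩ := ENNReal.lt_iff_exists_nnreal_btwn.1 hd
    refine ⟨r, by simpa using hr0, by simpa using hr⟩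
  refine ⟨min r T, lt_min hr0 hT, min_le_right _ _, ?_⟩
  have := H (Ioc 0 (min r T)) ?_
  · rwa [Measure.restrict_restrict measurableSet_Ioc,
      inter_eq_self_of_subset_left (Ioc_subset_Ioc_right (min_le_right _ _))] at this
  · refine (Measure.restrict_apply_le _ _).trans_lt ?_
    rw [Real.volume_Ioc, sub_zero]
    exact (ENNReal.ofReal_le_ofReal (min_le_left _ _)).trans_lt hrd

theorem exists_lintegral_hn_two_sq_lin_lt {a : V3 → ℝ≥0∞} (ha : Measurable a)
    (h : hn 1 a ≠ ⊤) {ε : ℝ≥0∞} (hε : 0 < ε) :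
    ∃ τ, 0 < τ ∧ ∫⁻ t in Ioc 0 τ, hn 2 (lin a t) ^ 2 < ε := by
  have hfin : ∫⁻ t in Ioc 0 1, hn 2 (lin a t) ^ 2 ≠ ⊤ := by
    refine ne_top_of_le_ne_top (ENNReal.mul_ne_top h h) ((lintegral_hn_two_sq_le (measurable_lin ha)
      measurableSet_Ioc (M := hn 1 a) fun t ht => ?_).trans ?_)
    · exact hn_mono (lin_le a ht.1.le)
    · gcongr _ * ?_
      exact lintegral_hn_three_lin_le ha 1
  obtain ⟨τ, h0, -, h1⟩ := exists_lintegral_Ioc_lt one_pos hfin hε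
  exact ⟨τ, h0, h1⟩

theorem exists_sqrt_mul_hn_two_lin_lt {a : V3 → ℝ≥0∞} (ha : Measurable a)
    (h : hn 1 a ≠ ⊤) {ε : ℝ≥0∞} (hε : 0 < ε) :
    ∃ τ, 0 < τ ∧ ∀ t ∈ Ioc 0 τ, ENNReal.ofReal (Real.sqrt t) * hn 2 (lin a t) < ε := by
  have key : Tendsto (fun t : ℝ => ∫⁻ ξ, ENNReal.ofReal (Real.sqrt t) *
      (ee ξ ^ 2 * lin a t ξ ^ 2)) (𝓝[>] 0) (𝓝 (∫⁻ ξ : V3, 0)) := by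
    refine tendsto_lintegral_filter_of_dominated_convergence (fun ξ => ee ξ ^ 1 * a ξ ^ 2)
      ?_ ?_ h ?_
    · refine Eventually.of_forall fun t => ?_
      have := measurable_slice (measurable_lin ha) t
      fun_prop
    · filter_upwards [self_mem_nhdsWithin] with t ht
      refine ae_of_all _ fun ξ => ?_
      have ht : 0 < t := ht
      have h1 : Real.sqrt t * en ξ * (Real.exp (-(t * en ξ ^ 2))) ^ 2 ≤ 1 := by
        rw [← Real.exp_nat_mul]
        have hx : Real.sqrt t * en ξ ≤ Real.exp (2 * (t * en ξ ^ 2)) := by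
          have e1 : (Real.sqrt t * en ξ) ^ 2 = t * en ξ ^ 2 := by
            rw [mul_pow, Real.sq_sqrt ht.le]
          have := Real.add_one_le_exp (2 * (t * en ξ ^ 2))
          nlinarith [sq_nonneg (Real.sqrt t * en ξ - 1), sq_nonneg (Real.sqrt t * en ξ)]
        calc _ ≤ Real.exp (2 * (t * en ξ ^ 2)) * Real.exp ((2 : ℕ) * -(t * en ξ ^ 2)) := by
              gcongr
          _ = 1 := by
              rw [← Real.exp_add]
              simp
      calc ENNReal.ofReal (Real.sqrt t) * (ee ξ ^ 2 * lin a t ξ ^ 2)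
          = ENNReal.ofReal (Real.sqrt t * en ξ * (Real.exp (-(t * en ξ ^ 2))) ^ 2) *
            (ee ξ ^ 1 * a ξ ^ 2) := by
            have := en_nonneg ξ
            rw [ENNReal.ofReal_mul (by positivity), ENNReal.ofReal_mul (by positivity),
              ENNReal.ofReal_pow (by positivity)]
            unfold lin ee
            ring
        _ ≤ 1 * (ee ξ ^ 1 * a ξ ^ 2) := by
            gcongr
            exact ENNReal.ofReal_le_one.2 h1
        _ = _ := one_mul _
    · have hfin : ∀ᵐ ξ : V3, ee ξ ^ 1 * a ξ ^ 2 < ⊤ := ae_lt_top (by fun_prop) h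
      have h0 : ∀ᵐ η : V3, η ≠ 0 := by simp [ae_iff]
      filter_upwards [hfin, h0] with ξ hξ h0
      have hat : a ξ ≠ ⊤ := by
        intro hc
        rw [hc] at hξ
        simp [ee_ne_zero h0, ENNReal.mul_top] at hξ
      have hbd : Tendsto (fun t : ℝ => ENNReal.ofReal (Real.sqrt t) * (ee ξ ^ 2 * a ξ ^ 2))
          (𝓝[>] 0) (𝓝 0) := by
        have : Tendsto (fun t : ℝ => ENNReal.ofReal (Real.sqrt t)) (𝓝[>] 0) (𝓝 0) := by
          have h2 : Continuous fun t : ℝ => ENNReal.ofReal (Real.sqrt t) :=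
            ENNReal.continuous_ofReal.comp Real.continuous_sqrt
          simpa using (h2.tendsto 0).mono_left nhdsWithin_le_nhds
        have h3 := ENNReal.Tendsto.mul_const this (b := ee ξ ^ 2 * a ξ ^ 2)
          (Or.inr (by have := ee_ne_top ξ; finiteness))
        simpa using h3
      refine tendsto_of_tendsto_of_tendsto_of_le_of_le' tendsto_const_nhds hbd
        (Eventually.of_forall fun _ => zero_le) ?_
      filter_upwards [self_mem_nhdsWithin] with t ht
      gcongr
      exact lin_le a (le_of_lt ht) ξ
  rw [lintegral_zero] at key
  have := key.eventually (gt_mem_nhds hε)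
  obtain ⟨τ, hτ, H⟩ := (mem_nhdsGT_iff_exists_Ioc_subset).1 this
  refine ⟨τ, hτ, fun t ht => ?_⟩
  have := H ht
  rw [mem_ofPred_eq] at this
  rwa [lintegral_const_mul' _ _ ENNReal.ofReal_ne_top] at this

theorem exists_hn_one_tail_lt {a : V3 → ℝ≥0∞} (ha : Measurable a)
    (h : hn 1 a ≠ ⊤) {ε : ℝ≥0∞} (hε : 0 < ε) :
    ∃ J₀ : ℝ, ∀ J, J₀ ≤ J → ∫⁻ ξ, (if J ≤ en ξ then ee ξ * a ξ ^ 2 else 0) < ε := by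
  have key : Tendsto (fun J : ℝ => ∫⁻ ξ, (if J ≤ en ξ then ee ξ * a ξ ^ 2 else 0))
      atTop (𝓝 (∫⁻ ξ : V3, 0)) := by
    refine tendsto_lintegral_filter_of_dominated_convergence (fun ξ => ee ξ ^ 1 * a ξ ^ 2)
      ?_ ?_ h ?_
    · refine Eventually.of_forall fun t => ?_
      exact Measurable.ite (measurableSet_le measurable_const measurable_en) (by fun_prop)
        (by fun_prop)
    · refine Eventually.of_forall fun t => ae_of_all _ fun ξ => ?_
      split_ifs <;> simp
    · refine ae_of_all _ fun ξ => tendsto_const_nhds.congr' ?_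
      filter_upwards [eventually_gt_atTop (en ξ)] with J hJ
      rw [if_neg (not_le.2 hJ)]
  rw [lintegral_zero] at key
  exact eventually_atTop.1 (key.eventually (gt_mem_nhds hε))

theorem rpow_mul_exp_le {q x : ℝ} (hq : 0 ≤ q) (hq' : q ≤ 2) (hx : 0 ≤ x) :
    x ^ q * Real.exp (-x ^ 2) ≤ 3 := by
  have h1 : x ^ q ≤ 1 + x ^ 2 := by
    rcases le_total x 1 with h | h
    · exact (Real.rpow_le_one hx h hq).trans (by nlinarith [sq_nonneg x])
    · calc x ^ q ≤ x ^ (2 : ℝ) := Real.rpow_le_rpow_of_exponent_le h hq'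
        _ ≤ 1 + x ^ 2 := by
          rw [Real.rpow_two]
          linarith
  have h2 := Real.add_one_le_exp (x ^ 2)
  calc x ^ q * Real.exp (-x ^ 2) ≤ Real.exp (x ^ 2) * Real.exp (-x ^ 2) := by
        gcongr
        linarith
    _ = 1 := by
        rw [← Real.exp_add]
        simp
    _ ≤ 3 := by norm_num

theorem sqrt_mul_hn_two_duh_le {g : ℝ → V3 → ℝ≥0∞} (hg : Measurable (Function.uncurry g)) {t : ℝ}
    (ht : 0 < t) {A : ℝ≥0∞} (hA : ∀ s ∈ Ioc 0 t, ENNReal.ofReal s * hn 1 (g s) ≤ A) :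
    ENNReal.ofReal (Real.sqrt t) * hn 2 (duh g t) ≤ 1296 * A := by
  have hg' : Measurable fun q : ℝ × V3 => g q.1 q.2 := hg
  have hs (x : ℝ≥0∞) : (x ^ ((1 : ℝ) / 2)) ^ 2 = x := by
    rw [← ENNReal.rpow_natCast, ← ENNReal.rpow_mul]
    norm_num
  have hG : Measurable (Function.uncurry fun (s : ℝ) (ξ : V3) =>
      3 * (ee ξ ^ ((1 : ℝ) / 2) * g s ξ)) := by
    unfold Function.uncurry
    fun_prop
  have K := lintegral_kernel_sq_le (p := 3 / 4) (by norm_num) le_rfl ht hG (A := 9 * A) ?_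
  · have pt (ξ : V3) : ee ξ ^ 2 * duh g t ξ ^ 2 ≤ (∫⁻ s in Ioc 0 t,
        ENNReal.ofReal ((t - s) ^ (-(3 / 4 : ℝ))) * (3 * (ee ξ ^ ((1 : ℝ) / 2) * g s ξ))) ^ 2 := by
      rw [← mul_pow]
      gcongr
      unfold duh
      rw [← lintegral_const_mul' _ _ (ee_ne_top ξ), setLIntegral_congr Ioo_ae_eq_Ioc.symm,
        setLIntegral_congr Ioo_ae_eq_Ioc.symm]
      refine setLIntegral_mono' measurableSet_Ioo fun s hs' => ?_
      have hts : 0 < t - s := sub_pos.2 hs'.2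
      have he := en_nonneg ξ
      have hr : en ξ * Real.exp (-((t - s) * en ξ ^ 2)) * en ξ ≤
          (t - s) ^ (-(3 / 4 : ℝ)) * 3 * en ξ ^ ((1 : ℝ) / 2) := by
        have := rpow_mul_exp_le (q := 3 / 2) (x := Real.sqrt (t - s) * en ξ) (by norm_num)
          (by norm_num) (by positivity)
        rw [mul_pow, Real.sq_sqrt hts.le, Real.mul_rpow (by positivity) he, Real.sqrt_eq_rpow,
          ← Real.rpow_mul hts.le] at this
        norm_num at this
        calc en ξ * Real.exp (-((t - s) * en ξ ^ 2)) * en ξ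
            = (t - s) ^ (-(3 / 4 : ℝ)) * ((t - s) ^ (3 / 4 : ℝ) * en ξ ^ (3 / 2 : ℝ) *
              Real.exp (-((t - s) * en ξ ^ 2))) * en ξ ^ ((1 : ℝ) / 2) := by
              rw [Real.rpow_neg hts.le]
              have e1 : en ξ ^ (3 / 2 : ℝ) * en ξ ^ ((1 : ℝ) / 2) = en ξ * en ξ := by
                rw [← Real.rpow_add_of_nonneg he (by norm_num) (by norm_num), ← sq]
                norm_num
              have e2 : (t - s) ^ (3 / 4 : ℝ) ≠ 0 := by positivity
              field_simp
              rw [e1]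
              ring
          _ ≤ _ := by gcongr
      calc ee ξ * (ENNReal.ofReal (Real.exp (-((t - s) * en ξ ^ 2))) * (ee ξ * g s ξ))
          = ENNReal.ofReal (en ξ * Real.exp (-((t - s) * en ξ ^ 2)) * en ξ) * g s ξ := by
            rw [ENNReal.ofReal_mul (by positivity), ENNReal.ofReal_mul (by positivity)]
            unfold ee
            ring
        _ ≤ ENNReal.ofReal ((t - s) ^ (-(3 / 4 : ℝ)) * 3 * en ξ ^ ((1 : ℝ) / 2)) * g s ξ := by
            gcongr
        _ = _ := by
            rw [ENNReal.ofReal_mul (by positivity), ENNReal.ofReal_mul (by positivity)]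
            unfold ee
            rw [ENNReal.ofReal_rpow_of_nonneg he (by norm_num)]
            simp
            ring
    calc ENNReal.ofReal (Real.sqrt t) * hn 2 (duh g t)
        ≤ ENNReal.ofReal (Real.sqrt t) * (ENNReal.ofReal (144 * t ^ (1 - 2 * (3 / 4 : ℝ))) *
          (9 * A)) := by
          gcongr
          exact (lintegral_mono pt).trans K
      _ = ENNReal.ofReal (Real.sqrt t * (144 * t ^ (1 - 2 * (3 / 4 : ℝ)))) * (9 * A) := by
          rw [ENNReal.ofReal_mul (Real.sqrt_nonneg t), mul_assoc]
      _ = 1296 * A := by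
          have : Real.sqrt t * (144 * t ^ (1 - 2 * (3 / 4 : ℝ))) = 144 := by
            rw [show 1 - 2 * (3 / 4 : ℝ) = -(1 / 2) by norm_num, Real.rpow_neg ht.le,
              ← Real.sqrt_eq_rpow]
            have : Real.sqrt t ≠ 0 := (Real.sqrt_pos.2 ht).ne'
            field_simp
          rw [this, ← mul_assoc]
          norm_num
  · intro s hs'
    calc ENNReal.ofReal s * ∫⁻ ξ, (3 * (ee ξ ^ ((1 : ℝ) / 2) * g s ξ)) ^ 2
        = ENNReal.ofReal s * ∫⁻ ξ, 9 * (ee ξ ^ 1 * g s ξ ^ 2) := by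
          congr 2 with ξ
          rw [mul_pow, mul_pow, hs, pow_one]
          norm_num
      _ = 9 * (ENNReal.ofReal s * hn 1 (g s)) := by
          rw [lintegral_const_mul' _ _ (by norm_num)]
          unfold hn
          ring
      _ ≤ 9 * A := by
          gcongr
          exact hA s hs'

theorem ENNReal.iSup_mul_iSup_of_monotone {f g : ℕ → ℝ≥0∞} (hf : Monotone f) (hg : Monotone g) :
    (⨆ n, f n) * ⨆ n, g n = ⨆ n, f n * g n := by
  refine le_antisymm ?_ (iSup_le fun n => mul_le_mul' (le_iSup f n) (le_iSup g n))
  rw [ENNReal.iSup_mul]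
  refine iSup_le fun i => ?_
  rw [ENNReal.mul_iSup]
  refine iSup_le fun j => ?_
  exact le_iSup_of_le (max i j)
    (mul_le_mul' (hf (le_max_left i j)) (hg (le_max_right i j)))

theorem hn_iSup {k : ℕ} {f : ℕ → V3 → ℝ≥0∞} (hf : ∀ n, Measurable (f n)) (hm : Monotone f) :
    hn k (fun ξ => ⨆ n, f n ξ) = ⨆ n, hn k (f n) := by
  unfold hn
  rw [← lintegral_iSup (fun n => by have := hf n; fun_prop)]
  · simp_rw [ENNReal.iSup_pow, ENNReal.mul_iSup]
  · intro m n h ξ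
    have := hm h ξ
    dsimp only
    gcongr

theorem conv_mono {f f' g g' : V3 → ℝ≥0∞} (hf : ∀ ξ, f ξ ≤ f' ξ) (hg : ∀ ξ, g ξ ≤ g' ξ) (ξ : V3) :
    conv f g ξ ≤ conv f' g' ξ :=
  lintegral_mono fun η => mul_le_mul' (hf η) (hg _)

theorem duh_mono {g g' : ℝ → V3 → ℝ≥0∞} (t : ℝ) (ξ : V3) (h : ∀ s ∈ Ioc 0 t, g s ξ ≤ g' s ξ) :
    duh g t ξ ≤ duh g' t ξ := by
  refine setLIntegral_mono' measurableSet_Ioc fun s hs => ?_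
  gcongr
  exact h s hs

theorem measurable_conv_time {f g : ℝ → V3 → ℝ≥0∞} (hf : Measurable (Function.uncurry f))
    (hg : Measurable (Function.uncurry g)) :
    Measurable (Function.uncurry fun t => conv (f t) (g t)) := by
  have : Measurable fun p : (ℝ × V3) × V3 => f p.1.1 p.2 * g p.1.1 (p.1.2 - p.2) := by
    have h1 : Measurable fun p : (ℝ × V3) × V3 => f p.1.1 p.2 :=
      hf.comp (f := fun p : (ℝ × V3) × V3 => (p.1.1, p.2)) (by fun_prop)
    have h2 : Measurable fun p : (ℝ × V3) × V3 => g p.1.1 (p.1.2 - p.2) :=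
      hg.comp (f := fun p : (ℝ × V3) × V3 => (p.1.1, p.1.2 - p.2)) (by fun_prop)
    exact h1.mul h2
  exact Measurable.lintegral_prod_right' (ν := volume) this

/-- Bilinear forcing term of the majorant equation. -/
def forc (K : ℝ≥0∞) (f g : ℝ → V3 → ℝ≥0∞) (s : ℝ) (ξ : V3) : ℝ≥0∞ := K * conv (f s) (g s) ξ

theorem measurable_forc {K : ℝ≥0∞} {f g : ℝ → V3 → ℝ≥0∞} (hf : Measurable (Function.uncurry f))
    (hg : Measurable (Function.uncurry g)) : Measurable (Function.uncurry (forc K f g)) :=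
  (measurable_conv_time hf hg).const_mul K

theorem hn_forc_le {K : ℝ≥0∞} (hK : K ≠ ⊤) {f g : ℝ → V3 → ℝ≥0∞}
    (hf : Measurable (Function.uncurry f)) (hg : Measurable (Function.uncurry g)) (s : ℝ) :
    hn 1 (forc K f g s) ≤ K ^ 2 * prodConst * (hn 2 (f s) * hn 2 (g s)) := by
  unfold forc
  rw [hn_const_mul hK, mul_assoc]
  gcongr
  exact hn_conv_le (measurable_slice hf s) (measurable_slice hg s)

/-- Right-hand side of the majorant equation. -/
def majStep (K : ℝ≥0∞) (a : V3 → ℝ≥0∞) (f : ℝ → V3 → ℝ≥0∞) (t : ℝ) (ξ : V3) : ℝ≥0∞ :=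
  lin a t ξ + duh (forc K f f) t ξ

theorem measurable_majStep {K : ℝ≥0∞} {a : V3 → ℝ≥0∞} (ha : Measurable a)
    {f : ℝ → V3 → ℝ≥0∞}
    (hf : Measurable (Function.uncurry f)) : Measurable (Function.uncurry (majStep K a f)) :=
  (measurable_lin ha).add (measurable_duh (measurable_forc hf hf))

/-- Picard iterates of the majorant equation. -/
def maj (K : ℝ≥0∞) (a : V3 → ℝ≥0∞) : ℕ → ℝ → V3 → ℝ≥0∞
  | 0 => fun _ _ => 0
  | n + 1 => majStep K a (maj K a n)

theorem measurable_maj {K : ℝ≥0∞} {a : V3 → ℝ≥0∞} (ha : Measurable a) (n : ℕ) :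
    Measurable (Function.uncurry (maj K a n)) := by
  induction n with
  | zero => exact measurable_const
  | succ n ih => exact measurable_majStep ha ih

theorem majStep_mono {K : ℝ≥0∞} {a : V3 → ℝ≥0∞} {f g : ℝ → V3 → ℝ≥0∞}
    (h : ∀ t ξ, f t ξ ≤ g t ξ) (t : ℝ) (ξ : V3) : majStep K a f t ξ ≤ majStep K a g t ξ := by
  unfold majStep
  gcongr
  refine duh_mono t ξ fun s _ => ?_
  unfold forc
  gcongr
  exact conv_mono (h s) (h s) ξ

theorem monotone_maj (K : ℝ≥0∞) (a : V3 → ℝ≥0∞) : Monotone (maj K a) := by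
  refine monotone_nat_of_le_succ fun n => ?_
  induction n with
  | zero => exact fun t ξ => zero_le
  | succ n ih => exact fun t ξ => majStep_mono (fun t ξ => ih t ξ) t ξ

/-- The minimal solution of the majorant equation. -/
def majSup (K : ℝ≥0∞) (a : V3 → ℝ≥0∞) (t : ℝ) (ξ : V3) : ℝ≥0∞ := ⨆ n, maj K a n t ξ

theorem measurable_majSup {K : ℝ≥0∞} {a : V3 → ℝ≥0∞} (ha : Measurable a) :
    Measurable (Function.uncurry (majSup K a)) := by
  exact Measurable.iSup fun n => measurable_maj ha n

theorem maj_le_majSup (K : ℝ≥0∞) (a : V3 → ℝ≥0∞) (n : ℕ) (t : ℝ) (ξ : V3) :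
    maj K a n t ξ ≤ majSup K a t ξ := le_iSup (fun n => maj K a n t ξ) n

theorem majSup_eq {K : ℝ≥0∞} {a : V3 → ℝ≥0∞} (ha : Measurable a) (t : ℝ) (ξ : V3) :
    majSup K a t ξ = majStep K a (majSup K a) t ξ := by
  have hm := monotone_maj K a
  have hconv (s : ℝ) : conv (majSup K a s) (majSup K a s) ξ
      = ⨆ n, conv (maj K a n s) (maj K a n s) ξ := by
    unfold conv
    rw [← lintegral_iSup]
    · refine lintegral_congr fun η => ?_
      unfold majSup
      rw [ENNReal.iSup_mul_iSup_of_monotone (fun m n h => hm h s η) (fun m n h => hm h s _)]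
    · intro n
      have := measurable_slice (measurable_maj (K := K) ha n) s
      fun_prop
    · intro m n h η
      exact mul_le_mul' (hm h s η) (hm h s _)
  have hforc (s : ℝ) : forc K (majSup K a) (majSup K a) s ξ
      = ⨆ n, forc K (maj K a n) (maj K a n) s ξ := by
    unfold forc
    rw [hconv, ENNReal.mul_iSup]
  have hfm {m n : ℕ} (h : m ≤ n) (s : ℝ) : forc K (maj K a m) (maj K a m) s ξ
      ≤ forc K (maj K a n) (maj K a n) s ξ := by
    unfold forc
    gcongr
    exact conv_mono (hm h s) (hm h s) ξ
  have hduh : duh (forc K (majSup K a) (majSup K a)) t ξ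
      = ⨆ n, duh (forc K (maj K a n) (maj K a n)) t ξ := by
    unfold duh
    rw [← lintegral_iSup]
    · refine lintegral_congr fun s => ?_
      rw [hforc, ENNReal.mul_iSup, ENNReal.mul_iSup]
    · intro n
      have := measurable_time (measurable_forc (K := K) (measurable_maj (K := K) ha n)
        (measurable_maj (K := K) ha n)) ξ
      fun_prop
    · intro m n h s
      have := hfm h s
      dsimp only
      gcongr
  unfold majStep
  rw [hduh, ENNReal.add_iSup]
  unfold majSup
  refine le_antisymm (iSup_le fun n => ?_) (iSup_le fun n => le_iSup_of_le (n + 1) le_rfl)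
  exact le_iSup_of_le n (hm n.le_succ t ξ)

theorem hn_majSup {K : ℝ≥0∞} {a : V3 → ℝ≥0∞} (ha : Measurable a) (k : ℕ) (t : ℝ) :
    hn k (majSup K a t) = ⨆ n, hn k (maj K a n t) :=
  hn_iSup (fun n => measurable_slice (measurable_maj ha n) t)
    fun _ _ h => monotone_maj K a h t

theorem lintegral_hn_two_sq_majSup {K : ℝ≥0∞} {a : V3 → ℝ≥0∞} (ha : Measurable a) (T : ℝ) :
    ∫⁻ t in Ioc 0 T, hn 2 (majSup K a t) ^ 2 = ⨆ n, ∫⁻ t in Ioc 0 T, hn 2 (maj K a n t) ^ 2 := by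
  rw [← lintegral_iSup]
  · simp_rw [hn_majSup ha, ENNReal.iSup_pow]
  · intro n
    have := measurable_hn (k := 2) (measurable_maj (K := K) ha n)
    fun_prop
  · intro m n h t
    have : hn 2 (maj K a m t) ≤ hn 2 (maj K a n t) := hn_mono (monotone_maj K a h t)
    dsimp only
    gcongr

theorem lintegral_hn_forc_le {K : ℝ≥0∞} (hK : K ≠ ⊤) {f : ℝ → V3 → ℝ≥0∞}
    (hf : Measurable (Function.uncurry f)) (T : ℝ) :
    ∫⁻ s in Ioc 0 T, hn 1 (forc K f f s)
      ≤ K ^ 2 * prodConst * ∫⁻ s in Ioc 0 T, hn 2 (f s) ^ 2 := by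
  rw [← lintegral_const_mul' _ _ (by have := prodConst_ne_top; finiteness)]
  refine lintegral_mono fun s => ?_
  rw [sq (hn 2 (f s))]
  exact hn_forc_le hK hf hf s

theorem hn_one_majStep_le {K : ℝ≥0∞} (hK : K ≠ ⊤) {a : V3 → ℝ≥0∞} (ha : Measurable a)
    {f : ℝ → V3 → ℝ≥0∞}
    (hf : Measurable (Function.uncurry f)) {t : ℝ} (ht : 0 ≤ t) :
    hn 1 (majStep K a f t)
      ≤ 2 * hn 1 a + 2 * (K ^ 2 * prodConst * ∫⁻ s in Ioc 0 t, hn 2 (f s) ^ 2) := by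
  refine (hn_add_le (measurable_slice (measurable_lin ha) t)).trans ?_
  gcongr 2 * ?_ + 2 * ?_
  · exact hn_mono (lin_le a ht)
  · exact (hn_one_duh_le (measurable_forc hf hf) t).trans (lintegral_hn_forc_le hK hf t)

theorem lintegral_hn_three_majStep_le {K : ℝ≥0∞} (hK : K ≠ ⊤) {a : V3 → ℝ≥0∞} (ha : Measurable a)
    {f : ℝ → V3 → ℝ≥0∞}
    (hf : Measurable (Function.uncurry f)) (T : ℝ) :
    ∫⁻ t in Ioc 0 T, hn 3 (majStep K a f t)
      ≤ 2 * hn 1 a + 2 * (K ^ 2 * prodConst * ∫⁻ s in Ioc 0 T, hn 2 (f s) ^ 2) := by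
  have h1 := measurable_hn (k := 3) (measurable_lin ha)
  calc _ ≤ ∫⁻ t in Ioc 0 T, (2 * hn 3 (lin a t) + 2 * hn 3 (duh (forc K f f) t)) :=
        lintegral_mono fun t => hn_add_le (measurable_slice (measurable_lin ha) t)
    _ = 2 * (∫⁻ t in Ioc 0 T, hn 3 (lin a t)) +
        2 * ∫⁻ t in Ioc 0 T, hn 3 (duh (forc K f f) t) := by
        rw [lintegral_add_left (by fun_prop), lintegral_const_mul' _ _ (by norm_num),
          lintegral_const_mul' _ _ (by norm_num)]
    _ ≤ _ := by
        gcongr 2 * ?_ + 2 * ?_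
        · exact lintegral_hn_three_lin_le ha T
        · exact (lintegral_hn_three_duh_le (measurable_forc hf hf) T).trans
            (lintegral_hn_forc_le hK hf T)

theorem lintegral_hn_two_sq_majStep_le {K : ℝ≥0∞} (hK : K ≠ ⊤) {a : V3 → ℝ≥0∞} (ha : Measurable a)
    {f : ℝ → V3 → ℝ≥0∞}
    (hf : Measurable (Function.uncurry f)) (T : ℝ) :
    ∫⁻ t in Ioc 0 T, hn 2 (majStep K a f t) ^ 2
      ≤ 8 * (∫⁻ t in Ioc 0 T, hn 2 (lin a t) ^ 2) +
        8 * (K ^ 2 * prodConst * ∫⁻ s in Ioc 0 T, hn 2 (f s) ^ 2) ^ 2 := by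
  have h1 := measurable_hn (k := 2) (measurable_lin ha)
  calc _ ≤ ∫⁻ t in Ioc 0 T, (8 * hn 2 (lin a t) ^ 2 + 8 * hn 2 (duh (forc K f f) t) ^ 2) := by
        refine lintegral_mono fun t => ?_
        calc hn 2 (majStep K a f t) ^ 2
            ≤ (2 * hn 2 (lin a t) + 2 * hn 2 (duh (forc K f f) t)) ^ 2 := by
              gcongr
              exact hn_add_le (measurable_slice (measurable_lin ha) t)
          _ ≤ _ := (ENNReal.add_sq_le_two_mul _ _).trans (le_of_eq (by ring))
    _ = 8 * (∫⁻ t in Ioc 0 T, hn 2 (lin a t) ^ 2) +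
        8 * ∫⁻ t in Ioc 0 T, hn 2 (duh (forc K f f) t) ^ 2 := by
        rw [lintegral_add_left (by fun_prop), lintegral_const_mul' _ _ (by norm_num),
          lintegral_const_mul' _ _ (by norm_num)]
    _ ≤ _ := by
        gcongr _ + _ * ?_
        refine (lintegral_hn_two_sq_duh_le (measurable_forc hf hf) T).trans ?_
        gcongr ?_ ^ 2
        exact lintegral_hn_forc_le hK hf T

theorem sqrt_mul_hn_two_majStep_le {K : ℝ≥0∞} (hK : K ≠ ⊤) {a : V3 → ℝ≥0∞} (ha : Measurable a)
    {f : ℝ → V3 → ℝ≥0∞}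
    (hf : Measurable (Function.uncurry f)) {t : ℝ} (ht : 0 < t) {κ : ℝ≥0∞}
    (hκ : ∀ s ∈ Ioc 0 t, ENNReal.ofReal (Real.sqrt s) * hn 2 (f s) ≤ κ) :
    ENNReal.ofReal (Real.sqrt t) * hn 2 (majStep K a f t)
      ≤ 2 * (ENNReal.ofReal (Real.sqrt t) * hn 2 (lin a t)) +
        2592 * (K ^ 2 * prodConst * κ ^ 2) := by
  have hA : ∀ s ∈ Ioc 0 t, ENNReal.ofReal s * hn 1 (forc K f f s)
      ≤ K ^ 2 * prodConst * κ ^ 2 := by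
    intro s hs
    calc ENNReal.ofReal s * hn 1 (forc K f f s)
        ≤ ENNReal.ofReal s * (K ^ 2 * prodConst * (hn 2 (f s) * hn 2 (f s))) := by
          gcongr
          exact hn_forc_le hK hf hf s
      _ = K ^ 2 * prodConst * (ENNReal.ofReal (Real.sqrt s) * hn 2 (f s)) ^ 2 := by
          nth_rw 1 [← Real.sq_sqrt hs.1.le]
          rw [ENNReal.ofReal_pow (Real.sqrt_nonneg s)]
          ring
      _ ≤ _ := by
          gcongr
          exact hκ s hs
  calc _ ≤ ENNReal.ofReal (Real.sqrt t) *
        (2 * hn 2 (lin a t) + 2 * hn 2 (duh (forc K f f) t)) := by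
        gcongr
        exact hn_add_le (measurable_slice (measurable_lin ha) t)
    _ = 2 * (ENNReal.ofReal (Real.sqrt t) * hn 2 (lin a t)) +
        2 * (ENNReal.ofReal (Real.sqrt t) * hn 2 (duh (forc K f f) t)) := by ring
    _ ≤ 2 * (ENNReal.ofReal (Real.sqrt t) * hn 2 (lin a t)) +
        2 * (1296 * (K ^ 2 * prodConst * κ ^ 2)) := by
        gcongr _ + 2 * ?_
        exact sqrt_mul_hn_two_duh_le (measurable_forc hf hf) ht hA
    _ = _ := by ring

theorem exists_small_quadratic {D : ℝ≥0∞} (hD : D ≠ ⊤) {ε : ℝ≥0∞} (hε : 0 < ε) :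
    ∃ x : ℝ≥0∞, 0 < x ∧ x ≤ ε ∧ x ≠ ⊤ ∧ x / 2 + D * x ^ 2 ≤ x := by
  refine ⟨min (min ε 1) (2 * D + 1)⁻¹, ?_, ?_, ?_, ?_⟩
  · refine lt_min (lt_min hε one_pos) ?_
    rw [ENNReal.inv_pos]
    finiteness
  · exact (min_le_left _ _).trans (min_le_left _ _)
  · exact ne_top_of_le_ne_top ENNReal.one_ne_top ((min_le_left _ _).trans (min_le_right _ _))
  · set x := min (min ε 1) (2 * D + 1)⁻¹
    have hx : D * x ≤ 1 / 2 := by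
      have h1 : 2 * D * x ≤ 1 := by
        calc 2 * D * x ≤ (2 * D + 1) * (2 * D + 1)⁻¹ := by
              gcongr
              · exact le_self_add
              · exact min_le_right _ _
          _ ≤ 1 := ENNReal.mul_inv_le_one _
      rw [ENNReal.le_div_iff_mul_le (by norm_num) (by norm_num)]
      calc D * x * 2 = 2 * D * x := by ring
        _ ≤ 1 := h1
    calc x / 2 + D * x ^ 2 = x / 2 + D * x * x := by ring
      _ ≤ x / 2 + 1 / 2 * x := by gcongr
      _ = x := by
          rw [one_div, mul_comm, ← div_eq_mul_inv, ENNReal.add_halves]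

theorem exists_majSup_small {K : ℝ≥0∞} (hK : K ≠ ⊤) {a : V3 → ℝ≥0∞} (ha : Measurable a)
    (h : hn 1 a ≠ ⊤) {ε : ℝ≥0∞} (hε : 0 < ε) :
    ∃ τ, 0 < τ ∧ ∫⁻ t in Ioc 0 τ, hn 2 (majSup K a t) ^ 2 ≠ ⊤ ∧
      ∀ t ∈ Ioc 0 τ, ENNReal.ofReal (Real.sqrt t) * hn 2 (majSup K a t) ≤ ε := by
  set D := K ^ 2 * prodConst with hD
  have hDt : D ≠ ⊤ := by
    have := prodConst_ne_top
    rw [hD]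
    finiteness
  obtain ⟨x, hx0, hxε, hxt, hx⟩ := exists_small_quadratic (D := 8 * D ^ 2) (by finiteness) hε
  obtain ⟨y, hy0, hyε, hyt, hy⟩ := exists_small_quadratic (D := 2592 * D) (by finiteness) hε
  obtain ⟨τ₁, h1, H1⟩ := exists_lintegral_hn_two_sq_lin_lt ha h (ε := x / 16)
    (ENNReal.div_pos hx0.ne' (by norm_num))
  obtain ⟨τ₂, h2, H2⟩ := exists_sqrt_mul_hn_two_lin_lt ha h (ε := y / 4)
    (ENNReal.div_pos hy0.ne' (by norm_num))
  have h16 (x : ℝ≥0∞) : 8 * (x / 16) = x / 2 := by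
    rw [div_eq_mul_inv, div_eq_mul_inv, mul_left_comm]
    congr 1
    rw [show (16 : ℝ≥0∞) = 8 * 2 by norm_num, ENNReal.mul_inv (by simp) (by simp), ← mul_assoc,
      ENNReal.mul_inv_cancel (by norm_num) (by norm_num), one_mul]
  have h4 (x : ℝ≥0∞) : 2 * (x / 4) = x / 2 := by
    rw [div_eq_mul_inv, div_eq_mul_inv, mul_left_comm]
    congr 1
    rw [show (4 : ℝ≥0∞) = 2 * 2 by norm_num, ENNReal.mul_inv (by simp) (by simp), ← mul_assoc,
      ENNReal.mul_inv_cancel (by norm_num) (by norm_num), one_mul]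
  refine ⟨min τ₁ τ₂, lt_min h1 h2, ?_, ?_⟩
  · rw [lintegral_hn_two_sq_majSup ha]
    refine ne_top_of_le_ne_top hxt (iSup_le fun n => ?_)
    induction n with
    | zero => simp [maj, hn]
    | succ n ih =>
      refine (lintegral_hn_two_sq_majStep_le hK ha (measurable_maj ha n) _).trans ?_
      calc _ ≤ 8 * (x / 16) + 8 * (D * x) ^ 2 := by
            gcongr 8 * ?_ + 8 * (_ * ?_) ^ 2
            exact (lintegral_mono_set (Ioc_subset_Ioc_right (min_le_left _ _))).trans H1.le
        _ = x / 2 + 8 * D ^ 2 * x ^ 2 := by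
            rw [h16]
            ring
        _ ≤ x := hx
  · intro t ht
    rw [hn_majSup ha, ENNReal.mul_iSup]
    refine (iSup_le fun n => ?_).trans hyε
    induction n generalizing t with
    | zero => simp [maj, hn]
    | succ n ih =>
      refine (sqrt_mul_hn_two_majStep_le hK ha (measurable_maj ha n) ht.1 (κ := y)
        fun s hs => ih s ⟨hs.1, hs.2.trans ht.2⟩).trans ?_
      calc _ ≤ 2 * (y / 4) + 2592 * (D * y ^ 2) := by
            gcongr
            exact (H2 t ⟨ht.1, ht.2.trans (min_le_right _ _)⟩).le
        _ = y / 2 + 2592 * D * y ^ 2 := by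
            rw [h4]
            ring
        _ ≤ y := hy

/-- Sum of the absolute values of the coefficients. -/
def coefSum (α : Coeffs) : ℝ := ∑ j, ∑ m, ∑ n, ∑ p, ∑ k, ∑ l, |α j m n p k l|

theorem coefSum_nonneg (α : Coeffs) : 0 ≤ coefSum α := by
  unfold coefSum
  positivity

/-- A bound for the bilinear symbol, normalised to be at least one. -/
def symBound (α : Coeffs) : ℝ≥0∞ :=
  ENNReal.ofReal (1 + 27 * coefSum α)

theorem symBound_ne_top (α : Coeffs) : symBound α ≠ ⊤ := ENNReal.ofReal_ne_top

theorem symBound_ne_zero (α : Coeffs) : symBound α ≠ 0 := by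
  have := coefSum_nonneg α
  rw [symBound, ne_eq, ENNReal.ofReal_eq_zero, not_le]
  linarith

theorem abs_qsym_le (α : Coeffs) (j m k l : Fin 3) (ξ : V3) :
    |qsym α j m k l ξ| ≤ coefSum α := by
  have h1 : |qsym α j m k l ξ| ≤ ∑ n, ∑ p, |α j m n p k l| := by
    unfold qsym
    refine (Finset.abs_sum_le_sum_abs _ _).trans (Finset.sum_le_sum fun n _ => ?_)
    refine (Finset.abs_sum_le_sum_abs _ _).trans (Finset.sum_le_sum fun p _ => ?_)
    rw [abs_div, abs_mul, abs_of_nonneg (sq_nonneg (en ξ)), abs_mul]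
    refine div_le_of_le_mul₀ (sq_nonneg _) (abs_nonneg _) ?_
    rw [sq]
    refine mul_le_mul_of_nonneg_left ?_ (abs_nonneg _)
    exact mul_le_mul (abs_le_en ξ n) (abs_le_en ξ p) (abs_nonneg _) (en_nonneg ξ)
  refine h1.trans ?_
  calc ∑ n, ∑ p, |α j m n p k l| ≤ ∑ n, ∑ p, ∑ k, ∑ l, |α j m n p k l| := by
        gcongr with n _ p _
        refine le_trans ?_ (Finset.single_le_sum
          (f := fun k => ∑ l, |α j m n p k l|) (fun _ _ => by positivity) (Finset.mem_univ k))
        exact Finset.single_le_sum (f := fun l => |α j m n p k l|) (fun _ _ => by positivity)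
          (Finset.mem_univ l)
    _ ≤ ∑ m, ∑ n, ∑ p, ∑ k, ∑ l, |α j m n p k l| :=
        Finset.single_le_sum (f := fun m => ∑ n, ∑ p, ∑ k, ∑ l, |α j m n p k l|)
          (fun _ _ => by positivity) (Finset.mem_univ m)
    _ ≤ _ := Finset.single_le_sum (f := fun j => ∑ m, ∑ n, ∑ p, ∑ k, ∑ l, |α j m n p k l|)
          (fun _ _ => by positivity) (Finset.mem_univ j)

/-- The linear combination defining `Qhat`, applied to arbitrary convolution values. -/
def qComb (α : Coeffs) (I : Fin 3 → Fin 3 → ℂ) (ξ : V3) (j : Fin 3) : ℂ :=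
  ∑ k : Fin 3, ∑ l : Fin 3, ∑ m : Fin 3,
    (qsym α j m k l ξ : ℂ) * (Complex.I * (ξ m : ℂ)) *
      ((((2 * Real.pi) ^ (3 : ℕ))⁻¹ : ℝ) : ℂ) * I k l

theorem Qhat_eq_qComb (α : Coeffs) (U W : V3 → Fin 3 → ℂ) (ξ : V3) (j : Fin 3) :
    Qhat α U W ξ j = qComb α (fun k l => ∫ η : V3, U η k * W (ξ - η) l) ξ j := rfl

theorem qComb_sub (α : Coeffs) (I I' : Fin 3 → Fin 3 → ℂ) (ξ : V3) (j : Fin 3) :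
    qComb α I ξ j - qComb α I' ξ j = qComb α (fun k l => I k l - I' k l) ξ j := by
  simp only [qComb, ← Finset.sum_sub_distrib, mul_sub]

theorem enorm_qComb_le (α : Coeffs) {I : Fin 3 → Fin 3 → ℂ} {B : ℝ≥0∞} (ξ : V3)
    (h : ∀ k l, ‖I k l‖ₑ ≤ B) (j : Fin 3) : ‖qComb α I ξ j‖ₑ ≤ symBound α * (ee ξ * B) := by
  set S := coefSum α with hS
  have hS0 : 0 ≤ S := coefSum_nonneg α
  have hpi : ((2 * Real.pi) ^ (3 : ℕ))⁻¹ ≤ 1 := by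
    refine inv_le_one_of_one_le₀ (one_le_pow₀ ?_)
    linarith [Real.pi_gt_three]
  have ht (k l m : Fin 3) : ‖(qsym α j m k l ξ : ℂ) * (Complex.I * (ξ m : ℂ)) *
      ((((2 * Real.pi) ^ (3 : ℕ))⁻¹ : ℝ) : ℂ) * I k l‖ₑ ≤ ENNReal.ofReal S * (ee ξ * B) := by
    rw [enorm_mul, ← mul_assoc (ENNReal.ofReal S)]
    refine mul_le_mul' ?_ (h k l)
    rw [← ofReal_norm, ee, ← ENNReal.ofReal_mul hS0]
    refine ENNReal.ofReal_le_ofReal ?_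
    rw [norm_mul, norm_mul, norm_mul, Complex.norm_I, one_mul, Complex.norm_real,
      Complex.norm_real, Complex.norm_real, Real.norm_eq_abs, Real.norm_eq_abs, Real.norm_eq_abs,
      abs_of_nonneg (a := ((2 * Real.pi) ^ (3 : ℕ))⁻¹) (by positivity)]
    calc _ ≤ S * en ξ * 1 := by
          have := en_nonneg ξ
          gcongr
          · exact abs_qsym_le α j m k l ξ
          · exact abs_le_en ξ m
      _ = S * en ξ := mul_one _
  calc ‖qComb α I ξ j‖ₑ ≤ ∑ k : Fin 3, ∑ l : Fin 3, ∑ m : Fin 3, ENNReal.ofReal S * (ee ξ * B) := by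
        refine (enorm_sum_le _ _).trans (Finset.sum_le_sum fun k _ => ?_)
        refine (enorm_sum_le _ _).trans (Finset.sum_le_sum fun l _ => ?_)
        exact (enorm_sum_le _ _).trans (Finset.sum_le_sum fun m _ => ht k l m)
    _ = ENNReal.ofReal (27 * S) * (ee ξ * B) := by
        rw [ENNReal.ofReal_mul (by norm_num)]
        simp only [Finset.sum_const, Finset.card_univ, Fintype.card_fin, nsmul_eq_mul]
        norm_num
        ring
    _ ≤ _ := by
        unfold symBound
        gcongr
        linarith

/-- The pointwise size of a vector field. -/
def mag (u : V3 → Fin 3 → ℂ) (ξ : V3) : ℝ≥0∞ := ‖u ξ‖ₑ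

theorem enorm_apply_le_mag (u : V3 → Fin 3 → ℂ) (ξ : V3) (j : Fin 3) : ‖u ξ j‖ₑ ≤ mag u ξ := by
  rw [mag, ← ofReal_norm, ← ofReal_norm]
  exact ENNReal.ofReal_le_ofReal (norm_le_pi_norm _ _)

theorem enorm_pi_le {v : Fin 3 → ℂ} {B : ℝ≥0∞} (h : ∀ j, ‖v j‖ₑ ≤ B) : ‖v‖ₑ ≤ B := by
  rcases eq_or_ne B ⊤ with rfl | hB
  · exact le_top
  lift B to NNReal using hB
  simp only [enorm_le_coe] at h ⊢
  exact pi_nnnorm_le_iff.2 h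

theorem measurable_mag {u : V3 → Fin 3 → ℂ} (hu : ∀ j, Measurable fun ξ => u ξ j) :
    Measurable (mag u) := (measurable_pi_lambda _ hu).enorm

theorem measurable_mag_time {U : ℝ → V3 → Fin 3 → ℂ} (hU : MeasVF U) :
    Measurable (Function.uncurry fun t => mag (U t)) :=
  (measurable_pi_lambda _ hU : Measurable fun p : ℝ × V3 => U p.1 p.2).enorm

theorem enorm_Qhat_le (α : Coeffs) (U W : V3 → Fin 3 → ℂ) (ξ : V3) (j : Fin 3) :
    ‖Qhat α U W ξ j‖ₑ ≤ ee ξ * (symBound α * conv (mag U) (mag W) ξ) := by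
  rw [mul_left_comm]
  refine enorm_qComb_le α ξ (fun k l => ?_) j
  refine (enorm_integral_le_lintegral_enorm _).trans (lintegral_mono fun η => ?_)
  rw [enorm_mul]
  exact mul_le_mul' (enorm_apply_le_mag U η k) (enorm_apply_le_mag W _ l)

theorem integrable_conv_term {u w : V3 → Fin 3 → ℂ} (hu : ∀ j, Measurable fun ξ => u ξ j)
    (hw : ∀ j, Measurable fun ξ => w ξ j) {ξ : V3} (h : conv (mag u) (mag w) ξ ≠ ⊤)
    (k l : Fin 3) : Integrable fun η => u η k * w (ξ - η) l := by
  refine ⟨?_, ?_⟩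
  · exact ((hu k).mul ((hw l).comp (measurable_const.sub measurable_id))).aestronglyMeasurable
  · refine lt_of_le_of_lt (lintegral_mono fun η => ?_) h.lt_top
    rw [enorm_mul]
    exact mul_le_mul' (enorm_apply_le_mag u η k) (enorm_apply_le_mag w _ l)

theorem enorm_Qhat_sub_le (α : Coeffs) {u w : V3 → Fin 3 → ℂ}
    (hu : ∀ j, Measurable fun ξ => u ξ j) (hw : ∀ j, Measurable fun ξ => w ξ j) {ξ : V3}
    (huu : conv (mag u) (mag u) ξ ≠ ⊤) (hww : conv (mag w) (mag w) ξ ≠ ⊤) (j : Fin 3) :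
    ‖Qhat α u u ξ j - Qhat α w w ξ j‖ₑ ≤ ee ξ * (symBound α *
      (conv (mag (u - w)) (mag u) ξ + conv (mag w) (mag (u - w)) ξ)) := by
  rw [Qhat_eq_qComb, Qhat_eq_qComb, qComb_sub, mul_left_comm]
  refine enorm_qComb_le α ξ (fun k l => ?_) j
  rw [← integral_sub (integrable_conv_term hu hu huu k l) (integrable_conv_term hw hw hww k l)]
  refine (enorm_integral_le_lintegral_enorm _).trans ?_
  have hm : Measurable (mag (u - w)) := measurable_mag fun j => (hu j).sub (hw j)
  have hmu := measurable_mag hu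
  unfold conv
  rw [← lintegral_add_left (by fun_prop)]
  refine lintegral_mono fun η => ?_
  calc ‖u η k * u (ξ - η) l - w η k * w (ξ - η) l‖ₑ
      = ‖(u - w) η k * u (ξ - η) l + w η k * (u - w) (ξ - η) l‖ₑ := by
        congr 1
        simp only [Pi.sub_apply]
        ring
    _ ≤ _ := by
        refine (enorm_add_le _ _).trans ?_
        rw [enorm_mul, enorm_mul]
        gcongr <;> apply enorm_apply_le_mag

theorem measurable_en_snd : Measurable fun p : ℝ × V3 => en p.2 := by fun_prop

theorem measurable_qsym (α : Coeffs) (j m k l : Fin 3) : Measurable (qsym α j m k l) := by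
  unfold qsym
  fun_prop

theorem measVF_Qhat (α : Coeffs) {U W : ℝ → V3 → Fin 3 → ℂ} (hU : MeasVF U) (hW : MeasVF W) :
    MeasVF fun s => Qhat α (U s) (W s) := by
  intro j
  have hI (k l : Fin 3) : Measurable fun p : ℝ × V3 => ∫ η : V3, U p.1 η k * W p.1 (p.2 - η) l := by
    have h1 : Measurable fun p : (ℝ × V3) × V3 => U p.1.1 p.2 k :=
      (hU k).comp (f := fun p : (ℝ × V3) × V3 => (p.1.1, p.2)) (by fun_prop)
    have h2 : Measurable fun p : (ℝ × V3) × V3 => W p.1.1 (p.1.2 - p.2) l :=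
      (hW l).comp (f := fun p : (ℝ × V3) × V3 => (p.1.1, p.1.2 - p.2)) (by fun_prop)
    exact (h1.mul h2).stronglyMeasurable.integral_prod_right'.measurable
  have hq (m k l : Fin 3) : Measurable fun p : ℝ × V3 => qsym α j m k l p.2 :=
    (measurable_qsym α j m k l).comp measurable_snd
  unfold Function.uncurry Qhat
  refine Finset.measurable_sum _ fun k _ => Finset.measurable_sum _ fun l _ =>
    Finset.measurable_sum _ fun m _ => ?_
  have := hq m k l
  have := hI k l
  fun_prop

theorem measurable_integral_Ioc {h : ℝ → V3 → ℝ → ℂ}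
    (hh : Measurable fun q : (ℝ × V3) × ℝ => h q.1.1 q.1.2 q.2) :
    Measurable fun p : ℝ × V3 => ∫ s in Ioc 0 p.1, h p.1 p.2 s := by
  have hS : MeasurableSet {q : (ℝ × V3) × ℝ | q.2 ∈ Ioc 0 q.1.1} :=
    (measurableSet_lt measurable_const measurable_snd).inter
      (measurableSet_le measurable_snd (measurable_fst.comp measurable_fst))
  have := (hh.indicator hS).stronglyMeasurable.integral_prod_right' (ν := (volume : Measure ℝ))
  convert this.measurable using 2 with p
  rw [← integral_indicator measurableSet_Ioc]
  rfl

/-- Integrand of the Duhamel term. -/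
def duhInt (α : Coeffs) (U : ℝ → V3 → Fin 3 → ℂ) (t : ℝ) (ξ : V3) (j : Fin 3) (s : ℝ) : ℂ :=
  (Real.exp (-((t - s) * en ξ ^ 2)) : ℂ) * Qhat α (U s) (U s) ξ j

/-- Right-hand side of the mild formulation. -/
def mildRhs (α : Coeffs) (U₀ : V3 → Fin 3 → ℂ) (U : ℝ → V3 → Fin 3 → ℂ) (t : ℝ) (ξ : V3)
    (j : Fin 3) : ℂ :=
  (Real.exp (-(t * en ξ ^ 2)) : ℂ) * U₀ ξ j + ∫ s in Ioc 0 t, duhInt α U t ξ j s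

theorem isMildSol_iff {α : Coeffs} {U₀ : V3 → Fin 3 → ℂ} {U : ℝ → V3 → Fin 3 → ℂ} {T : ℝ} :
    IsMildSol α U₀ U T ↔ ∀ t ∈ Icc 0 T, ∀ ξ j, U t ξ j = mildRhs α U₀ U t ξ j := by
  unfold IsMildSol mildRhs duhInt
  refine forall₂_congr fun t ht => ?_
  rw [forall_congr']
  intro ξ
  simp_rw [intervalIntegral.integral_of_le ht.1]

theorem measurable_duhInt (α : Coeffs) {U : ℝ → V3 → Fin 3 → ℂ} (hU : MeasVF U) (j : Fin 3) :
    Measurable fun q : (ℝ × V3) × ℝ => duhInt α U q.1.1 q.1.2 j q.2 := by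
  have hQ : Measurable fun q : (ℝ × V3) × ℝ => Qhat α (U q.2) (U q.2) q.1.2 j :=
    (measVF_Qhat α hU hU j).comp (f := fun q : (ℝ × V3) × ℝ => (q.2, q.1.2)) (by fun_prop)
  unfold duhInt
  fun_prop

theorem measVF_mildRhs (α : Coeffs) {U₀ : V3 → Fin 3 → ℂ} (h₀ : ∀ j, Measurable fun ξ => U₀ ξ j)
    {U : ℝ → V3 → Fin 3 → ℂ} (hU : MeasVF U) : MeasVF (mildRhs α U₀ U) := by
  intro j
  unfold mildRhs Function.uncurry
  refine Measurable.add ?_ (measurable_integral_Ioc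
    (h := fun t ξ s => duhInt α U t ξ j s) (measurable_duhInt α hU j))
  have : Measurable fun p : ℝ × V3 => U₀ p.2 j := (h₀ j).comp measurable_snd
  fun_prop

theorem enorm_exp (x : ℝ) : ‖(Real.exp x : ℂ)‖ₑ = ENNReal.ofReal (Real.exp x) := by
  rw [← ofReal_norm, Complex.norm_real, Real.norm_eq_abs, abs_of_pos (Real.exp_pos x)]

theorem enorm_duhInt_le (α : Coeffs) {U : ℝ → V3 → Fin 3 → ℂ} (t : ℝ) (ξ : V3) (j : Fin 3) (s : ℝ) :
    ‖duhInt α U t ξ j s‖ₑ ≤ ENNReal.ofReal (Real.exp (-((t - s) * en ξ ^ 2))) *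
      (ee ξ * forc (symBound α) (fun s => mag (U s)) (fun s => mag (U s)) s ξ) := by
  rw [duhInt, enorm_mul, enorm_exp]
  gcongr
  exact enorm_Qhat_le α _ _ ξ j

theorem mag_mildRhs_le (α : Coeffs) {U₀ : V3 → Fin 3 → ℂ} {U : ℝ → V3 → Fin 3 → ℂ} (t : ℝ)
    (ξ : V3) :
    mag (mildRhs α U₀ U t) ξ ≤ majStep (symBound α) (mag U₀) (fun s => mag (U s)) t ξ := by
  refine enorm_pi_le fun j => (enorm_add_le _ _).trans ?_
  unfold majStep
  gcongr
  · rw [enorm_mul, enorm_exp]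
    unfold lin
    gcongr
    exact enorm_apply_le_mag _ _ _
  · exact (enorm_integral_le_lintegral_enorm _).trans
      (lintegral_mono fun s => enorm_duhInt_le α t ξ j s)

theorem Qhat_congr_ae (α : Coeffs) {u w : V3 → Fin 3 → ℂ} (h : u =ᵐ[volume] w) :
    Qhat α u u = Qhat α w w := by
  ext ξ j
  have h2 : ∀ᵐ η : V3, u (ξ - η) = w (ξ - η) :=
    (Measure.measurePreserving_sub_left volume ξ).quasiMeasurePreserving.ae h
  rw [Qhat_eq_qComb, Qhat_eq_qComb]
  congr 1
  ext k l
  refine integral_congr_ae ?_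
  filter_upwards [h, h2] with η h1 h2
  rw [h1, h2]

theorem mildRhs_congr_ae (α : Coeffs) (U₀ : V3 → Fin 3 → ℂ) {U W : ℝ → V3 → Fin 3 → ℂ} {t : ℝ}
    (h : ∀ s ∈ Ioc 0 t, U s =ᵐ[volume] W s) : mildRhs α U₀ U t = mildRhs α U₀ W t := by
  ext ξ j
  unfold mildRhs
  congr 1
  refine setIntegral_congr_fun measurableSet_Ioc fun s hs => ?_
  simp only [duhInt, Qhat_congr_ae α (h s hs)]

theorem ee_zero : ee 0 = 0 := by simp [ee, en]

theorem duhInt_zero (α : Coeffs) (U : ℝ → V3 → Fin 3 → ℂ) (t : ℝ) (j : Fin 3) (s : ℝ) :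
    duhInt α U t 0 j s = 0 := by
  have := enorm_duhInt_le α (U := U) t 0 j s
  simpa [ee_zero] using this

theorem ae_conv_ne_top {K : ℝ≥0∞} (hK : K ≠ 0) {V : ℝ → V3 → ℝ≥0∞}
    (hV : Measurable (Function.uncurry V)) {t : ℝ} {ξ : V3} (hξ : ξ ≠ 0)
    (h : duh (forc K V V) t ξ ≠ ⊤) :
    ∀ᵐ s ∂(volume.restrict (Ioc 0 t)), conv (V s) (V s) ξ ≠ ⊤ := by
  have hm := measurable_time (measurable_forc (K := K) hV hV) ξ
  have := ae_lt_top (by fun_prop) h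
  filter_upwards [this] with s hs hc
  rw [forc, hc, ENNReal.mul_top hK, ENNReal.mul_top (ee_ne_zero hξ), ENNReal.mul_top] at hs
  · exact lt_irrefl _ hs
  · simpa using Real.exp_pos _

section

variable {α : Coeffs} {V : ℝ → V3 → ℝ≥0∞} {t : ℝ}

theorem integrable_duhInt {ξ : V3}
    (h : duh (forc (symBound α) V V) t ξ ≠ ⊤) {U : ℝ → V3 → Fin 3 → ℂ} (hU : MeasVF U)
    (hUV : ∀ s ∈ Ioc 0 t, ∀ ξ, mag (U s) ξ ≤ V s ξ) (j : Fin 3) :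
    IntegrableOn (duhInt α U t ξ j) (Ioc 0 t) := by
  refine ⟨?_, ?_⟩
  · exact ((measurable_duhInt α hU j).comp
      (f := fun s : ℝ => ((t, ξ), s)) (by fun_prop)).aestronglyMeasurable
  · refine lt_of_le_of_lt (setLIntegral_mono' measurableSet_Ioc fun s hs => ?_) h.lt_top
    refine (enorm_duhInt_le α t ξ j s).trans ?_
    unfold forc
    gcongr
    exact conv_mono (hUV s hs) (hUV s hs) ξ

theorem mag_mildRhs_sub_le (hV : Measurable (Function.uncurry V)) {ξ : V3}
    (h : duh (forc (symBound α) V V) t ξ ≠ ⊤) (U₀ : V3 → Fin 3 → ℂ) {U W : ℝ → V3 → Fin 3 → ℂ}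
    (hU : MeasVF U) (hW : MeasVF W) (hUV : ∀ s ∈ Ioc 0 t, ∀ ξ, mag (U s) ξ ≤ V s ξ)
    (hWV : ∀ s ∈ Ioc 0 t, ∀ ξ, mag (W s) ξ ≤ V s ξ) :
    mag (mildRhs α U₀ U t - mildRhs α U₀ W t) ξ ≤ duh (fun s ξ =>
      forc (symBound α) (fun s => mag (U s - W s)) (fun s => mag (U s)) s ξ +
      forc (symBound α) (fun s => mag (W s)) (fun s => mag (U s - W s)) s ξ) t ξ := by
  refine enorm_pi_le fun j => ?_
  have e : (mildRhs α U₀ U t - mildRhs α U₀ W t) ξ j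
      = ∫ s in Ioc 0 t, (duhInt α U t ξ j s - duhInt α W t ξ j s) := by
    rw [integral_sub (integrable_duhInt h hU hUV j) (integrable_duhInt h hW hWV j)]
    simp [mildRhs]
  rw [e]
  refine (enorm_integral_le_lintegral_enorm _).trans ?_
  rcases eq_or_ne ξ 0 with rfl | hξ
  · simp [duhInt_zero]
  refine lintegral_mono_ae ?_
  filter_upwards [ae_conv_ne_top (symBound_ne_zero α) hV hξ h,
    ae_restrict_mem measurableSet_Ioc] with s hs hst
  rw [duhInt, duhInt, ← mul_sub, enorm_mul, enorm_exp]
  refine mul_le_mul_right ?_ _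
  refine (enorm_Qhat_sub_le α (fun j => (hU j).comp measurable_prodMk_left)
    (fun j => (hW j).comp measurable_prodMk_left)
    (ne_top_of_le_ne_top hs (conv_mono (hUV s hst) (hUV s hst) ξ))
    (ne_top_of_le_ne_top hs (conv_mono (hWV s hst) (hWV s hst) ξ)) j).trans ?_
  rw [mul_add]
  rfl

theorem tendsto_mildRhs (hV : Measurable (Function.uncurry V)) {ξ : V3}
    (h : duh (forc (symBound α) V V) t ξ ≠ ⊤) (U₀ : V3 → Fin 3 → ℂ)
    {P : ℕ → ℝ → V3 → Fin 3 → ℂ} {U : ℝ → V3 → Fin 3 → ℂ} (hP : ∀ n, MeasVF (P n))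
    (hPV : ∀ n, ∀ s ∈ Ioc 0 t, ∀ ξ, mag (P n s) ξ ≤ V s ξ)
    (hlim : ∀ s ξ j, Tendsto (fun n => P n s ξ j) atTop (𝓝 (U s ξ j))) (j : Fin 3) :
    Tendsto (fun n => mildRhs α U₀ (P n) t ξ j) atTop (𝓝 (mildRhs α U₀ U t ξ j)) := by
  unfold mildRhs
  refine tendsto_const_nhds.add ?_
  rcases eq_or_ne ξ 0 with rfl | hξ
  · simp [duhInt_zero]
  have hfm := measurable_time (measurable_forc (K := symBound α) hV hV) ξ
  refine tendsto_integral_of_dominated_convergence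
    (fun s => (ENNReal.ofReal (Real.exp (-((t - s) * en ξ ^ 2))) *
      (ee ξ * forc (symBound α) V V s ξ)).toReal) ?_ ?_ ?_ ?_
  · intro n
    exact ((measurable_duhInt α (hP n) j).comp
      (f := fun s : ℝ => ((t, ξ), s)) (by fun_prop)).aestronglyMeasurable
  · exact integrable_toReal_of_lintegral_ne_top (by fun_prop) h
  · intro n
    filter_upwards [ae_lt_top (by fun_prop) h, ae_restrict_mem measurableSet_Ioc] with s hs hst
    rw [← toReal_enorm]
    refine ENNReal.toReal_mono hs.ne ((enorm_duhInt_le α t ξ j s).trans ?_)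
    unfold forc
    gcongr
    exact conv_mono (hPV n s hst) (hPV n s hst) ξ
  · filter_upwards [ae_conv_ne_top (symBound_ne_zero α) hV hξ h,
      ae_restrict_mem measurableSet_Ioc] with s hs hst
    unfold duhInt
    refine tendsto_const_nhds.mul ?_
    simp only [Qhat_eq_qComb, qComb]
    refine tendsto_finsetSum _ fun k _ => tendsto_finsetSum _ fun l _ =>
      tendsto_finsetSum _ fun m _ => tendsto_const_nhds.mul ?_
    have hVs := measurable_slice hV s
    refine tendsto_integral_of_dominated_convergence
      (fun η => (V s η * V s (ξ - η)).toReal) ?_ ?_ ?_ ?_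
    · intro n
      have h1 : Measurable fun η => P n s η k := (hP n k).comp measurable_prodMk_left
      have h2 : Measurable fun η => P n s η l := (hP n l).comp measurable_prodMk_left
      exact (h1.mul (h2.comp (measurable_const.sub measurable_id))).aestronglyMeasurable
    · exact integrable_toReal_of_lintegral_ne_top (by fun_prop) hs
    · intro n
      have hs' : ∫⁻ η, V s η * V s (ξ - η) ≠ ⊤ := hs
      filter_upwards [ae_lt_top (by fun_prop) hs'] with η hη
      rw [← toReal_enorm]
      refine ENNReal.toReal_mono hη.ne ?_
      rw [enorm_mul]
      exact mul_le_mul' ((enorm_apply_le_mag _ _ _).trans (hPV n s hst η))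
        ((enorm_apply_le_mag _ _ _).trans (hPV n s hst _))
    · exact ae_of_all _ fun η => (hlim s η k).mul (hlim s _ l)

end

/-- Picard iterates of the mild formulation, set to zero where the majorant is infinite. -/
def pic (α : Coeffs) (U₀ : V3 → Fin 3 → ℂ) : ℕ → ℝ → V3 → Fin 3 → ℂ
  | 0 => fun _ _ => 0
  | n + 1 => {p : ℝ × V3 | 0 ≤ p.1 ∧ majSup (symBound α) (mag U₀) p.1 p.2 ≠ ⊤}.indicator
      (Function.uncurry (mildRhs α U₀ (pic α U₀ n))) |>.curry

open scoped Classical in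
theorem pic_succ (α : Coeffs) (U₀ : V3 → Fin 3 → ℂ) (n : ℕ) (t : ℝ) (ξ : V3) :
    pic α U₀ (n + 1) t ξ = if 0 ≤ t ∧ majSup (symBound α) (mag U₀) t ξ ≠ ⊤ then
      mildRhs α U₀ (pic α U₀ n) t ξ else 0 := by
  rw [pic, Function.curry_apply, indicator_apply]
  rfl

section

variable {α : Coeffs} {U₀ : V3 → Fin 3 → ℂ}

theorem measVF_pic (h₀ : ∀ j, Measurable fun ξ => U₀ ξ j) (n : ℕ) : MeasVF (pic α U₀ n) := by
  induction n with
  | zero => exact fun j => measurable_const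
  | succ n ih =>
    have h1 : Measurable (Function.uncurry (mildRhs α U₀ (pic α U₀ n))) :=
      measurable_pi_lambda _ (measVF_mildRhs α h₀ ih)
    have hV := measurable_majSup (K := symBound α) (measurable_mag h₀)
    have h2 : MeasurableSet
        {p : ℝ × V3 | 0 ≤ p.1 ∧ majSup (symBound α) (mag U₀) p.1 p.2 ≠ ⊤} :=
      (measurableSet_le measurable_const measurable_fst).inter
        (hV (measurableSet_singleton ⊤).compl)
    exact fun j => measurable_pi_iff.1 (h1.indicator h2) j

theorem mag_pic_le (n : ℕ) (t : ℝ) (ξ : V3) :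
    mag (pic α U₀ n t) ξ ≤ maj (symBound α) (mag U₀) n t ξ := by
  classical
  induction n generalizing t ξ with
  | zero => simp [mag, pic]
  | succ n ih =>
    rw [mag, pic_succ]
    split_ifs with h
    · exact (mag_mildRhs_le α t ξ).trans (majStep_mono (fun s ξ => ih s ξ) t ξ)
    · simp

theorem mag_pic_le_majSup (n : ℕ) (t : ℝ) (ξ : V3) :
    mag (pic α U₀ n t) ξ ≤ majSup (symBound α) (mag U₀) t ξ :=
  (mag_pic_le n t ξ).trans (maj_le_majSup _ _ n t ξ)

theorem duh_majSup_ne_top (h₀ : ∀ j, Measurable fun ξ => U₀ ξ j) {t : ℝ} {ξ : V3}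
    (h : majSup (symBound α) (mag U₀) t ξ ≠ ⊤) :
    duh (forc (symBound α) (majSup (symBound α) (mag U₀)) (majSup (symBound α) (mag U₀))) t ξ
      ≠ ⊤ := by
  rw [majSup_eq (measurable_mag h₀)] at h
  exact ne_top_of_le_ne_top h le_add_self

theorem forc_add_le {K : ℝ≥0∞} {d f f' : ℝ → V3 → ℝ≥0∞} (hd : Measurable (Function.uncurry d))
    (hf : Measurable (Function.uncurry f)) (hf' : Measurable (Function.uncurry f'))
    (h : ∀ t ξ, d t ξ + f t ξ ≤ f' t ξ) (s : ℝ) (ξ : V3) :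
    forc K d f' s ξ + forc K f d s ξ + forc K f f s ξ ≤ forc K f' f' s ξ := by
  have hd := measurable_slice hd s
  have hf := measurable_slice hf s
  have hf' := measurable_slice hf' s
  unfold forc conv
  rw [← mul_add, ← mul_add, ← lintegral_add_left (by fun_prop), ← lintegral_add_left (by fun_prop)]
  gcongr with η
  calc d s η * f' s (ξ - η) + f s η * d s (ξ - η) + f s η * f s (ξ - η)
      = d s η * f' s (ξ - η) + f s η * (d s (ξ - η) + f s (ξ - η)) := by ring
    _ ≤ d s η * f' s (ξ - η) + f s η * f' s (ξ - η) := by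
        gcongr
        exact h s _
    _ = (d s η + f s η) * f' s (ξ - η) := by ring
    _ ≤ _ := by
        gcongr
        exact h s _

theorem duh_add {g g' : ℝ → V3 → ℝ≥0∞} (hg : Measurable (Function.uncurry g)) (t : ℝ) (ξ : V3) :
    duh (fun s ξ => g s ξ + g' s ξ) t ξ = duh g t ξ + duh g' t ξ := by
  have := measurable_time hg ξ
  unfold duh
  rw [← lintegral_add_left (by fun_prop)]
  simp_rw [mul_add]

theorem mag_pic_succ_sub_add_le (h₀ : ∀ j, Measurable fun ξ => U₀ ξ j) (n : ℕ) (t : ℝ) (ξ : V3) :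
    mag (pic α U₀ (n + 1) t - pic α U₀ n t) ξ + maj (symBound α) (mag U₀) n t ξ
      ≤ maj (symBound α) (mag U₀) (n + 1) t ξ := by
  classical
  have ha := measurable_mag h₀
  induction n generalizing t ξ with
  | zero =>
    have := mag_pic_le (α := α) (U₀ := U₀) 1 t ξ
    simpa [mag, pic, maj] using this
  | succ n ih =>
    have hP := measVF_pic (α := α) h₀
    have hM := measurable_maj (K := symBound α) ha
    rw [mag, Pi.sub_apply, pic_succ, pic_succ]
    split_ifs with h
    · have hV := measurable_majSup (K := symBound α) ha
      have h1 := mag_mildRhs_sub_le hV (duh_majSup_ne_top h₀ h.2) U₀ (hP (n + 1)) (hP n)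
        (fun s _ ξ => mag_pic_le_majSup (n + 1) s ξ) (fun s _ ξ => mag_pic_le_majSup n s ξ)
      set d : ℝ → V3 → ℝ≥0∞ := fun s => mag (pic α U₀ (n + 1) s - pic α U₀ n s) with hd
      have hdm : Measurable (Function.uncurry d) :=
        measurable_mag_time (U := fun s => pic α U₀ (n + 1) s - pic α U₀ n s)
          fun j => (hP (n + 1) j).sub (hP n j)
      have hF1 := measurable_forc (K := symBound α) hdm (hM (n + 1))
      have hF2 := measurable_forc (K := symBound α) (hM n) hdm
      have h2 : mag (mildRhs α U₀ (pic α U₀ (n + 1)) t - mildRhs α U₀ (pic α U₀ n) t) ξ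
          ≤ duh (fun s ξ => forc (symBound α) d (maj (symBound α) (mag U₀) (n + 1)) s ξ +
            forc (symBound α) (maj (symBound α) (mag U₀) n) d s ξ) t ξ := by
        refine h1.trans (duh_mono t ξ fun s _ => ?_)
        unfold forc
        gcongr
        · exact conv_mono (fun _ => le_rfl) (fun ξ => mag_pic_le _ _ _) ξ
        · exact conv_mono (fun ξ => mag_pic_le _ _ _) (fun _ => le_rfl) ξ
      rw [mag, Pi.sub_apply] at h2
      refine (add_le_add_left h2 _).trans ?_
      have e (m : ℕ) : maj (symBound α) (mag U₀) (m + 1) t ξ = lin (mag U₀) t ξ +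
        duh (forc (symBound α) (maj (symBound α) (mag U₀) m)
          (maj (symBound α) (mag U₀) m)) t ξ := rfl
      rw [e (n + 1), e n, add_left_comm, ← duh_add (g := fun s ξ =>
        forc (symBound α) d (maj (symBound α) (mag U₀) (n + 1)) s ξ +
        forc (symBound α) (maj (symBound α) (mag U₀) n) d s ξ) (hF1.add hF2)]
      gcongr
      exact duh_mono t ξ fun s _ => forc_add_le hdm (hM n) (hM (n + 1)) (fun s ξ => ih s ξ) s ξ
    · simpa using monotone_maj (symBound α) (mag U₀) (n + 1).le_succ t ξ

theorem exists_tendsto_pic (h₀ : ∀ j, Measurable fun ξ => U₀ ξ j) (t : ℝ) (ξ : V3) :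
    ∃ v, Tendsto (fun n => pic α U₀ n t ξ) atTop (𝓝 v) := by
  classical
  by_cases h : 0 ≤ t ∧ majSup (symBound α) (mag U₀) t ξ ≠ ⊤
  · have hsum (n : ℕ) : ∑ i ∈ Finset.range n, edist (pic α U₀ i t ξ) (pic α U₀ (i + 1) t ξ)
        ≤ maj (symBound α) (mag U₀) n t ξ := by
      induction n with
      | zero => simp
      | succ n ih =>
        rw [Finset.sum_range_succ, add_comm, edist_comm, edist_eq_enorm_sub]
        exact (add_le_add_right ih _).trans (mag_pic_succ_sub_add_le h₀ n t ξ)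
    refine cauchySeq_tendsto_of_complete (cauchySeq_of_edist_le_of_tsum_ne_top
      (fun n => edist (pic α U₀ n t ξ) (pic α U₀ (n + 1) t ξ)) (fun n => le_rfl) ?_)
    refine ne_top_of_le_ne_top h.2 ?_
    rw [ENNReal.tsum_eq_iSup_nat]
    exact iSup_le fun n => (hsum n).trans (maj_le_majSup _ _ n t ξ)
  · refine ⟨0, tendsto_const_nhds.congr fun n => ?_⟩
    cases n with
    | zero => rfl
    | succ n => rw [pic_succ, if_neg h]

theorem exists_mild_majorized (h₀ : ∀ j, Measurable fun ξ => U₀ ξ j) {T : ℝ}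
    (hfin : ∀ t ∈ Icc 0 T, hn 1 (majSup (symBound α) (mag U₀) t) ≠ ⊤) :
    ∃ U, MeasVF U ∧ IsMildSol α U₀ U T ∧
      ∀ t ∈ Icc 0 T, ∀ ξ, mag (U t) ξ ≤ majSup (symBound α) (mag U₀) t ξ := by
  classical
  have ha := measurable_mag h₀
  have hV := measurable_majSup (K := symBound α) ha
  choose Z hZ using exists_tendsto_pic (α := α) h₀
  have hZj (s : ℝ) (ξ : V3) (j : Fin 3) :
      Tendsto (fun n => pic α U₀ n s ξ j) atTop (𝓝 (Z s ξ j)) := (tendsto_pi_nhds.1 (hZ s ξ)) j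
  have hZm : MeasVF Z := fun j => measurable_of_tendsto_metrizable
    (fun n => measVF_pic (α := α) h₀ n j) (tendsto_pi_nhds.2 fun p => hZj p.1 p.2 j)
  have hZV (s : ℝ) (ξ : V3) : mag (Z s) ξ ≤ majSup (symBound α) (mag U₀) s ξ :=
    le_of_tendsto (hZ s ξ).enorm (Eventually.of_forall fun n => mag_pic_le_majSup n s ξ)
  have hfix {t : ℝ} (ht : 0 ≤ t) {ξ : V3} (h : majSup (symBound α) (mag U₀) t ξ ≠ ⊤) :
      Z t ξ = mildRhs α U₀ Z t ξ := by
    ext j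
    refine tendsto_nhds_unique ((hZj t ξ j).comp (tendsto_add_atTop_nat 1)) ?_
    refine (tendsto_mildRhs hV (duh_majSup_ne_top h₀ h) U₀ (measVF_pic h₀)
      (fun n s _ ξ => mag_pic_le_majSup n s ξ) hZj j).congr fun n => ?_
    simp only [Function.comp]
    rw [pic_succ, if_pos ⟨ht, h⟩]
  have hZae : ∀ t ∈ Icc 0 T, mildRhs α U₀ Z t =ᵐ[volume] Z t := by
    intro t ht
    have h0 : ∀ᵐ η : V3, η ≠ 0 := by simp [ae_iff]
    have hVt := measurable_slice hV t
    filter_upwards [ae_lt_top (by fun_prop) (hfin t ht), h0] with ξ h1 h2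
    refine (hfix ht.1 fun hc => ?_).symm
    rw [hc] at h1
    simp [ENNReal.mul_top (ee_ne_zero h2)] at h1
  refine ⟨mildRhs α U₀ Z, measVF_mildRhs α h₀ hZm, isMildSol_iff.2 fun t ht ξ j => ?_,
    fun t ht ξ => ?_⟩
  · rw [mildRhs_congr_ae α U₀ (U := mildRhs α U₀ Z) (W := Z) fun s hs =>
      hZae s ⟨hs.1.le, hs.2.trans ht.2⟩]
  · rw [majSup_eq ha]
    exact (mag_mildRhs_le α t ξ).trans (majStep_mono hZV t ξ)

end

theorem wnorm_sq (w : V3 → ℝ) (f : V3 → Fin 3 → ℂ) :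
    wnorm w f ^ 2 = ∫⁻ ξ, ENNReal.ofReal (w ξ ^ 2 * vnSq (f ξ)) := by
  rw [wnorm, ← ENNReal.rpow_natCast, ← ENNReal.rpow_mul]
  norm_num

theorem enorm_sq_eq_ofReal {E : Type*} [SeminormedAddCommGroup E] (v : E) :
    ‖v‖ₑ ^ 2 = ENNReal.ofReal (‖v‖ ^ 2) := by
  rw [ENNReal.ofReal_pow (norm_nonneg _), ofReal_norm]

theorem vnSq_nonneg (v : Fin 3 → ℂ) : 0 ≤ vnSq v := Finset.sum_nonneg fun _ _ => sq_nonneg _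

theorem enorm_sq_le_vnSq (v : Fin 3 → ℂ) : ‖v‖ₑ ^ 2 ≤ ENNReal.ofReal (vnSq v) := by
  rw [enorm_sq_eq_ofReal]
  refine ENNReal.ofReal_le_ofReal ?_
  rw [← Real.sq_sqrt (vnSq_nonneg v)]
  refine pow_le_pow_left₀ (norm_nonneg _) ((pi_norm_le_iff_of_nonneg (Real.sqrt_nonneg _)).2
    fun j => Real.le_sqrt_of_sq_le ?_) 2
  exact Finset.single_le_sum (f := fun j => ‖v j‖ ^ 2) (fun _ _ => sq_nonneg _) (Finset.mem_univ j)

theorem vnSq_le_enorm_sq (v : Fin 3 → ℂ) : ENNReal.ofReal (vnSq v) ≤ 3 * ‖v‖ₑ ^ 2 := by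
  have h3 : (3 : ℝ≥0∞) = ENNReal.ofReal 3 := by norm_num
  rw [enorm_sq_eq_ofReal, h3, ← ENNReal.ofReal_mul (by norm_num)]
  refine ENNReal.ofReal_le_ofReal ?_
  calc vnSq v ≤ ∑ _j : Fin 3, ‖v‖ ^ 2 :=
        Finset.sum_le_sum fun j _ => pow_le_pow_left₀ (norm_nonneg _) (norm_le_pi_norm v j) 2
    _ = 3 * ‖v‖ ^ 2 := by simp

theorem wnorm_sq_le (w : V3 → ℝ) (f : V3 → Fin 3 → ℂ) :
    wnorm w f ^ 2 ≤ 3 * ∫⁻ ξ, ENNReal.ofReal (w ξ ^ 2) * mag f ξ ^ 2 := by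
  rw [wnorm_sq, ← lintegral_const_mul' _ _ (by norm_num)]
  refine lintegral_mono fun ξ => ?_
  rw [ENNReal.ofReal_mul (sq_nonneg _), mul_left_comm]
  gcongr
  exact vnSq_le_enorm_sq _

theorem le_wnorm_sq (w : V3 → ℝ) (f : V3 → Fin 3 → ℂ) :
    ∫⁻ ξ, ENNReal.ofReal (w ξ ^ 2) * mag f ξ ^ 2 ≤ wnorm w f ^ 2 := by
  rw [wnorm_sq]
  refine lintegral_mono fun ξ => ?_
  rw [ENNReal.ofReal_mul (sq_nonneg _)]
  gcongr
  exact enorm_sq_le_vnSq _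

theorem wD_half_sq (k : ℕ) (ξ : V3) : ENNReal.ofReal (wD ((k : ℝ) / 2) ξ ^ 2) = ee ξ ^ k := by
  rw [wD, ← Real.rpow_natCast, ← Real.rpow_mul (en_nonneg ξ), ee,
    ← ENNReal.ofReal_pow (en_nonneg ξ), ← Real.rpow_natCast (en ξ) k]
  norm_num

theorem wnorm_wD_sq_le (k : ℕ) (f : V3 → Fin 3 → ℂ) :
    wnorm (wD ((k : ℝ) / 2)) f ^ 2 ≤ 3 * hn k (mag f) := by
  simpa only [wD_half_sq, hn] using wnorm_sq_le (wD ((k : ℝ) / 2)) f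

theorem hn_mag_le (k : ℕ) (f : V3 → Fin 3 → ℂ) :
    hn k (mag f) ≤ wnorm (wD ((k : ℝ) / 2)) f ^ 2 := by
  simpa only [wD_half_sq, hn] using le_wnorm_sq (wD ((k : ℝ) / 2)) f

theorem mag_sub_le (f g : V3 → Fin 3 → ℂ) (ξ : V3) : mag (f - g) ξ ≤ mag f ξ + mag g ξ :=
  enorm_sub_le

theorem ae_ne_zero_V3 : ∀ᵐ ξ : V3, ξ ≠ 0 := by simp [ae_iff]

section regularity

variable {α : Coeffs} {U₀ : V3 → Fin 3 → ℂ} {U : ℝ → V3 → Fin 3 → ℂ} {T : ℝ}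

theorem mag_le_majStep (hmild : IsMildSol α U₀ U T) {t : ℝ} (ht : t ∈ Icc 0 T) (ξ : V3) :
    mag (U t) ξ ≤ majStep (symBound α) (mag U₀) (fun s => mag (U s)) t ξ := by
  have : U t = mildRhs α U₀ U t := by
    ext ξ j
    exact isMildSol_iff.1 hmild t ht ξ j
  rw [this]
  exact mag_mildRhs_le α t ξ

theorem hn_one_mag_ne_top (hU : MeasVF U) (h₀ : ∀ j, Measurable fun ξ => U₀ ξ j)
    (hmild : IsMildSol α U₀ U T) (ha : hn 1 (mag U₀) ≠ ⊤)
    (h2 : ∫⁻ s in Ioc 0 T, hn 2 (mag (U s)) ^ 2 ≠ ⊤) {t : ℝ} (ht : t ∈ Icc 0 T) :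
    hn 1 (mag (U t)) ≠ ⊤ := by
  refine ne_top_of_le_ne_top ?_ ((hn_mono (mag_le_majStep hmild ht)).trans
    (hn_one_majStep_le (symBound_ne_top α) (measurable_mag h₀) (measurable_mag_time hU) ht.1))
  have : ∫⁻ s in Ioc 0 t, hn 2 (mag (U s)) ^ 2 ≠ ⊤ :=
    ne_top_of_le_ne_top h2 (lintegral_mono_set (Ioc_subset_Ioc_right ht.2))
  have := symBound_ne_top α
  have := prodConst_ne_top
  finiteness

theorem lintegral_hn_three_mag_ne_top (hU : MeasVF U) (h₀ : ∀ j, Measurable fun ξ => U₀ ξ j)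
    (hmild : IsMildSol α U₀ U T) (ha : hn 1 (mag U₀) ≠ ⊤)
    (h2 : ∫⁻ s in Ioc 0 T, hn 2 (mag (U s)) ^ 2 ≠ ⊤) :
    ∫⁻ s in Ioc 0 T, hn 3 (mag (U s)) ≠ ⊤ := by
  refine ne_top_of_le_ne_top ?_ ((setLIntegral_mono' measurableSet_Ioc fun t ht =>
    hn_mono (mag_le_majStep hmild ⟨ht.1.le, ht.2⟩)).trans
    (lintegral_hn_three_majStep_le (symBound_ne_top α) (measurable_mag h₀)
      (measurable_mag_time hU) T))
  have := symBound_ne_top α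
  have := prodConst_ne_top
  finiteness

theorem ae_lintegral_forc_sq_ne_top {K : ℝ≥0∞} (hK : K ≠ ⊤) {f : ℝ → V3 → ℝ≥0∞}
    (hf : Measurable (Function.uncurry f)) (h2 : ∫⁻ s in Ioc 0 T, hn 2 (f s) ^ 2 ≠ ⊤) :
    ∀ᵐ ξ, ∫⁻ s in Ioc 0 T, forc K f f s ξ ^ 2 ≠ ⊤ := by
  have hF := measurable_forc (K := K) hf hf
  have h1 : ∫⁻ s in Ioc 0 T, hn 1 (forc K f f s) ≠ ⊤ := by
    refine ne_top_of_le_ne_top ?_ (lintegral_hn_forc_le hK hf T)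
    have := prodConst_ne_top
    finiteness
  rw [hn_lintegral_swap hF] at h1
  have hm : Measurable fun ξ => ∫⁻ s in Ioc 0 T, forc K f f s ξ ^ 2 :=
    Measurable.lintegral_prod_left' (f := fun p : ℝ × V3 => forc K f f p.1 p.2 ^ 2) (hF.pow_const 2)
  filter_upwards [ae_lt_top (by fun_prop) h1, ae_ne_zero_V3] with ξ h1 h2 hc
  rw [hc] at h1
  simp [ENNReal.mul_top (ee_ne_zero h2)] at h1

theorem continuousOn_mildRhs (hU : MeasVF U) {ξ : V3}
    (h : ∫⁻ s in Ioc 0 T, forc (symBound α) (fun s => mag (U s)) (fun s => mag (U s)) s ξ ^ 2 ≠ ⊤)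
    (j : Fin 3) : ContinuousOn (fun t => mildRhs α U₀ U t ξ j) (Icc 0 T) := by
  have hQm : Measurable fun s => Qhat α (U s) (U s) ξ j :=
    Measurable.of_uncurry_right (f := fun s ξ => Qhat α (U s) (U s) ξ j) (measVF_Qhat α hU hU j)
  set F := forc (symBound α) (fun s => mag (U s)) (fun s => mag (U s)) with hF
  have hFm : Measurable fun s => F s ξ :=
    measurable_time (measurable_forc (measurable_mag_time hU) (measurable_mag_time hU)) ξ
  have hint : ∫⁻ s in Ioc 0 T, F s ξ ≠ ⊤ := by
    have h3 := lintegral_mul_sq_le (μ := volume.restrict (Ioc 0 T)) (f := fun s => F s ξ)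
      (g := fun _ => 1) hFm.aemeasurable aemeasurable_const
    have h4 : (∫⁻ s in Ioc 0 T, F s ξ * 1) ^ 2 ≠ ⊤ := by
      refine ne_top_of_le_ne_top ?_ h3
      refine ENNReal.mul_ne_top h ?_
      simp
    simpa using h4
  have hQ : IntegrableOn (fun s => (Real.exp (s * en ξ ^ 2) : ℂ) * Qhat α (U s) (U s) ξ j)
      (Icc 0 T) := by
    rw [integrableOn_Icc_iff_integrableOn_Ioc]
    have hem : Measurable fun s : ℝ => (Real.exp (s * en ξ ^ 2) : ℂ) := by fun_prop
    refine ⟨(hem.mul hQm).aestronglyMeasurable, ?_⟩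
    rw [HasFiniteIntegral]
    have hle : ∫⁻ s in Ioc 0 T, ‖(Real.exp (s * en ξ ^ 2) : ℂ) * Qhat α (U s) (U s) ξ j‖ₑ
        ≤ ∫⁻ s in Ioc 0 T, ENNReal.ofReal (Real.exp (T * en ξ ^ 2)) * (ee ξ * F s ξ) := by
      refine setLIntegral_mono' measurableSet_Ioc fun s hs => ?_
      rw [enorm_mul, enorm_exp]
      refine mul_le_mul' (ENNReal.ofReal_le_ofReal (Real.exp_le_exp.2 ?_))
        (enorm_Qhat_le α (U s) (U s) ξ j)
      exact mul_le_mul_of_nonneg_right hs.2 (sq_nonneg _)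
    refine hle.trans_lt ?_
    rw [lintegral_const_mul _ (by fun_prop), lintegral_const_mul _ hFm]
    have := ee_ne_top ξ
    finiteness
  have hc := intervalIntegral.continuousOn_primitive hQ
  refine (ContinuousOn.add (f := fun t => (Real.exp (-(t * en ξ ^ 2)) : ℂ) * U₀ ξ j)
    (g := fun t => (Real.exp (-(t * en ξ ^ 2)) : ℂ) * ∫ s in Ioc 0 t,
      (Real.exp (s * en ξ ^ 2) : ℂ) * Qhat α (U s) (U s) ξ j) ?_ ?_).congr fun t _ => ?_
  · fun_prop
  · exact ContinuousOn.mul (by fun_prop) hc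
  · simp only [mildRhs, duhInt, Pi.add_apply]
    rw [← integral_const_mul]
    congr 2
    ext s
    rw [← mul_assoc, ← Complex.ofReal_mul, ← Real.exp_add]
    ring_nf

theorem contInW_of_isMildSol (hU : MeasVF U) (h₀ : ∀ j, Measurable fun ξ => U₀ ξ j)
    (hmild : IsMildSol α U₀ U T) (ha : hn 1 (mag U₀) ≠ ⊤)
    (h2 : ∫⁻ s in Ioc 0 T, hn 2 (mag (U s)) ^ 2 ≠ ⊤) : ContInW (wD (1 / 2)) U T := by
  have hUm := measurable_mag_time hU
  set F := forc (symBound α) (fun s => mag (U s)) (fun s => mag (U s)) with hF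
  have hFm : Measurable (Function.uncurry F) := measurable_forc hUm hUm
  refine ⟨fun t ht => ?_, fun t ht ε hε => ?_⟩
  · have := wnorm_wD_sq_le 1 (U t)
    have h3 := hn_one_mag_ne_top hU h₀ hmild ha h2 ht
    have h4 : wnorm (wD ((1 : ℕ) / 2)) (U t) ^ 2 ≠ ⊤ := ne_top_of_le_ne_top (by finiteness) this
    simpa [lt_top_iff_ne_top] using h4
  set B : V3 → ℝ≥0∞ := fun ξ => mag U₀ ξ ^ 2 + ∫⁻ s in Ioc 0 T, F s ξ ^ 2 with hB
  have hUB : ∀ s ∈ Icc 0 T, ∀ ξ, mag (U s) ξ ^ 2 ≤ 2 * B ξ := by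
    intro s hs ξ
    calc mag (U s) ξ ^ 2 ≤ (lin (mag U₀) s ξ + duh F s ξ) ^ 2 := by
          gcongr
          exact mag_le_majStep hmild hs ξ
      _ ≤ 2 * lin (mag U₀) s ξ ^ 2 + 2 * duh F s ξ ^ 2 := ENNReal.add_sq_le_two_mul _ _
      _ ≤ 2 * mag U₀ ξ ^ 2 + 2 * ∫⁻ s in Ioc 0 T, F s ξ ^ 2 := by
          gcongr 2 * ?_ ^ 2 + 2 * ?_
          · exact lin_le _ hs.1 ξ
          · exact (duh_sq_le hFm s ξ).trans (lintegral_mono_set (Ioc_subset_Ioc_right hs.2))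
      _ = 2 * B ξ := by rw [hB]; ring
  have hBi : ∫⁻ ξ, ee ξ * (8 * B ξ) ≠ ⊤ := by
    have e : ∀ ξ, ee ξ * (8 * B ξ)
        = 8 * (ee ξ ^ 1 * mag U₀ ξ ^ 2) + 8 * (ee ξ ^ 1 * ∫⁻ s in Ioc 0 T, F s ξ ^ 2) := by
      intro ξ; rw [hB]; ring
    have hm := measurable_mag h₀
    simp_rw [e]
    rw [lintegral_add_left (by fun_prop), lintegral_const_mul' _ _ (by norm_num),
      lintegral_const_mul' _ _ (by norm_num), ← hn_lintegral_swap hFm]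
    have h1 : ∫⁻ s in Ioc 0 T, hn 1 (F s) ≠ ⊤ := by
      refine ne_top_of_le_ne_top ?_ (lintegral_hn_forc_le (symBound_ne_top α) hUm T)
      have := prodConst_ne_top
      have := symBound_ne_top α
      finiteness
    exact ENNReal.add_ne_top.2 ⟨ENNReal.mul_ne_top (by norm_num) ha,
      ENNReal.mul_ne_top (by norm_num) h1⟩
  have hlim : Tendsto (fun s => ∫⁻ ξ, ee ξ * mag (U s - U t) ξ ^ 2) (𝓝[Icc 0 T] t)
      (𝓝 (∫⁻ _ : V3, 0)) := by
    refine tendsto_lintegral_filter_of_dominated_convergence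
      (fun ξ => ee ξ * (8 * B ξ)) ?_ ?_ hBi ?_
    · refine Eventually.of_forall fun s => ?_
      have : Measurable (mag (U s - U t)) := measurable_mag fun j =>
        ((hU j).comp measurable_prodMk_left).sub ((hU j).comp measurable_prodMk_left)
      fun_prop
    · filter_upwards [self_mem_nhdsWithin] with s hs
      refine Eventually.of_forall fun ξ => ?_
      gcongr
      calc mag (U s - U t) ξ ^ 2 ≤ (mag (U s) ξ + mag (U t) ξ) ^ 2 := by
            gcongr
            exact mag_sub_le _ _ ξ
        _ ≤ 2 * mag (U s) ξ ^ 2 + 2 * mag (U t) ξ ^ 2 := ENNReal.add_sq_le_two_mul _ _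
        _ ≤ 2 * (2 * B ξ) + 2 * (2 * B ξ) := by
            gcongr
            · exact hUB s hs ξ
            · exact hUB t ht ξ
        _ = 8 * B ξ := by ring
    · filter_upwards [ae_lintegral_forc_sq_ne_top (symBound_ne_top α) hUm h2] with ξ hξ
      have hc : ContinuousOn (fun s => U s ξ) (Icc 0 T) := continuousOn_pi.2 fun j =>
        (continuousOn_mildRhs (U₀ := U₀) hU hξ j).congr fun s hs => isMildSol_iff.1 hmild s hs ξ j
      have h5 : Tendsto (fun s => ee ξ * ‖U s ξ - U t ξ‖ₑ ^ 2) (𝓝[Icc 0 T] t)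
          (𝓝 (ee ξ * ‖U t ξ - U t ξ‖ₑ ^ 2)) := by
        refine ENNReal.Tendsto.const_mul (ENNReal.Tendsto.pow ?_) (Or.inr (ee_ne_top ξ))
        exact ((hc t ht).tendsto.sub_const _).enorm
      simpa [mag] using h5
  have hε' : (0 : ℝ≥0∞) < min 1 (ε ^ 2 / 3) :=
    lt_min one_pos (ENNReal.div_pos (by positivity) (by norm_num))
  rw [lintegral_zero] at hlim
  have hev := hlim.eventually_lt_const hε'
  rw [eventually_nhdsWithin_iff, Metric.eventually_nhds_iff] at hev
  obtain ⟨d, hd, hd'⟩ := hev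
  refine ⟨d, hd, fun s hs hst => ?_⟩
  have h6 := hd' (y := s) (by rwa [Real.dist_eq]) hs
  have h7 := wnorm_wD_sq_le 1 (U s - U t)
  have h8 : wnorm (wD (1 / 2)) (U s - U t) ^ 2 < ε ^ 2 := by
    refine lt_of_le_of_lt (by simpa using h7) ?_
    have h9 : hn 1 (mag (U s - U t)) < ε ^ 2 / 3 := by
      refine lt_of_lt_of_le ?_ (min_le_right 1 _)
      simpa [hn] using h6
    rw [ENNReal.lt_div_iff_mul_lt (by norm_num) (by norm_num)] at h9
    rwa [mul_comm]
  exact lt_of_not_ge fun hc => h8.not_ge (pow_le_pow_left' hc 2)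

theorem memL2W_of_hn_three (h : ∫⁻ s in Ioc 0 T, hn 3 (mag (U s)) ≠ ⊤) :
    MemL2W (wD (3 / 2)) U T := by
  have : ∫⁻ s in Ioo 0 T, wnorm (wD (3 / 2)) (U s) ^ 2
      ≤ ∫⁻ s in Ioo 0 T, 3 * hn 3 (mag (U s)) :=
    lintegral_mono fun s => by simpa using wnorm_wD_sq_le 3 (U s)
  refine lt_of_le_of_lt this ?_
  rw [lintegral_const_mul' _ _ (by norm_num)]
  refine ENNReal.mul_lt_top (by norm_num) (lt_of_le_of_lt ?_ h.lt_top)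
  exact lintegral_mono_set Ioo_subset_Ioc_self

theorem lintegral_hn_two_sq_ne_top_of_memL2W (hU : MeasVF U) (hc : ContInW (wD (1 / 2)) U T)
    (hL : MemL2W (wD (3 / 2)) U T) : ∫⁻ s in Ioc 0 T, hn 2 (mag (U s)) ^ 2 ≠ ⊤ := by
  have hb : ∃ M : ℝ≥0∞, M ≠ ⊤ ∧ ∀ s ∈ Icc 0 T, hn 1 (mag (U s)) ≤ M := by
    refine isCompact_Icc.induction_on (s := Icc 0 T)
      (p := fun S => ∃ M : ℝ≥0∞, M ≠ ⊤ ∧ ∀ s ∈ S, hn 1 (mag (U s)) ≤ M) ?_ ?_ ?_ ?_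
    · exact ⟨0, by simp, by simp⟩
    · rintro S S' hS ⟨M, hM, h⟩
      exact ⟨M, hM, fun s hs => h s (hS hs)⟩
    · rintro S S' ⟨M, hM, h⟩ ⟨M', hM', h'⟩
      refine ⟨M + M', by finiteness, ?_⟩
      rintro s (hs | hs)
      · exact (h s hs).trans le_self_add
      · exact (h' s hs).trans le_add_self
    · intro t ht
      obtain ⟨d, hd, h⟩ := hc.2 t ht 1 one_pos
      have hU1 : ∀ s, hn 1 (mag (U s)) ≤ wnorm (wD (1 / 2)) (U s) ^ 2 := fun s => by
        simpa using hn_mag_le 1 (U s)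
      refine ⟨Icc 0 T ∩ Metric.ball t d, inter_mem_nhdsWithin _ (Metric.ball_mem_nhds t hd),
        2 * 1 + 2 * hn 1 (mag (U t)), ?_, ?_⟩
      · have : hn 1 (mag (U t)) ≠ ⊤ :=
          ne_top_of_le_ne_top (by have := hc.1 t ht; finiteness) (hU1 t)
        finiteness
      · rintro s ⟨hs, hs'⟩
        have h1 := h s hs (by simpa [Real.dist_eq] using hs')
        have h2 : hn 1 (mag (U s - U t)) ≤ wnorm (wD (1 / 2)) (U s - U t) ^ 2 := by
          simpa using hn_mag_le 1 (U s - U t)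
        have h3 : wnorm (wD (1 / 2)) (U s - U t) ^ 2 ≤ 1 := pow_le_one₀ (by positivity) h1.le
        have hm : Measurable (mag (U s - U t)) := measurable_mag fun j =>
          ((hU j).comp measurable_prodMk_left).sub ((hU j).comp measurable_prodMk_left)
        calc hn 1 (mag (U s)) ≤ hn 1 (fun ξ => mag (U s - U t) ξ + mag (U t) ξ) := by
              refine hn_mono fun ξ => ?_
              have := enorm_add_le (U s ξ - U t ξ) (U t ξ)
              rwa [sub_add_cancel] at this
          _ ≤ 2 * hn 1 (mag (U s - U t)) + 2 * hn 1 (mag (U t)) := hn_add_le hm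
          _ ≤ 2 * 1 + 2 * hn 1 (mag (U t)) := by
              gcongr 2 * ?_ + _
              exact h2.trans h3
  obtain ⟨M, hM, h⟩ := hb
  have h3 : ∫⁻ s in Ioc 0 T, hn 3 (mag (U s)) ≠ ⊤ := by
    rw [setLIntegral_congr Ioo_ae_eq_Ioc.symm]
    refine ne_top_of_le_ne_top hL.ne (lintegral_mono fun s => ?_)
    simpa using hn_mag_le 3 (U s)
  exact ne_top_of_le_ne_top (ENNReal.mul_ne_top hM h3) (lintegral_hn_two_sq_le
    (measurable_mag_time hU) measurableSet_Ioc fun s hs => h s ⟨hs.1.le, hs.2⟩)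

end regularity

theorem lintegral_sq_eq_zero_of_le {a b : ℝ → ℝ≥0∞} (ha : Measurable a) (hb : Measurable b)
    {T : ℝ} (hA : ∫⁻ s in Ioc 0 T, a s ^ 2 ≠ ⊤) (hB : ∫⁻ s in Ioc 0 T, b s ^ 2 ≠ ⊤)
    {D : ℝ≥0∞} (hD : D ≠ ⊤)
    (h : ∀ t ∈ Icc 0 T, ∫⁻ s in Ioc 0 t, a s ^ 2 ≤ (D * ∫⁻ s in Ioc 0 t, a s * b s) ^ 2) :
    ∀ t ∈ Icc 0 T, ∫⁻ s in Ioc 0 t, a s ^ 2 = 0 := by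
  obtain ⟨ε, hε, hεD⟩ := ENNReal.exists_nnreal_pos_mul_lt (a := D ^ 2) (b := 1 / 2)
    (by finiteness) (by norm_num)
  obtain ⟨d, hd, hd'⟩ := exists_pos_setLIntegral_lt_of_measure_lt hB
    (ε := ε) (by simpa using hε.ne')
  obtain ⟨h', hh0, hhd⟩ : ∃ h' : ℝ, 0 < h' ∧ ENNReal.ofReal h' < d := by
    obtain ⟨r, hr, hr'⟩ := ENNReal.lt_iff_exists_nnreal_btwn.1 hd
    exact ⟨r, by simpa using hr, by simpa using hr'⟩
  have key (n : ℕ) : ∀ t ∈ Icc 0 T, t ≤ n * h' → ∫⁻ s in Ioc 0 t, a s ^ 2 = 0 := by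
    induction n with
    | zero =>
      intro t ht h0
      rw [Ioc_eq_empty (by simpa using h0)]
      simp
    | succ n ih =>
      intro t ht htn
      set t' := max 0 (t - h') with ht'
      have hd0 : t' ≤ t := max_le ht.1 (by linarith)
      have ht0 : 0 ≤ t' := le_max_left _ _
      have hA' := ih t' ⟨ht0, hd0.trans ht.2⟩
            (max_le (by positivity) (by push_cast at htn; linarith))
      have hAt : ∫⁻ s in Ioc 0 t, a s ^ 2 ≠ ⊤ :=
        ne_top_of_le_ne_top hA (lintegral_mono_set (Ioc_subset_Ioc_right ht.2))
      have h1 : ∫⁻ s in Ioc 0 t', a s * b s = 0 := by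
        have := lintegral_mul_sq_le (μ := volume.restrict (Ioc 0 t')) ha.aemeasurable
          hb.aemeasurable
        rw [hA', zero_mul] at this
        simpa using this
      have h2 : (∫⁻ s in Ioc t' t, a s * b s) ^ 2 ≤ (∫⁻ s in Ioc 0 t, a s ^ 2) * ε := by
        refine (lintegral_mul_sq_le ha.aemeasurable hb.aemeasurable).trans ?_
        refine mul_le_mul' (lintegral_mono_set (Ioc_subset_Ioc_left ht0)) ?_
        · have h3 : Ioc t' t ⊆ Ioc 0 T := Ioc_subset_Ioc ht0 ht.2
          have h4 := hd' (Ioc t' t) (by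
            refine (Measure.restrict_apply_le _ _).trans_lt (lt_of_le_of_lt ?_ hhd)
            rw [Real.volume_Ioc]
            exact ENNReal.ofReal_le_ofReal (by have := le_max_right 0 (t - h'); linarith))
          rw [Measure.restrict_restrict measurableSet_Ioc, inter_eq_left.2 h3] at h4
          exact h4.le
      have h3 := h t ht
      rw [← Ioc_union_Ioc_eq_Ioc ht0 hd0, lintegral_union measurableSet_Ioc
        (Ioc_disjoint_Ioc_of_le le_rfl) (f := fun s => a s * b s), h1, zero_add,
        Ioc_union_Ioc_eq_Ioc ht0 hd0, mul_pow] at h3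
      by_contra hne
      have h4 : ∫⁻ s in Ioc 0 t, a s ^ 2 ≤ (∫⁻ s in Ioc 0 t, a s ^ 2) * (1 / 2) := by
        refine (h3.trans (mul_le_mul_right h2 _)).trans ?_
        rw [mul_left_comm, mul_comm (D ^ 2)]
        exact mul_le_mul_right hεD.le _
      have h5 : ∫⁻ s in Ioc 0 t, a s ^ 2 < ∫⁻ s in Ioc 0 t, a s ^ 2 :=
        h4.trans_lt (by simpa [div_eq_mul_inv] using ENNReal.half_lt_self hne hAt)
      exact h5.false
  intro t ht
  obtain ⟨n, hn⟩ := exists_nat_ge (t / h')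
  exact key n t ht (by rwa [div_le_iff₀ hh0] at hn)

section uniqueness

variable {α : Coeffs} {U₀ : V3 → Fin 3 → ℂ} {U W : ℝ → V3 → Fin 3 → ℂ} {T : ℝ}

theorem IsMildSol.eq_of_lintegral_hn_two (hU : MeasVF U) (hW : MeasVF W)
    (hmU : IsMildSol α U₀ U T) (hmW : IsMildSol α U₀ W T)
    (h2U : ∫⁻ s in Ioc 0 T, hn 2 (mag (U s)) ^ 2 ≠ ⊤)
    (h2W : ∫⁻ s in Ioc 0 T, hn 2 (mag (W s)) ^ 2 ≠ ⊤) :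
    ∀ t ∈ Icc 0 T, ∀ ξ j, W t ξ j = U t ξ j := by
  have hUm := measurable_mag_time hU
  have hWm := measurable_mag_time hW
  set w : ℝ → V3 → ℝ≥0∞ := fun s => mag (U s - W s) with hw
  have hwm : Measurable (Function.uncurry w) :=
    measurable_mag_time (U := fun s => U s - W s) fun j => (hU j).sub (hW j)
  set V : ℝ → V3 → ℝ≥0∞ := fun s ξ => mag (U s) ξ + mag (W s) ξ with hV
  have hVm : Measurable (Function.uncurry V) := hUm.add hWm
  have hsq : ∀ x y : ℝ≥0∞, (2 * x + 2 * y) ^ 2 ≤ 8 * x ^ 2 + 8 * y ^ 2 := fun x y =>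
    (ENNReal.add_sq_le_two_mul _ _).trans (le_of_eq (by ring))
  have hfin : ∀ f : ℝ → ℝ≥0∞, (∀ s, f s ≤ 2 * hn 2 (mag (U s)) + 2 * hn 2 (mag (W s))) →
      ∫⁻ s in Ioc 0 T, f s ^ 2 ≠ ⊤ := by
    intro f hf
    have hm1 := measurable_hn (k := 2) hUm
    refine ne_top_of_le_ne_top ?_ (lintegral_mono fun s =>
      (pow_le_pow_left' (hf s) 2).trans (hsq _ _))
    rw [lintegral_add_left (by fun_prop), lintegral_const_mul' _ _ (by norm_num),
      lintegral_const_mul' _ _ (by norm_num)]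
    finiteness
  have hV2 := hfin (fun s => hn 2 (V s)) fun s => hn_add_le (measurable_slice hUm s)
  have hw2 := hfin (fun s => hn 2 (w s)) fun s => (hn_mono fun ξ => mag_sub_le _ _ ξ).trans
    (hn_add_le (measurable_slice hUm s))
  set b : ℝ → ℝ≥0∞ := fun s => hn 2 (mag (U s)) + hn 2 (mag (W s)) with hb
  have hb2 := hfin b fun s => by
    rw [hb, ← mul_add]
    exact le_mul_of_one_le_left (by positivity) (by norm_num)
  have hbm : Measurable b := (measurable_hn hUm).add (measurable_hn hWm)
  have ham : Measurable fun s => hn 2 (w s) := measurable_hn hwm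
  set K := symBound α
  have hK : K ≠ ⊤ := symBound_ne_top α
  set g : ℝ → V3 → ℝ≥0∞ := fun s ξ =>
    forc K w (fun s => mag (U s)) s ξ + forc K (fun s => mag (W s)) w s ξ with hg
  have hgm : Measurable (Function.uncurry g) :=
    (measurable_forc hwm hUm).add (measurable_forc hWm hwm)
  set D : ℝ≥0∞ := 2 * (K ^ 2 * prodConst) with hD
  have hDt : D ≠ ⊤ := by have := prodConst_ne_top; finiteness
  have hg1 : ∀ s, hn 1 (g s) ≤ D * (hn 2 (w s) * b s) := by
    intro s
    calc hn 1 (g s) ≤ 2 * hn 1 (forc K w (fun s => mag (U s)) s) +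
          2 * hn 1 (forc K (fun s => mag (W s)) w s) :=
          hn_add_le (measurable_slice (measurable_forc hwm hUm) s)
      _ ≤ 2 * (K ^ 2 * prodConst * (hn 2 (w s) * hn 2 (mag (U s)))) +
          2 * (K ^ 2 * prodConst * (hn 2 (mag (W s)) * hn 2 (w s))) := by
          gcongr 2 * ?_ + 2 * ?_
          · exact hn_forc_le hK hwm hUm s
          · exact hn_forc_le hK hWm hwm s
      _ = D * (hn 2 (w s) * b s) := by rw [hD, hb]; ring
  have hle : ∀ t ∈ Icc 0 T, ∀ᵐ ξ, w t ξ ≤ duh g t ξ := by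
    intro t ht
    filter_upwards [ae_lintegral_forc_sq_ne_top hK hVm hV2] with ξ hξ
    have hd : duh (forc K V V) t ξ ≠ ⊤ := by
      have h1 := (duh_sq_le (measurable_forc (K := K) hVm hVm) t ξ).trans
        (lintegral_mono_set (Ioc_subset_Ioc_right ht.2))
      have h2 := ne_top_of_le_ne_top hξ h1
      simpa using h2
    have eU : U t = mildRhs α U₀ U t := by ext ξ j; exact isMildSol_iff.1 hmU t ht ξ j
    have eW : W t = mildRhs α U₀ W t := by ext ξ j; exact isMildSol_iff.1 hmW t ht ξ j
    have h3 := mag_mildRhs_sub_le hVm hd U₀ hU hW (fun s _ ξ => le_self_add)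
      (fun s _ ξ => le_add_self)
    rwa [← eU, ← eW] at h3
  have hgi : ∀ t, ∫⁻ s in Ioc 0 t, hn 1 (g s) ≤ D * ∫⁻ s in Ioc 0 t, hn 2 (w s) * b s := by
    intro t
    rw [← lintegral_const_mul' _ _ hDt]
    exact lintegral_mono hg1
  have hzero := lintegral_sq_eq_zero_of_le ham hbm hw2 hb2 hDt fun t ht => by
    refine le_trans (setLIntegral_mono' measurableSet_Ioc fun s hs =>
      pow_le_pow_left' (hn_mono_ae (hle s ⟨hs.1.le, hs.2.trans ht.2⟩)) 2) ?_
    exact (lintegral_hn_two_sq_duh_le hgm t).trans (pow_le_pow_left' (hgi t) 2)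
  have hae : ∀ t ∈ Icc 0 T, U t =ᵐ[volume] W t := by
    intro t ht
    have h1 : ∫⁻ s in Ioc 0 t, hn 2 (w s) * b s = 0 := by
      have := lintegral_mul_sq_le (μ := volume.restrict (Ioc 0 t)) ham.aemeasurable
        hbm.aemeasurable
      rw [hzero t ht, zero_mul] at this
      simpa using this
    have h2 : hn 1 (w t) = 0 := by
      have := ((hn_mono_ae (hle t ht)).trans (hn_one_duh_le hgm t)).trans (hgi t)
      simpa [h1] using this
    have hwt := measurable_slice hwm t
    rw [hn, lintegral_eq_zero_iff (by fun_prop)] at h2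
    filter_upwards [h2, ae_ne_zero_V3] with ξ h3 h4
    have h5 : w t ξ = 0 := by simpa [ee_ne_zero h4] using h3
    exact sub_eq_zero.1 (by simpa [hw, mag] using h5)
  intro t ht ξ j
  rw [isMildSol_iff.1 hmU t ht ξ j, isMildSol_iff.1 hmW t ht ξ j,
    mildRhs_congr_ae α U₀ fun s hs => hae s ⟨hs.1.le, hs.2.trans ht.2⟩]

end uniqueness

/-- The exponential factor of the critical weight for `T = τ ^ 4`, with the frequency truncated
at `R`. -/
def expWt (lam τ R t : ℝ) (ξ : V3) : ℝ :=
  Real.exp (-(lam ^ 2 * t / (4 * τ ^ 4)) + lam * t / τ ^ 2 * min (en ξ) R)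

theorem expWt_pos (lam τ R t : ℝ) (ξ : V3) : 0 < expWt lam τ R t ξ := Real.exp_pos _

theorem measurable_expWt (lam τ R : ℝ) : Measurable (Function.uncurry (expWt lam τ R)) := by
  unfold expWt Function.uncurry
  have := measurable_en_snd
  fun_prop

theorem expWt_eq_mul (lam τ R s t : ℝ) (ξ : V3) :
    expWt lam τ R t ξ = expWt lam τ R (t - s) ξ * expWt lam τ R s ξ := by
  rw [expWt, expWt, expWt, ← Real.exp_add]
  ring_nf

section weights

variable {lam τ R : ℝ}

theorem min_en_le_add (hR : 0 ≤ R) (ξ η : V3) :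
    min (en ξ) R ≤ min (en η) R + min (en (ξ - η)) R := by
  have h1 := en_le_add_sub ξ η
  have h2 := en_nonneg η
  have h3 := en_nonneg (ξ - η)
  rcases le_total (en η) R with h | h <;> rcases le_total (en (ξ - η)) R with h' | h' <;>
    simp only [h, h', min_eq_left, min_eq_right]
  · exact (min_le_left _ _).trans h1
  · exact (min_le_right _ _).trans (by linarith)
  · exact (min_le_right _ _).trans (by linarith)
  · exact (min_le_right _ _).trans (by linarith)

theorem expWt_le_mul (hlam : 0 ≤ lam) (hτ : 0 < τ) (hR : 0 ≤ R) {s : ℝ} (hs : 0 ≤ s)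
    (hs' : s ≤ τ ^ 4) (ξ η : V3) :
    expWt lam τ R s ξ
      ≤ Real.exp (lam ^ 2 / 4) * (expWt lam τ R s η * expWt lam τ R s (ξ - η)) := by
  rw [expWt, expWt, expWt, ← Real.exp_add, ← Real.exp_add]
  refine Real.exp_le_exp.2 ?_
  have h1 : lam * s / τ ^ 2 * min (en ξ) R
      ≤ lam * s / τ ^ 2 * (min (en η) R + min (en (ξ - η)) R) := by
    gcongr
    exact min_en_le_add hR ξ η
  have h2 : lam ^ 2 * s / (4 * τ ^ 4) ≤ lam ^ 2 / 4 := by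
    rw [div_le_div_iff₀ (by positivity) (by norm_num)]
    nlinarith [mul_le_mul_of_nonneg_left hs' (sq_nonneg lam)]
  linarith

theorem lam_mul_div_sq_le (hlam : 0 ≤ lam) (hτ : 0 < τ) {s : ℝ} (hs' : s ≤ τ ^ 4) :
    lam * s / τ ^ 2 ≤ lam * τ ^ 2 := by
  rw [div_le_iff₀ (by positivity)]
  nlinarith [mul_le_mul_of_nonneg_left hs' hlam]

theorem expWt_le_of_low (hlam : 0 ≤ lam) (hτ : 0 < τ) (hlt : lam * τ ≤ 3) (hR : 0 ≤ R) {s : ℝ}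
    (hs : 0 ≤ s) (hs' : s ≤ τ ^ 4) {ξ η : V3} (hη : en η ≤ τ⁻¹) :
    expWt lam τ R s ξ ≤ Real.exp 3 * expWt lam τ R s (ξ - η) := by
  rw [expWt, expWt, ← Real.exp_add]
  refine Real.exp_le_exp.2 ?_
  have h1 : lam * s / τ ^ 2 * min (en ξ) R
      ≤ lam * s / τ ^ 2 * (min (en η) R + min (en (ξ - η)) R) := by
    gcongr
    exact min_en_le_add hR ξ η
  have h2 : lam * s / τ ^ 2 * min (en η) R ≤ lam * τ ^ 2 * τ⁻¹ := by
    gcongr ?_ * ?_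
    · exact le_min (en_nonneg _) hR
    · exact lam_mul_div_sq_le hlam hτ hs'
    · exact (min_le_left _ _).trans hη
  have h3 : lam * τ ^ 2 * τ⁻¹ = lam * τ := by field_simp
  linarith

theorem expWt_le_of_le (hlam : 0 ≤ lam) (hτ : 0 < τ) (hlt : lam * τ ≤ 3) (hR : 0 ≤ R) {s : ℝ}
    (hs : 0 ≤ s) (hs' : s ≤ τ ^ 4) {ξ : V3} (hξ : en ξ ≤ 2 * τ⁻¹) :
    expWt lam τ R s ξ ≤ Real.exp 6 := by
  rw [expWt]
  refine Real.exp_le_exp.2 ?_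
  have h2 : lam * s / τ ^ 2 * min (en ξ) R ≤ lam * τ ^ 2 * (2 * τ⁻¹) := by
    gcongr ?_ * ?_
    · exact le_min (en_nonneg _) hR
    · exact lam_mul_div_sq_le hlam hτ hs'
    · exact (min_le_left _ _).trans hξ
  have h3 : lam * τ ^ 2 * (2 * τ⁻¹) = 2 * (lam * τ) := by field_simp
  have h4 : 0 ≤ lam ^ 2 * s / (4 * τ ^ 4) := by positivity
  linarith

theorem rpow_mul_exp_sub_sq_le {q x b : ℝ} (hq : 0 ≤ q) (hq' : q ≤ 2) (hx : 0 ≤ x) :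
    x ^ q * Real.exp (-(x - b) ^ 2) ≤ 3 + 2 * b ^ 2 := by
  have h1 : x ^ q ≤ 1 + x ^ 2 := by
    rcases le_total x 1 with h | h
    · exact (Real.rpow_le_one hx h hq).trans (by nlinarith)
    · have := Real.rpow_le_rpow_of_exponent_le h hq'
      rw [Real.rpow_two] at this
      linarith
  have h2 : x ^ 2 ≤ 2 * (x - b) ^ 2 + 2 * b ^ 2 := by nlinarith [sq_nonneg (x - 2 * b)]
  set y := (x - b) ^ 2 with hy
  have hy0 : 0 ≤ y := sq_nonneg _
  have h3 : Real.exp (-y) ≤ 1 := Real.exp_le_one_iff.2 (by linarith)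
  have h4 : y * Real.exp (-y) ≤ 1 := by
    have h5 := Real.add_one_le_exp y
    have h6 : Real.exp y * Real.exp (-y) = 1 := by rw [← Real.exp_add]; simp
    nlinarith [Real.exp_pos (-y)]
  calc x ^ q * Real.exp (-y) ≤ (1 + 2 * y + 2 * b ^ 2) * Real.exp (-y) := by
        gcongr
        linarith
    _ = (1 + 2 * b ^ 2) * Real.exp (-y) + 2 * (y * Real.exp (-y)) := by ring
    _ ≤ (1 + 2 * b ^ 2) * 1 + 2 * 1 := by gcongr
    _ = 3 + 2 * b ^ 2 := by ring

theorem rpow_mul_heat_mul_expWt_le (hlam : 0 ≤ lam) (hτ : 0 < τ) {q : ℝ} (hq : 0 ≤ q)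
    (hq' : q ≤ 2) {t : ℝ} (ht : 0 ≤ t) (ht' : t ≤ τ ^ 4) (ξ : V3) :
    (√t * en ξ) ^ q * (Real.exp (-(t * en ξ ^ 2)) * expWt lam τ R t ξ) ≤ 3 * (1 + lam ^ 2) := by
  have hst : √t ≤ τ ^ 2 := by
    rw [Real.sqrt_le_left (by positivity)]
    exact ht'.trans (le_of_eq (by ring))
  set b := lam * √t / (2 * τ ^ 2) with hb
  have hb2 : b ^ 2 ≤ lam ^ 2 / 4 := by
    have h1 : b ≤ lam / 2 := by
      rw [hb, div_le_div_iff₀ (by positivity) (by norm_num)]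
      nlinarith [mul_le_mul_of_nonneg_left hst hlam]
    have h0 : 0 ≤ b := by positivity
    nlinarith
  have he : Real.exp (-(t * en ξ ^ 2)) * expWt lam τ R t ξ
      ≤ Real.exp (-(√t * en ξ - b) ^ 2) := by
    rw [expWt, ← Real.exp_add]
    refine Real.exp_le_exp.2 ?_
    have h1 : lam * t / τ ^ 2 * min (en ξ) R ≤ lam * t / τ ^ 2 * en ξ := by
      gcongr
      exact min_le_left _ _
    have h2 : -(√t * en ξ - b) ^ 2
        = -(√t ^ 2 * en ξ ^ 2)
            + (-(lam ^ 2 * √t ^ 2 / (4 * τ ^ 4)) + lam * √t ^ 2 / τ ^ 2 * en ξ) := by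
      rw [hb]; field_simp; ring
    rw [h2, Real.sq_sqrt ht]
    linarith
  calc _ ≤ (√t * en ξ) ^ q * Real.exp (-(√t * en ξ - b) ^ 2) := by
        gcongr
        exact Real.rpow_nonneg (mul_nonneg (Real.sqrt_nonneg _) (en_nonneg _)) q
    _ ≤ 3 + 2 * b ^ 2 :=
      rpow_mul_exp_sub_sq_le hq hq' (mul_nonneg (Real.sqrt_nonneg _) (en_nonneg _))
    _ ≤ 3 * (1 + lam ^ 2) := by nlinarith [sq_nonneg lam]

theorem rpow_mul_duhamel_mul_expWt_le (hlam : 0 ≤ lam) (hτ : 0 < τ) {δ : ℝ} (hδ : 0 ≤ δ)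
    (hδ' : δ ≤ 1) {s t : ℝ} (hs : 0 ≤ s) (hst : s < t) (ht' : t ≤ τ ^ 4) (ξ : V3) :
    (√t * en ξ) ^ δ * expWt lam τ R t ξ * (Real.exp (-((t - s) * en ξ ^ 2)) * en ξ)
      ≤ 3 * (1 + lam ^ 2) * t ^ (δ / 2) * ((t - s) ^ (-((1 + δ) / 2)) * expWt lam τ R s ξ) := by
  have hts : 0 < t - s := sub_pos.2 hst
  have h1 := rpow_mul_heat_mul_expWt_le (R := R) hlam hτ (q := 1 + δ) (by linarith) (by linarith)
    hts.le (by linarith) ξ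
  have e1 : (√t * en ξ) ^ δ = t ^ (δ / 2) * en ξ ^ δ := by
    rw [Real.mul_rpow (Real.sqrt_nonneg _) (en_nonneg _), Real.sqrt_eq_rpow,
      ← Real.rpow_mul (by linarith)]
    ring_nf
  have e2 : (√(t - s) * en ξ) ^ (1 + δ) * (t - s) ^ (-((1 + δ) / 2)) = en ξ ^ δ * en ξ := by
    rw [Real.mul_rpow (Real.sqrt_nonneg _) (en_nonneg _), Real.sqrt_eq_rpow,
      ← Real.rpow_mul hts.le, mul_right_comm, ← Real.rpow_add hts]
    have : 1 / 2 * (1 + δ) + -((1 + δ) / 2) = 0 := by ring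
    rw [this, Real.rpow_zero, one_mul, add_comm, Real.rpow_add_one' (en_nonneg _) (by linarith)]
  have hpos : 0 ≤ t ^ (δ / 2) * ((t - s) ^ (-((1 + δ) / 2)) * expWt lam τ R s ξ) := by
    have := expWt_pos lam τ R s ξ
    have := hs.trans hst.le
    positivity
  calc _ = ((√(t - s) * en ξ) ^ (1 + δ) * (Real.exp (-((t - s) * en ξ ^ 2)) *
        expWt lam τ R (t - s) ξ)) *
        (t ^ (δ / 2) * ((t - s) ^ (-((1 + δ) / 2)) * expWt lam τ R s ξ)) := by
        rw [e1, expWt_eq_mul lam τ R s t]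
        linear_combination (-(t ^ (δ / 2)) * expWt lam τ R (t - s) ξ * expWt lam τ R s ξ *
          Real.exp (-((t - s) * en ξ ^ 2))) * e2
    _ ≤ 3 * (1 + lam ^ 2) *
        (t ^ (δ / 2) * ((t - s) ^ (-((1 + δ) / 2)) * expWt lam τ R s ξ)) := by gcongr
    _ = _ := by ring

end weights

/-- The part of `g` supported on frequencies at least `J`. -/
def hiPart (J : ℝ) (g : V3 → ℝ≥0∞) (ξ : V3) : ℝ≥0∞ := if J ≤ en ξ then g ξ else 0

/-- The part of `g` supported on frequencies below `J`. -/
def loPart (J : ℝ) (g : V3 → ℝ≥0∞) (ξ : V3) : ℝ≥0∞ := if J ≤ en ξ then 0 else g ξ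

/-- The exponential weight applied to the high frequencies of `g`. -/
def expHi (lam τ R t : ℝ) (g : V3 → ℝ≥0∞) (ξ : V3) : ℝ≥0∞ :=
  ENNReal.ofReal (expWt lam τ R t ξ) * hiPart τ⁻¹ g ξ

/-- The square of the critical norm at time `t`, with the exponential truncated at `R`. -/
def critSq (δ lam τ R t : ℝ) (g : V3 → ℝ≥0∞) : ℝ≥0∞ :=
  ∫⁻ ξ, (ENNReal.ofReal ((√t * en ξ) ^ δ * √(en ξ)) * expHi lam τ R t g ξ) ^ 2

theorem hiPart_le (J : ℝ) (g : V3 → ℝ≥0∞) (ξ : V3) : hiPart J g ξ ≤ g ξ := by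
  unfold hiPart
  split_ifs <;> simp

theorem measurableSet_le_en (J : ℝ) : MeasurableSet {p : ℝ × V3 | J ≤ en p.2} :=
  measurableSet_le measurable_const measurable_en_snd

theorem measurable_hiPart_time {J : ℝ} {f : ℝ → V3 → ℝ≥0∞} (hf : Measurable (Function.uncurry f)) :
    Measurable (Function.uncurry fun s => hiPart J (f s)) :=
  Measurable.ite (measurableSet_le_en J) hf measurable_const

theorem measurable_loPart_time {J : ℝ} {f : ℝ → V3 → ℝ≥0∞} (hf : Measurable (Function.uncurry f)) :
    Measurable (Function.uncurry fun s => loPart J (f s)) :=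
  Measurable.ite (measurableSet_le_en J) measurable_const hf

theorem measurable_hiPart {J : ℝ} {g : V3 → ℝ≥0∞} (hg : Measurable g) :
    Measurable (hiPart J g) :=
  Measurable.ite (measurableSet_le measurable_const measurable_en) hg measurable_const

theorem measurable_expHi_time {lam τ R : ℝ} {f : ℝ → V3 → ℝ≥0∞}
    (hf : Measurable (Function.uncurry f)) :
    Measurable (Function.uncurry fun s => expHi lam τ R s (f s)) :=
  (measurable_expWt lam τ R).ennreal_ofReal.mul (measurable_hiPart_time hf)

theorem hn_two_loPart_le {J : ℝ} (g : V3 → ℝ≥0∞) :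
    hn 2 (loPart J g) ≤ ENNReal.ofReal J * hn 1 g := by
  rw [hn, hn, ← lintegral_const_mul' _ _ ENNReal.ofReal_ne_top]
  refine lintegral_mono fun ξ => ?_
  unfold loPart
  split_ifs with h
  · simp
  · rw [pow_two (ee ξ), pow_one, mul_assoc]
    gcongr
    exact ENNReal.ofReal_le_ofReal (not_le.1 h).le

theorem ofReal_sqrt_en_sq (ξ : V3) : ENNReal.ofReal √(en ξ) ^ 2 = ee ξ := by
  rw [← ENNReal.ofReal_pow (Real.sqrt_nonneg _), Real.sq_sqrt (en_nonneg ξ), ee]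

theorem critSq_half {lam τ R t : ℝ} (g : V3 → ℝ≥0∞) :
    critSq (1 / 2) lam τ R t g = ENNReal.ofReal √t * hn 2 (expHi lam τ R t g) := by
  rw [critSq, hn, ← lintegral_const_mul' _ _ ENNReal.ofReal_ne_top]
  refine lintegral_congr fun ξ => ?_
  have h0 : 0 ≤ √t * en ξ := mul_nonneg (Real.sqrt_nonneg _) (en_nonneg _)
  rw [mul_pow, ENNReal.ofReal_mul (by positivity), mul_pow, ofReal_sqrt_en_sq,
    ← ENNReal.ofReal_pow (by positivity), ← Real.sqrt_eq_rpow, Real.sq_sqrt h0,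
    ENNReal.ofReal_mul (Real.sqrt_nonneg _), ← ee]
  ring

section forcing

variable {lam τ R : ℝ} {K : ℝ≥0∞} {f : ℝ → V3 → ℝ≥0∞}

theorem conv_le_of_high {J : ℝ} {g : V3 → ℝ≥0∞} (hg : Measurable g) {ξ : V3}
    (hξ : 2 * J ≤ en ξ) :
    conv g g ξ ≤ conv (hiPart J g) (hiPart J g) ξ +
      (∫⁻ η, loPart J g η * hiPart J g (ξ - η)) + ∫⁻ η, hiPart J g η * loPart J g (ξ - η) := by
  have hh := measurable_hiPart (J := J) hg
  have hl : Measurable (loPart J g) :=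
    Measurable.ite (measurableSet_le measurable_const measurable_en) measurable_const hg
  have hsub : Measurable fun η : V3 => ξ - η := by fun_prop
  have m1 : Measurable fun η => hiPart J g η * hiPart J g (ξ - η) := hh.mul (hh.comp hsub)
  have m2 : Measurable fun η => hiPart J g η * hiPart J g (ξ - η) +
      loPart J g η * hiPart J g (ξ - η) := m1.add (hl.mul (hh.comp hsub))
  unfold conv
  rw [← lintegral_add_left m1, ← lintegral_add_left m2]
  refine lintegral_mono fun η => ?_
  have h1 := en_le_add_sub ξ η
  unfold hiPart loPart
  by_cases ha : J ≤ en η <;> by_cases hb : J ≤ en (ξ - η) <;> simp [ha, hb]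
  push Not at ha hb
  linarith

/-- The majorant of the exponentially weighted forcing at high frequencies. -/
def expForc (K : ℝ≥0∞) (lam τ R : ℝ) (f : ℝ → V3 → ℝ≥0∞) (s : ℝ) (ξ : V3) : ℝ≥0∞ :=
  forc (K * ENNReal.ofReal (Real.exp (lam ^ 2 / 4))) (fun s => expHi lam τ R s (f s))
      (fun s => expHi lam τ R s (f s)) s ξ +
    (forc (K * ENNReal.ofReal (Real.exp 3)) (fun s => loPart τ⁻¹ (f s))
      (fun s => expHi lam τ R s (f s)) s ξ +
    forc (K * ENNReal.ofReal (Real.exp 3)) (fun s => expHi lam τ R s (f s))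
      (fun s => loPart τ⁻¹ (f s)) s ξ)

theorem measurable_expForc (hf : Measurable (Function.uncurry f)) :
    Measurable (Function.uncurry (expForc K lam τ R f)) :=
  have h1 := measurable_expHi_time (lam := lam) (τ := τ) (R := R) hf
  have h2 := measurable_loPart_time (J := τ⁻¹) hf
  (measurable_forc h1 h1).add ((measurable_forc h2 h1).add (measurable_forc h1 h2))

theorem expWt_mul_forc_le (hlam : 0 ≤ lam) (hτ : 0 < τ) (hlt : lam * τ ≤ 3) (hR : 0 ≤ R)
    (hf : Measurable (Function.uncurry f)) {s : ℝ} (hs : 0 ≤ s) (hs' : s ≤ τ ^ 4) {ξ : V3}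
    (hξ : 2 * τ⁻¹ ≤ en ξ) :
    ENNReal.ofReal (expWt lam τ R s ξ) * forc K f f s ξ ≤ expForc K lam τ R f s ξ := by
  set E := ENNReal.ofReal (expWt lam τ R s ξ) with hE
  have h1 : E * conv (hiPart τ⁻¹ (f s)) (hiPart τ⁻¹ (f s)) ξ
      ≤ ENNReal.ofReal (Real.exp (lam ^ 2 / 4)) *
        conv (expHi lam τ R s (f s)) (expHi lam τ R s (f s)) ξ := by
    unfold conv
    rw [← lintegral_const_mul' _ _ ENNReal.ofReal_ne_top,
      ← lintegral_const_mul' _ _ ENNReal.ofReal_ne_top]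
    refine lintegral_mono fun η => ?_
    have h := ENNReal.ofReal_le_ofReal (expWt_le_mul hlam hτ hR hs hs' ξ η)
    rw [ENNReal.ofReal_mul (Real.exp_nonneg _), ENNReal.ofReal_mul (expWt_pos _ _ _ _ _).le] at h
    refine (mul_le_mul_left h _).trans (le_of_eq ?_)
    unfold expHi
    ring
  have hlo (η : V3) : loPart τ⁻¹ (f s) η ≠ 0 → en η ≤ τ⁻¹ := by
    unfold loPart
    split_ifs with h
    · simp
    · exact fun _ => (not_le.1 h).le
  have h2 : E * ∫⁻ η, loPart τ⁻¹ (f s) η * hiPart τ⁻¹ (f s) (ξ - η)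
      ≤ ENNReal.ofReal (Real.exp 3) * conv (loPart τ⁻¹ (f s)) (expHi lam τ R s (f s)) ξ := by
    unfold conv
    rw [← lintegral_const_mul' _ _ ENNReal.ofReal_ne_top,
      ← lintegral_const_mul' _ _ ENNReal.ofReal_ne_top]
    refine lintegral_mono fun η => ?_
    by_cases h0 : loPart τ⁻¹ (f s) η = 0
    · simp [h0]
    have h := ENNReal.ofReal_le_ofReal (expWt_le_of_low hlam hτ hlt hR hs hs' (ξ := ξ) (hlo η h0))
    rw [ENNReal.ofReal_mul (Real.exp_nonneg _)] at h
    refine (mul_le_mul_left h _).trans (le_of_eq ?_)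
    unfold expHi
    ring
  have h3 : E * ∫⁻ η, hiPart τ⁻¹ (f s) η * loPart τ⁻¹ (f s) (ξ - η)
      ≤ ENNReal.ofReal (Real.exp 3) * conv (expHi lam τ R s (f s)) (loPart τ⁻¹ (f s)) ξ := by
    unfold conv
    rw [← lintegral_const_mul' _ _ ENNReal.ofReal_ne_top,
      ← lintegral_const_mul' _ _ ENNReal.ofReal_ne_top]
    refine lintegral_mono fun η => ?_
    by_cases h0 : loPart τ⁻¹ (f s) (ξ - η) = 0
    · simp [h0]
    have h := ENNReal.ofReal_le_ofReal
      (expWt_le_of_low hlam hτ hlt hR hs hs' (ξ := ξ) (hlo _ h0))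
    rw [ENNReal.ofReal_mul (Real.exp_nonneg _), sub_sub_cancel] at h
    refine (mul_le_mul_left h _).trans (le_of_eq ?_)
    unfold expHi
    ring
  calc E * forc K f f s ξ
      ≤ E * (K * (conv (hiPart τ⁻¹ (f s)) (hiPart τ⁻¹ (f s)) ξ +
        (∫⁻ η, loPart τ⁻¹ (f s) η * hiPart τ⁻¹ (f s) (ξ - η)) +
        ∫⁻ η, hiPart τ⁻¹ (f s) η * loPart τ⁻¹ (f s) (ξ - η))) :=
        mul_le_mul_right (mul_le_mul_right (conv_le_of_high (measurable_slice hf s) hξ) _) _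
    _ = K * (E * conv (hiPart τ⁻¹ (f s)) (hiPart τ⁻¹ (f s)) ξ +
        (E * (∫⁻ η, loPart τ⁻¹ (f s) η * hiPart τ⁻¹ (f s) (ξ - η)) +
        E * ∫⁻ η, hiPart τ⁻¹ (f s) η * loPart τ⁻¹ (f s) (ξ - η))) := by ring
    _ ≤ _ := mul_le_mul_right (add_le_add h1 (add_le_add h2 h3)) _
    _ = expForc K lam τ R f s ξ := by
        unfold expForc forc
        ring

theorem ofReal_exp_sq (x : ℝ) :
    ENNReal.ofReal (Real.exp x) ^ 2 = ENNReal.ofReal (Real.exp (2 * x)) := by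
  rw [← ENNReal.ofReal_pow (Real.exp_nonneg _), ← Real.exp_nat_mul]
  norm_num

theorem ofReal_mul_hn_one_expForc_le (hK : K ≠ ⊤) (hτ : 0 < τ)
    (hf : Measurable (Function.uncurry f)) {s : ℝ} (hs : 0 ≤ s) (hs' : s ≤ τ ^ 4) {y M : ℝ≥0∞}
    (hy : critSq (1 / 2) lam τ R s (f s) ≤ y) (hM : hn 1 (f s) ≤ M) :
    ENNReal.ofReal s * hn 1 (expForc K lam τ R f s)
      ≤ 8 * (K ^ 2 * prodConst * ENNReal.ofReal (Real.exp 6)) *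
        (ENNReal.ofReal (Real.exp (lam ^ 2 / 2)) * y ^ 2 + ENNReal.ofReal τ * M * y) := by
  have m1 := measurable_expHi_time (lam := lam) (τ := τ) (R := R) hf
  have m2 := measurable_loPart_time (J := τ⁻¹) hf
  set N := hn 2 (expHi lam τ R s (f s)) with hN
  set L := hn 2 (loPart τ⁻¹ (f s)) with hL
  set P := prodConst
  set e1 := ENNReal.ofReal (Real.exp (lam ^ 2 / 4)) with he1
  set e3 := ENNReal.ofReal (Real.exp 3) with he3
  have hLM : L ≤ ENNReal.ofReal τ⁻¹ * M := (hn_two_loPart_le _).trans (mul_le_mul_right hM _)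
  have hK1 : K * e1 ≠ ⊤ := by finiteness
  have hK3 : K * e3 ≠ ⊤ := by finiteness
  rw [critSq_half] at hy
  have hss : ENNReal.ofReal s = ENNReal.ofReal √s * ENNReal.ofReal √s := by
    rw [← ENNReal.ofReal_mul (Real.sqrt_nonneg _), Real.mul_self_sqrt hs]
  have hsτ : ENNReal.ofReal √s * ENNReal.ofReal τ⁻¹ ≤ ENNReal.ofReal τ := by
    rw [← ENNReal.ofReal_mul (Real.sqrt_nonneg _)]
    refine ENNReal.ofReal_le_ofReal ?_
    rw [← div_eq_mul_inv, div_le_iff₀ hτ, Real.sqrt_le_left (by positivity)]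
    exact hs'.trans (le_of_eq (by ring))
  have hH : hn 1 (expForc K lam τ R f s)
      ≤ 2 * ((K * e1) ^ 2 * P * (N * N)) +
        2 * (2 * ((K * e3) ^ 2 * P * (L * N)) + 2 * ((K * e3) ^ 2 * P * (N * L))) := by
    refine (hn_add_le (measurable_slice (measurable_forc m1 m1) s)).trans ?_
    gcongr 2 * ?_ + 2 * ?_
    · exact hn_forc_le hK1 m1 m1 s
    · refine (hn_add_le (measurable_slice (measurable_forc m2 m1) s)).trans ?_
      gcongr 2 * ?_ + 2 * ?_
      · exact hn_forc_le hK3 m2 m1 s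
      · exact hn_forc_le hK3 m1 m2 s
  have he1' : e1 ^ 2 = ENNReal.ofReal (Real.exp (lam ^ 2 / 2)) := by
    rw [he1, ofReal_exp_sq]; ring_nf
  have he3' : e3 ^ 2 = ENNReal.ofReal (Real.exp 6) := by
    rw [he3, ofReal_exp_sq]; norm_num
  have h6 : 1 ≤ ENNReal.ofReal (Real.exp 6) :=
    ENNReal.one_le_ofReal.2 (Real.one_le_exp (by norm_num))
  calc ENNReal.ofReal s * hn 1 (expForc K lam τ R f s)
      ≤ ENNReal.ofReal s * (2 * ((K * e1) ^ 2 * P * (N * N)) +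
        2 * (2 * ((K * e3) ^ 2 * P * (L * N)) + 2 * ((K * e3) ^ 2 * P * (N * L)))) := by gcongr
    _ ≤ ENNReal.ofReal s * (2 * ((K * e1) ^ 2 * P * (N * N)) +
        2 * (2 * ((K * e3) ^ 2 * P * (ENNReal.ofReal τ⁻¹ * M * N)) +
          2 * ((K * e3) ^ 2 * P * (N * (ENNReal.ofReal τ⁻¹ * M))))) := by gcongr
    _ = 2 * (K ^ 2 * P * 1 * (e1 ^ 2 * (ENNReal.ofReal √s * N) ^ 2)) +
        8 * (K ^ 2 * P * e3 ^ 2 * ((ENNReal.ofReal √s * ENNReal.ofReal τ⁻¹) * M *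
          (ENNReal.ofReal √s * N))) := by rw [hss]; ring
    _ ≤ 8 * (K ^ 2 * P * ENNReal.ofReal (Real.exp 6) * (e1 ^ 2 * y ^ 2)) +
        8 * (K ^ 2 * P * e3 ^ 2 * (ENNReal.ofReal τ * M * y)) := by
        gcongr
        norm_num
    _ = _ := by rw [he1', he3']; ring

end forcing

section master

variable {δ lam τ R t : ℝ} {K : ℝ≥0∞} {f : ℝ → V3 → ℝ≥0∞} {a : V3 → ℝ≥0∞}

theorem duh_mul_expWt_le (hlam : 0 ≤ lam) (hτ : 0 < τ) (hlt : lam * τ ≤ 3) (hR : 0 ≤ R)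
    (hδ : 0 ≤ δ) (hδ' : δ ≤ 1) (hf : Measurable (Function.uncurry f)) (ht' : t ≤ τ ^ 4)
    {ξ : V3} (hξ : 2 * τ⁻¹ ≤ en ξ) :
    ENNReal.ofReal ((√t * en ξ) ^ δ * √(en ξ)) *
        (ENNReal.ofReal (expWt lam τ R t ξ) * duh (forc K f f) t ξ)
      ≤ ENNReal.ofReal (3 * (1 + lam ^ 2) * t ^ (δ / 2)) *
        ∫⁻ s in Ioc 0 t, ENNReal.ofReal ((t - s) ^ (-((1 + δ) / 2))) *
          (ENNReal.ofReal √(en ξ) * expForc K lam τ R f s ξ) := by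
  unfold duh
  rw [← lintegral_const_mul' _ _ ENNReal.ofReal_ne_top,
    ← lintegral_const_mul' _ _ ENNReal.ofReal_ne_top,
    ← lintegral_const_mul' _ _ ENNReal.ofReal_ne_top, setLIntegral_congr Ioo_ae_eq_Ioc.symm,
    setLIntegral_congr Ioo_ae_eq_Ioc.symm]
  refine setLIntegral_mono' measurableSet_Ioo fun s hs => ?_
  have hts : 0 < t - s := sub_pos.2 hs.2
  have ht : 0 < t := hs.1.trans hs.2
  have h0 : 0 ≤ (√t * en ξ) ^ δ :=
    Real.rpow_nonneg (mul_nonneg (Real.sqrt_nonneg _) (en_nonneg _)) _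
  have h1 := ENNReal.ofReal_le_ofReal
    (rpow_mul_duhamel_mul_expWt_le (R := R) hlam hτ hδ hδ' hs.1.le hs.2 ht' ξ)
  rw [ENNReal.ofReal_mul (mul_nonneg h0 (expWt_pos _ _ _ _ _).le), ENNReal.ofReal_mul h0,
    ENNReal.ofReal_mul (Real.exp_nonneg _), ENNReal.ofReal_mul (by positivity),
    ENNReal.ofReal_mul (Real.rpow_nonneg hts.le _)] at h1
  have h2 := expWt_mul_forc_le (K := K) hlam hτ hlt hR hf hs.1.le (hs.2.le.trans ht') hξ
  rw [ENNReal.ofReal_mul h0]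
  set A := ENNReal.ofReal ((√t * en ξ) ^ δ)
  set B := ENNReal.ofReal √(en ξ)
  set D := ENNReal.ofReal (3 * (1 + lam ^ 2) * t ^ (δ / 2))
  set k := ENNReal.ofReal ((t - s) ^ (-((1 + δ) / 2)))
  set X := ENNReal.ofReal (expWt lam τ R t ξ)
  set Y := ENNReal.ofReal (expWt lam τ R s ξ)
  set H := ENNReal.ofReal (Real.exp (-((t - s) * en ξ ^ 2)))
  calc A * B * (X * (H * (ee ξ * forc K f f s ξ)))
      = A * X * (H * ee ξ) * (B * forc K f f s ξ) := by ring
    _ ≤ D * (k * Y) * (B * forc K f f s ξ) := mul_le_mul_left h1 _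
    _ = D * (k * (B * (Y * forc K f f s ξ))) := by ring
    _ ≤ D * (k * (B * expForc K lam τ R f s ξ)) := by gcongr

theorem lin_mul_expWt_le (hlam : 0 ≤ lam) (hτ : 0 < τ) (hδ : 0 ≤ δ) (hδ' : δ ≤ 1) (ht : 0 ≤ t)
    (ht' : t ≤ τ ^ 4) (ξ : V3) :
    ENNReal.ofReal ((√t * en ξ) ^ δ * √(en ξ)) *
        (ENNReal.ofReal (expWt lam τ R t ξ) * lin a t ξ)
      ≤ ENNReal.ofReal (3 * (1 + lam ^ 2)) * (ENNReal.ofReal √(en ξ) * a ξ) := by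
  have h0 : 0 ≤ (√t * en ξ) ^ δ :=
    Real.rpow_nonneg (mul_nonneg (Real.sqrt_nonneg _) (en_nonneg _)) _
  have h1 := ENNReal.ofReal_le_ofReal
    (rpow_mul_heat_mul_expWt_le (R := R) hlam hτ hδ (hδ'.trans one_le_two) ht ht' ξ)
  rw [ENNReal.ofReal_mul h0, ENNReal.ofReal_mul (Real.exp_nonneg _)] at h1
  rw [ENNReal.ofReal_mul h0]
  unfold lin
  refine le_trans (le_of_eq ?_) (mul_le_mul_left h1 _)
  ring

theorem weight_le_of_le (hlam : 0 ≤ lam) (hτ : 0 < τ) (hτ' : τ ≤ 1) (hlt : lam * τ ≤ 3)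
    (hR : 0 ≤ R) (hδ : 0 ≤ δ) (hδ' : δ ≤ 1) (ht : 0 ≤ t) (ht' : t ≤ τ ^ 4) {ξ : V3}
    (hξ : en ξ ≤ 2 * τ⁻¹) :
    (√t * en ξ) ^ δ * expWt lam τ R t ξ ≤ 2 * Real.exp 6 := by
  have h0 : 0 ≤ √t * en ξ := mul_nonneg (Real.sqrt_nonneg _) (en_nonneg _)
  have hst : √t ≤ τ ^ 2 := by
    rw [Real.sqrt_le_left (by positivity)]
    exact ht'.trans (le_of_eq (by ring))
  have h1 : √t * en ξ ≤ 2 := by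
    calc √t * en ξ ≤ τ ^ 2 * (2 * τ⁻¹) := by gcongr; exact en_nonneg _
      _ = 2 * τ := by field_simp
      _ ≤ 2 := by linarith
  have h2 : (√t * en ξ) ^ δ ≤ 2 := by
    calc (√t * en ξ) ^ δ ≤ 2 ^ δ := Real.rpow_le_rpow h0 h1 hδ
      _ ≤ 2 ^ (1 : ℝ) := Real.rpow_le_rpow_of_exponent_le one_le_two hδ'
      _ = 2 := Real.rpow_one 2
  exact mul_le_mul h2 (expWt_le_of_le hlam hτ hlt hR ht ht' hξ) (expWt_pos _ _ _ _ _).le two_pos.le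

/-- The constant in the weighted energy inequality. -/
def enConst (K : ℝ≥0∞) : ℝ≥0∞ :=
  (4 * ENNReal.ofReal (Real.exp 12) + 2) + 2304 * (K ^ 2 * prodConst * ENNReal.ofReal (Real.exp 6))

theorem enConst_ne_top (hK : K ≠ ⊤) : enConst K ≠ ⊤ := by
  have := prodConst_ne_top
  unfold enConst
  finiteness

theorem one_le_enConst (K : ℝ≥0∞) : 1 ≤ enConst K := by
  have h : (1 : ℝ≥0∞) ≤ 2 := one_le_two
  exact (h.trans le_add_self).trans le_self_add

/-- The weighted energy inequality for functions dominated by the Duhamel iteration. -/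
theorem critSq_le (hK : K ≠ ⊤) (hlam : 0 ≤ lam) (hτ : 0 < τ) (hτ' : τ ≤ 1) (hlt : lam * τ ≤ 3)
    (hR : 0 ≤ R) (hδ : 0 ≤ δ) (hδ' : δ ≤ 1 / 2) (ha : Measurable a)
    (hf : Measurable (Function.uncurry f)) (ht : t ∈ Ioc 0 (τ ^ 4))
    (hmaj : ∀ ξ, f t ξ ≤ majStep K a f t ξ) {y z M : ℝ≥0∞}
    (hy : ∀ s ∈ Ioc 0 (τ ^ 4), critSq (1 / 2) lam τ R s (f s) ≤ y)
    (hzf : hn 1 (hiPart τ⁻¹ (f t)) ≤ z) (hza : hn 1 (hiPart τ⁻¹ a) ≤ z)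
    (hM : ∀ s ∈ Ioc 0 (τ ^ 4), hn 1 (f s) ≤ M) :
    critSq δ lam τ R t (f t) ≤ enConst K * ENNReal.ofReal (3 * (1 + lam ^ 2)) ^ 2 *
      (z + (ENNReal.ofReal (Real.exp (lam ^ 2 / 2)) * y ^ 2 + ENNReal.ofReal τ * M * y)) := by
  have hδ1 : δ ≤ 1 := by linarith
  set Λ := ENNReal.ofReal (3 * (1 + lam ^ 2)) with hΛ
  set p := (1 + δ) / 2 with hp
  set G : ℝ → V3 → ℝ≥0∞ := fun s ξ => ENNReal.ofReal √(en ξ) * expForc K lam τ R f s ξ with hG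
  have hGm : Measurable (Function.uncurry G) := by
    have h1 := measurable_expForc (K := K) (lam := lam) (τ := τ) (R := R) hf
    have h2 : Measurable fun q : ℝ × V3 => ENNReal.ofReal √(en q.2) := by
      have := measurable_en_snd
      fun_prop
    exact h2.mul h1
  have hG2 (s : ℝ) : ∫⁻ ξ, G s ξ ^ 2 = hn 1 (expForc K lam τ R f s) := by
    unfold hn
    refine lintegral_congr fun ξ => ?_
    rw [hG, mul_pow, ofReal_sqrt_en_sq, pow_one]
  set A := 8 * (K ^ 2 * prodConst * ENNReal.ofReal (Real.exp 6)) *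
    (ENNReal.ofReal (Real.exp (lam ^ 2 / 2)) * y ^ 2 + ENNReal.ofReal τ * M * y) with hA
  have hker := lintegral_kernel_sq_le (p := p) (by rw [hp]; linarith) (by rw [hp]; linarith) ht.1
    hGm (A := A) fun s hs => by
      have hs' : s ∈ Ioc 0 (τ ^ 4) := ⟨hs.1, hs.2.trans ht.2⟩
      rw [hG2]
      exact ofReal_mul_hn_one_expForc_le hK hτ hf hs.1.le hs'.2 (hy s hs') (hM s hs')
  set D := ENNReal.ofReal (3 * (1 + lam ^ 2) * t ^ (δ / 2)) with hD
  have hD2 : D ^ 2 * ENNReal.ofReal (144 * t ^ (1 - 2 * p)) = 144 * Λ ^ 2 := by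
    have hΛ0 : (0 : ℝ) ≤ 3 * (1 + lam ^ 2) := by positivity
    rw [hD, hΛ, ← ENNReal.ofReal_pow (mul_nonneg hΛ0 (Real.rpow_nonneg ht.1.le _)),
      ← ENNReal.ofReal_mul (by positivity), ← ENNReal.ofReal_pow hΛ0]
    have e : (3 * (1 + lam ^ 2) * t ^ (δ / 2)) ^ 2 * (144 * t ^ (1 - 2 * p))
        = 144 * (3 * (1 + lam ^ 2)) ^ 2 := by
      have e1 : (t ^ (δ / 2)) ^ 2 * t ^ (1 - 2 * p) = 1 := by
        rw [← Real.rpow_natCast, ← Real.rpow_mul ht.1.le, ← Real.rpow_add ht.1, hp]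
        convert Real.rpow_zero t using 2
        push_cast
        ring
      linear_combination (144 * (3 * (1 + lam ^ 2)) ^ 2) * e1
    rw [e, ENNReal.ofReal_mul (by norm_num)]
    norm_num
  set I : V3 → ℝ≥0∞ := fun ξ => ∫⁻ s in Ioc 0 t, ENNReal.ofReal ((t - s) ^ (-p)) * G s ξ with hI
  have pt (ξ : V3) :
      (ENNReal.ofReal ((√t * en ξ) ^ δ * √(en ξ)) * expHi lam τ R t (f t) ξ) ^ 2
        ≤ 4 * ENNReal.ofReal (Real.exp 12) * (ee ξ ^ 1 * hiPart τ⁻¹ (f t) ξ ^ 2) +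
          (2 * Λ ^ 2 * (ee ξ ^ 1 * hiPart τ⁻¹ a ξ ^ 2) + 2 * D ^ 2 * I ξ ^ 2) := by
    have h0 : 0 ≤ (√t * en ξ) ^ δ :=
      Real.rpow_nonneg (mul_nonneg (Real.sqrt_nonneg _) (en_nonneg _)) _
    unfold expHi
    rcases le_total (en ξ) (2 * τ⁻¹) with hξ | hξ
    · refine le_trans ?_ le_self_add
      have h1 := ENNReal.ofReal_le_ofReal
        (weight_le_of_le hlam hτ hτ' hlt hR hδ hδ1 ht.1.le ht.2 hξ)
      rw [ENNReal.ofReal_mul h0] at h1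
      rw [ENNReal.ofReal_mul h0]
      calc _ = (ENNReal.ofReal ((√t * en ξ) ^ δ) * ENNReal.ofReal (expWt lam τ R t ξ) *
            (ENNReal.ofReal √(en ξ) * hiPart τ⁻¹ (f t) ξ)) ^ 2 := by ring
        _ ≤ (ENNReal.ofReal (2 * Real.exp 6) *
            (ENNReal.ofReal √(en ξ) * hiPart τ⁻¹ (f t) ξ)) ^ 2 := by gcongr
        _ = _ := by
          rw [mul_pow, mul_pow, ofReal_sqrt_en_sq, ENNReal.ofReal_mul two_pos.le, mul_pow,
            ofReal_exp_sq]
          norm_num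
    · refine le_trans ?_ le_add_self
      have hξ' : τ⁻¹ ≤ en ξ := by
        have := inv_pos.2 hτ
        linarith
      have e1 : hiPart τ⁻¹ (f t) ξ = f t ξ := if_pos hξ'
      have e2 : hiPart τ⁻¹ a ξ = a ξ := if_pos hξ'
      rw [e1, e2]
      calc _ ≤ (ENNReal.ofReal ((√t * en ξ) ^ δ * √(en ξ)) *
            (ENNReal.ofReal (expWt lam τ R t ξ) * lin a t ξ) +
            ENNReal.ofReal ((√t * en ξ) ^ δ * √(en ξ)) *
            (ENNReal.ofReal (expWt lam τ R t ξ) * duh (forc K f f) t ξ)) ^ 2 := by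
            rw [← mul_add, ← mul_add]
            gcongr
            exact hmaj ξ
        _ ≤ (Λ * (ENNReal.ofReal √(en ξ) * a ξ) + D * I ξ) ^ 2 := by
            gcongr ?_ ^ 2
            exact add_le_add (lin_mul_expWt_le hlam hτ hδ hδ1 ht.1.le ht.2 ξ)
              (duh_mul_expWt_le hlam hτ hlt hR hδ hδ1 hf ht.2 hξ)
        _ ≤ 2 * (Λ * (ENNReal.ofReal √(en ξ) * a ξ)) ^ 2 + 2 * (D * I ξ) ^ 2 :=
            ENNReal.add_sq_le_two_mul _ _
        _ = _ := by
            rw [mul_pow, mul_pow, mul_pow, ofReal_sqrt_en_sq]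
            ring
  have hmf : Measurable fun ξ => ee ξ ^ 1 * hiPart τ⁻¹ (f t) ξ ^ 2 :=
    (measurable_ee.pow_const 1).mul ((measurable_hiPart (measurable_slice hf t)).pow_const 2)
  have hma : Measurable fun ξ => ee ξ ^ 1 * hiPart τ⁻¹ a ξ ^ 2 :=
    (measurable_ee.pow_const 1).mul ((measurable_hiPart ha).pow_const 2)
  have hΛ1 : 1 ≤ Λ ^ 2 :=
    one_le_pow_of_one_le' (ENNReal.one_le_ofReal.2 (by nlinarith [sq_nonneg lam])) 2
  calc critSq δ lam τ R t (f t)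
      ≤ 4 * ENNReal.ofReal (Real.exp 12) * hn 1 (hiPart τ⁻¹ (f t)) +
          (2 * Λ ^ 2 * hn 1 (hiPart τ⁻¹ a) + 2 * D ^ 2 * ∫⁻ ξ, I ξ ^ 2) := by
        unfold critSq hn
        refine (lintegral_mono pt).trans (le_of_eq ?_)
        rw [lintegral_add_left (hmf.const_mul _), lintegral_add_left (hma.const_mul _),
          lintegral_const_mul _ hmf, lintegral_const_mul _ hma,
          lintegral_const_mul' _ _ (by finiteness)]
    _ ≤ 4 * ENNReal.ofReal (Real.exp 12) * (Λ ^ 2 * z) +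
          (2 * Λ ^ 2 * z + 2 * D ^ 2 * (ENNReal.ofReal (144 * t ^ (1 - 2 * p)) * A)) := by
        gcongr 4 * ENNReal.ofReal (Real.exp 12) * ?_ + (2 * Λ ^ 2 * ?_ + 2 * D ^ 2 * ?_)
        exact hzf.trans (le_mul_of_one_le_left' hΛ1)
    _ = (4 * ENNReal.ofReal (Real.exp 12) + 2) * Λ ^ 2 * z +
          2 * (D ^ 2 * ENNReal.ofReal (144 * t ^ (1 - 2 * p))) * A := by ring
    _ = Λ ^ 2 * ((4 * ENNReal.ofReal (Real.exp 12) + 2) * z +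
          2304 * (K ^ 2 * prodConst * ENNReal.ofReal (Real.exp 6)) *
          (ENNReal.ofReal (Real.exp (lam ^ 2 / 2)) * y ^ 2 + ENNReal.ofReal τ * M * y)) := by
        rw [hD2, hA]
        ring
    _ ≤ Λ ^ 2 * (enConst K * z + enConst K *
          (ENNReal.ofReal (Real.exp (lam ^ 2 / 2)) * y ^ 2 + ENNReal.ofReal τ * M * y)) := by
        gcongr
        · exact le_self_add
        · exact le_add_self
    _ = _ := by ring

end master

theorem ENNReal.le_two_mul_of_le_add_half_mul {y b : ℝ≥0∞} (hy : y ≠ ⊤) (h : y ≤ b + 1 / 2 * y) :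
    y ≤ 2 * b := by
  have h1 : 1 / 2 * y ≠ ⊤ := by finiteness
  have h2 : y = 1 / 2 * y + 1 / 2 * y := by
    rw [← add_mul, ENNReal.add_halves, one_mul]
  have h3 : 1 / 2 * y ≤ b := by
    rw [← ENNReal.add_le_add_iff_right h1, ← h2]
    exact h
  calc y = 2 * (1 / 2 * y) := by rw [two_mul]; exact h2
    _ ≤ 2 * b := by gcongr

section bootstrap

variable {δ lam τ : ℝ} {K : ℝ≥0∞} {f : ℝ → V3 → ℝ≥0∞} {a : V3 → ℝ≥0∞}

theorem critSq_le_mul {R R' c t : ℝ} (hc : 0 ≤ c) {g : V3 → ℝ≥0∞}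
    (h : ∀ ξ, expWt lam τ R t ξ ≤ c * expWt lam τ R' t ξ) :
    critSq δ lam τ R t g ≤ ENNReal.ofReal (c ^ 2) * critSq δ lam τ R' t g := by
  unfold critSq
  rw [← lintegral_const_mul' _ _ ENNReal.ofReal_ne_top]
  refine lintegral_mono fun ξ => ?_
  unfold expHi
  have h1 := ENNReal.ofReal_le_ofReal (h ξ)
  rw [ENNReal.ofReal_mul hc] at h1
  calc _ ≤ (ENNReal.ofReal ((√t * en ξ) ^ δ * √(en ξ)) *
        (ENNReal.ofReal c * ENNReal.ofReal (expWt lam τ R' t ξ) * hiPart τ⁻¹ g ξ)) ^ 2 := by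
        gcongr
    _ = _ := by
        rw [ENNReal.ofReal_pow hc]
        ring

theorem critSq_half_zero_le {t : ℝ} (g : V3 → ℝ≥0∞) :
    critSq (1 / 2) 0 τ 0 t g ≤ ENNReal.ofReal √t * hn 2 g := by
  rw [critSq_half]
  gcongr
  refine hn_mono fun ξ => ?_
  unfold expHi expWt
  simpa using hiPart_le _ _ _

/-- The critical norm without exponential weight is controlled by the high frequency norm. -/
theorem critSq_half_zero_le_of_small (hK : K ≠ ⊤) (hτ : 0 < τ) (hτ' : τ ≤ 1) (ha : Measurable a)
    (hf : Measurable (Function.uncurry f))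
    (hmaj : ∀ t ∈ Ioc 0 (τ ^ 4), ∀ ξ, f t ξ ≤ majStep K a f t ξ) {z M ε : ℝ≥0∞}
    (hzf : ∀ t ∈ Ioc 0 (τ ^ 4), hn 1 (hiPart τ⁻¹ (f t)) ≤ z) (hza : hn 1 (hiPart τ⁻¹ a) ≤ z)
    (hM : ∀ s ∈ Ioc 0 (τ ^ 4), hn 1 (f s) ≤ M) (hε : ε ≠ ⊤)
    (hfε : ∀ s ∈ Ioc 0 (τ ^ 4), ENNReal.ofReal √s * hn 2 (f s) ≤ ε)
    (hsmall : enConst K * 9 * (ε + ENNReal.ofReal τ * M) ≤ 1 / 2) {t : ℝ}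
    (ht : t ∈ Ioc 0 (τ ^ 4)) :
    critSq (1 / 2) 0 τ 0 t (f t) ≤ 2 * (enConst K * 9 * z) := by
  set y := ⨆ s ∈ Ioc 0 (τ ^ 4), critSq (1 / 2) 0 τ 0 s (f s) with hy
  have hle : ∀ s ∈ Ioc 0 (τ ^ 4), critSq (1 / 2) 0 τ 0 s (f s) ≤ y := fun s hs =>
    le_iSup₂ (f := fun s _ => critSq (1 / 2) 0 τ 0 s (f s)) s hs
  have hyε : y ≤ ε := iSup₂_le fun s hs => (critSq_half_zero_le _).trans (hfε s hs)
  have h9 : ENNReal.ofReal (3 * (1 + (0 : ℝ) ^ 2)) ^ 2 = 9 := by norm_num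
  refine (hle t ht).trans (ENNReal.le_two_mul_of_le_add_half_mul (ne_top_of_le_ne_top hε hyε) ?_)
  refine iSup₂_le fun s hs => ?_
  have h := critSq_le hK le_rfl hτ hτ' (by simp) le_rfl (by norm_num) le_rfl ha hf hs (hmaj s hs)
    hle (hzf s hs) hza hM
  rw [h9] at h
  refine h.trans ?_
  calc _ = enConst K * 9 * z + enConst K * 9 * (y + ENNReal.ofReal τ * M) * y := by
        norm_num
        ring
    _ ≤ enConst K * 9 * z + enConst K * 9 * (ε + ENNReal.ofReal τ * M) * y := by gcongr
    _ ≤ _ := by gcongr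

theorem expWt_mono (hlam : 0 ≤ lam) {R R' t : ℝ} (hR : R ≤ R') (ht : 0 ≤ t) (ξ : V3) :
    expWt lam τ R t ξ ≤ expWt lam τ R' t ξ := by
  unfold expWt
  gcongr

theorem expWt_add_le (hlam : 0 ≤ lam) (hτ : 0 < τ) {R h t : ℝ} (hh : 0 ≤ h)
    (hle : lam * τ ^ 2 * h ≤ 1 / 4) (ht : 0 ≤ t) (ht' : t ≤ τ ^ 4) (ξ : V3) :
    expWt lam τ (R + h) t ξ ≤ Real.exp (1 / 4) * expWt lam τ R t ξ := by
  unfold expWt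
  rw [← Real.exp_add]
  refine Real.exp_le_exp.2 ?_
  have h1 : min (en ξ) (R + h) ≤ min (en ξ) R + h := by
    rw [← min_add_add_right]
    exact min_le_min (by linarith) le_rfl
  have h2 : lam * t / τ ^ 2 * min (en ξ) (R + h) ≤ lam * t / τ ^ 2 * (min (en ξ) R + h) := by
    gcongr
  have h3 : lam * t / τ ^ 2 * h ≤ lam * τ ^ 2 * h :=
    mul_le_mul_of_nonneg_right (lam_mul_div_sq_le hlam hτ ht') hh
  linarith

/-- The bootstrap in the truncation radius of the exponential weight. -/
theorem critSq_le_of_small (hK : K ≠ ⊤) (hlam : 0 ≤ lam) (hτ : 0 < τ) (hτ' : τ ≤ 1)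
    (hlt : lam * τ ≤ 3) (hδ : 0 ≤ δ) (hδ' : δ ≤ 1 / 2) (ha : Measurable a)
    (hf : Measurable (Function.uncurry f))
    (hmaj : ∀ t ∈ Ioc 0 (τ ^ 4), ∀ ξ, f t ξ ≤ majStep K a f t ξ) {z M ε A : ℝ≥0∞}
    (hzf : ∀ t ∈ Ioc 0 (τ ^ 4), hn 1 (hiPart τ⁻¹ (f t)) ≤ z) (hza : hn 1 (hiPart τ⁻¹ a) ≤ z)
    (hM : ∀ s ∈ Ioc 0 (τ ^ 4), hn 1 (f s) ≤ M) (hε : ε ≠ ⊤)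
    (hfε : ∀ s ∈ Ioc 0 (τ ^ 4), ENNReal.ofReal √s * hn 2 (f s) ≤ ε)
    (hsmall : enConst K * 9 * (ε + ENNReal.ofReal τ * M) ≤ 1 / 2)
    (hA : A = 2 * (enConst K * ENNReal.ofReal (3 * (1 + lam ^ 2)) ^ 2 * z))
    (hsmall' : enConst K * ENNReal.ofReal (3 * (1 + lam ^ 2)) ^ 2 *
      (4 * ENNReal.ofReal (Real.exp (lam ^ 2 / 2)) * A + 2 * ENNReal.ofReal τ * M) ≤ 1 / 2) {t : ℝ}
    (ht : t ∈ Ioc 0 (τ ^ 4)) :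
    ∫⁻ ξ, (ENNReal.ofReal ((√t * en ξ) ^ δ * √(en ξ)) *
      (ENNReal.ofReal (Real.exp (-(lam ^ 2 * t / (4 * τ ^ 4)) + lam * t / τ ^ 2 * en ξ)) *
        hiPart τ⁻¹ (f t) ξ)) ^ 2 ≤ A := by
  set Λ := ENNReal.ofReal (3 * (1 + lam ^ 2)) with hΛ
  have improve {q R s : ℝ} (hq : 0 ≤ q) (hq' : q ≤ 1 / 2) (hR : 0 ≤ R) (hs : s ∈ Ioc 0 (τ ^ 4))
      (hy : ∀ s ∈ Ioc 0 (τ ^ 4), critSq (1 / 2) lam τ R s (f s) ≤ 2 * A) :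
      critSq q lam τ R s (f s) ≤ A := by
    refine (critSq_le hK hlam hτ hτ' hlt hR hq hq' ha hf hs (hmaj s hs) hy (hzf s hs) hza hM).trans
      ?_
    rw [← hΛ]
    calc _ = enConst K * Λ ^ 2 * z + enConst K * Λ ^ 2 *
          (4 * ENNReal.ofReal (Real.exp (lam ^ 2 / 2)) * A + 2 * ENNReal.ofReal τ * M) * A := by ring
      _ ≤ enConst K * Λ ^ 2 * z + 1 / 2 * (2 * (enConst K * Λ ^ 2 * z)) := by
          rw [← hA]
          gcongr
      _ = A := by
          rw [hA, ← mul_assoc, one_div, ENNReal.inv_mul_cancel two_ne_zero ENNReal.ofNat_ne_top,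
            one_mul, two_mul]
  set h := 1 / (4 * (lam * τ ^ 2 + 1)) with hh
  have hh0 : 0 < h := by positivity
  have hle : lam * τ ^ 2 * h ≤ 1 / 4 := by
    rw [hh, mul_one_div, div_le_div_iff₀ (by positivity) (by norm_num)]
    linarith
  have hbase : ∀ s ∈ Ioc 0 (τ ^ 4), critSq (1 / 2) lam τ 0 s (f s) ≤ A := by
    intro s hs
    have h0 : ∀ ξ, expWt lam τ 0 s ξ ≤ 1 * expWt 0 τ 0 s ξ := by
      intro ξ
      unfold expWt
      have h1 : 0 ≤ lam ^ 2 * s / (4 * τ ^ 4) := by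
        have := hs.1
        positivity
      rw [min_eq_right (en_nonneg ξ)]
      simpa using h1
    have h1 : critSq (1 / 2) lam τ 0 s (f s) ≤ critSq (1 / 2) 0 τ 0 s (f s) := by
      unfold critSq expHi
      refine lintegral_mono fun ξ => ?_
      gcongr
      simpa using h0 ξ
    refine (h1.trans (critSq_half_zero_le_of_small hK hτ hτ' ha hf hmaj hzf hza hM hε hfε hsmall
      hs)).trans ?_
    have h9 : (9 : ℝ≥0∞) ≤ Λ ^ 2 := by
      have h3 : (3 : ℝ≥0∞) ≤ Λ := by
        rw [hΛ, ← ENNReal.ofReal_ofNat 3]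
        exact ENNReal.ofReal_le_ofReal (by nlinarith [sq_nonneg lam])
      calc (9 : ℝ≥0∞) = 3 ^ 2 := by norm_num
        _ ≤ Λ ^ 2 := by gcongr
    rw [hA]
    gcongr
  have hind (n : ℕ) : ∀ s ∈ Ioc 0 (τ ^ 4), critSq (1 / 2) lam τ (n * h) s (f s) ≤ A := by
    induction n with
    | zero => simpa using hbase
    | succ n ih =>
      intro s hs
      refine improve (by norm_num) le_rfl (by positivity) hs fun r hr => ?_
      have h1 := critSq_le_mul (δ := 1 / 2) (R := ((n + 1 : ℕ) : ℝ) * h) (R' := n * h)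
        (g := f r) (Real.exp_nonneg (1 / 4)) fun ξ => by
          have := expWt_add_le (R := n * h) hlam hτ hh0.le hle hr.1.le hr.2 ξ
          push_cast
          rwa [add_mul, one_mul]
      have h2 : Real.exp (1 / 4) ^ 2 ≤ 2 := by
        have h4 : Real.exp (1 / 4) ^ 4 ≤ 4 := by
          rw [← Real.exp_nat_mul]
          have := Real.exp_one_lt_three
          norm_num
          linarith
        nlinarith [sq_nonneg (Real.exp (1 / 4) ^ 2)]
      refine h1.trans (mul_le_mul' ?_ (ih r hr))
      exact (ENNReal.ofReal_le_ofReal h2).trans (by norm_num)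
  have hall (n : ℕ) : critSq δ lam τ (n * h) t (f t) ≤ A :=
    improve hδ hδ' (by positivity) ht fun s hs =>
      (hind n s hs).trans (le_mul_of_one_le_left' one_le_two)
  set F : ℕ → V3 → ℝ≥0∞ := fun n ξ =>
    (ENNReal.ofReal ((√t * en ξ) ^ δ * √(en ξ)) * expHi lam τ (n * h) t (f t) ξ) ^ 2 with hF
  have hFm (n : ℕ) : Measurable (F n) := by
    have h1 := measurable_slice (measurable_expHi_time (lam := lam) (τ := τ) (R := n * h) hf) t
    have h2 := measurable_en
    exact ((Measurable.ennreal_ofReal (by fun_prop)).mul h1).pow_const 2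
  have hFmono : Monotone F := by
    intro n m hnm ξ
    simp only [hF]
    unfold expHi
    gcongr
    exact expWt_mono hlam (by gcongr) ht.1.le ξ
  calc _ ≤ ∫⁻ ξ, ⨆ n, F n ξ := by
        refine lintegral_mono fun ξ => ?_
        obtain ⟨n, hn⟩ := exists_nat_ge (en ξ / h)
        rw [div_le_iff₀ hh0] at hn
        refine le_trans (le_of_eq ?_) (le_iSup (fun n => F n ξ) n)
        simp only [hF]
        rw [expHi, expWt, min_eq_left hn]
    _ = ⨆ n, ∫⁻ ξ, F n ξ := lintegral_iSup hFm hFmono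
    _ ≤ A := iSup_le hall

end bootstrap

/-- The weight of the high frequency part of the critical Sobolev norm. -/
def hiWt (J : ℝ) (ξ : V3) : ℝ := if J ≤ en ξ then en ξ ^ ((1 : ℝ) / 2) else 0

theorem lintegral_hiWt_sq (J : ℝ) (f : V3 → Fin 3 → ℂ) :
    ∫⁻ ξ, ENNReal.ofReal (hiWt J ξ ^ 2) * mag f ξ ^ 2 = hn 1 (hiPart J (mag f)) := by
  unfold hn
  refine lintegral_congr fun ξ => ?_
  unfold hiWt hiPart
  split_ifs
  · rw [← Real.sqrt_eq_rpow, Real.sq_sqrt (en_nonneg ξ), pow_one, ee]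
  · simp

theorem zetaSup_eq (U : ℝ → V3 → Fin 3 → ℂ) (J T : ℝ) :
    zetaSup U J T = ⨆ t ∈ Icc (0 : ℝ) T, wnorm (hiWt J) (U t) := rfl

theorem hn_one_hiPart_mag_le {U : ℝ → V3 → Fin 3 → ℂ} {J T t : ℝ} (ht : t ∈ Icc 0 T) :
    hn 1 (hiPart J (mag (U t))) ≤ zetaSup U J T ^ 2 := by
  rw [← lintegral_hiWt_sq]
  refine (le_wnorm_sq _ _).trans ?_
  gcongr
  exact le_iSup₂ (f := fun t _ => wnorm (hiWt J) (U t)) t ht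

theorem IsMildSol.zero_eq {α : Coeffs} {U₀ : V3 → Fin 3 → ℂ} {U : ℝ → V3 → Fin 3 → ℂ} {T : ℝ}
    (h : IsMildSol α U₀ U T) (hT : 0 ≤ T) : U 0 = U₀ := by
  ext ξ j
  rw [h 0 ⟨le_rfl, hT⟩ ξ j]
  simp

theorem hn_one_hiPart_le {K : ℝ≥0∞} (hK : K ≠ ⊤) {a : V3 → ℝ≥0∞} (ha : Measurable a)
    {f : ℝ → V3 → ℝ≥0∞} (hf : Measurable (Function.uncurry f)) {J T t : ℝ} (ht : t ∈ Icc 0 T)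
    (hmaj : ∀ ξ, f t ξ ≤ majStep K a f t ξ) :
    hn 1 (hiPart J (f t)) ≤ 2 * (∫⁻ ξ, (if J ≤ en ξ then ee ξ * a ξ ^ 2 else 0)) +
      2 * (K ^ 2 * prodConst * ∫⁻ s in Ioc 0 T, hn 2 (f s) ^ 2) := by
  have h1 : hn 1 (hiPart J (f t))
      ≤ hn 1 (fun ξ => hiPart J (lin a t) ξ + duh (forc K f f) t ξ) := by
    refine hn_mono fun ξ => ?_
    have := hmaj ξ
    unfold hiPart
    split_ifs
    · exact this
    · exact bot_le
  refine h1.trans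
    ((hn_add_le (measurable_hiPart (measurable_slice (measurable_lin ha) t))).trans ?_)
  gcongr 2 * ?_ + 2 * ?_
  · unfold hn
    refine lintegral_mono fun ξ => ?_
    unfold hiPart
    split_ifs
    · rw [pow_one]
      gcongr
      exact lin_le a ht.1 ξ
    · simp
  · refine (hn_one_duh_le (measurable_forc hf hf) t).trans
      ((lintegral_hn_forc_le hK hf t).trans ?_)
    gcongr K ^ 2 * prodConst * ?_
    exact lintegral_mono_set (Ioc_subset_Ioc_right ht.2)

theorem ENNReal.exists_mul_le_of_ne_top {A c : ℝ≥0∞} (hA : A ≠ ⊤) (hc : c ≠ 0) :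
    ∃ x : ℝ≥0∞, 0 < x ∧ A * x ≤ c := by
  obtain ⟨n, hn0, hn⟩ := ENNReal.exists_nnreal_pos_mul_lt hA hc
  exact ⟨n, by exact_mod_cast hn0, by rw [mul_comm]; exact hn.le⟩

/-- The high frequency part of the critical norm vanishes as the time goes to zero. -/
theorem exists_zetaSup_le {α : Coeffs} {U₀ : V3 → Fin 3 → ℂ} {V : ℝ → V3 → ℝ≥0∞}
    (h₀ : ∀ j, Measurable fun ξ => U₀ ξ j) (hfin : hn 1 (mag U₀) ≠ ⊤) {T : ℝ} (hT : 0 < T)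
    (hV : ∫⁻ t in Ioc 0 T, hn 2 (V t) ^ 2 ≠ ⊤) {c : ℝ≥0∞} (hc : 0 < c) :
    ∃ τ₀, 0 < τ₀ ∧ ∀ (U : ℝ → V3 → Fin 3 → ℂ) (S : ℝ), MeasVF U → IsMildSol α U₀ U S →
      (∀ s ∈ Icc 0 S, hn 2 (mag (U s)) ≤ hn 2 (V s)) →
      ∀ τ, 0 < τ → τ ≤ τ₀ → τ ^ 4 ≤ S → zetaSup U τ⁻¹ (τ ^ 4) ≤ c := by
  have ha := measurable_mag h₀
  have hK := symBound_ne_top α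
  have hP := prodConst_ne_top
  have hc2 : c ^ 2 / 2 ≠ 0 := by simpa using hc.ne'
  obtain ⟨x, hx0, hx⟩ := ENNReal.exists_mul_le_of_ne_top (A := 6) (by norm_num) hc2
  obtain ⟨y, hy0, hy⟩ := ENNReal.exists_mul_le_of_ne_top
    (A := 6 * (symBound α ^ 2 * prodConst)) (by finiteness) hc2
  obtain ⟨J₀, hJ⟩ := exists_hn_one_tail_lt ha hfin hx0
  obtain ⟨r, hr0, hrT, hr⟩ := exists_lintegral_Ioc_lt hT hV hy0
  refine ⟨min (min 1 r) (max J₀ 1)⁻¹, by positivity, fun U S hU hmild hle τ hτ hττ hτS => ?_⟩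
  have hτ1 : τ ≤ 1 := hττ.trans ((min_le_left _ _).trans (min_le_left _ _))
  have hτr : τ ≤ r := hττ.trans ((min_le_left _ _).trans (min_le_right _ _))
  have hτJ : J₀ ≤ τ⁻¹ := by
    have h1 : τ ≤ (max J₀ 1)⁻¹ := hττ.trans (min_le_right _ _)
    exact (le_max_left _ _).trans ((le_inv_comm₀ hτ (by positivity)).1 h1)
  have h4 : τ ^ 4 ≤ r := by
    refine le_trans ?_ hτr
    calc τ ^ 4 ≤ τ ^ 1 := pow_le_pow_of_le_one hτ.le hτ1 (by norm_num)
      _ = τ := pow_one τ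
  have hI : ∫⁻ s in Ioc 0 (τ ^ 4), hn 2 (mag (U s)) ^ 2 ≤ y := by
    refine le_trans ?_ hr.le
    refine (setLIntegral_mono' measurableSet_Ioc fun s hs => ?_).trans
      (lintegral_mono_set (Ioc_subset_Ioc_right h4))
    gcongr
    exact hle s ⟨hs.1.le, hs.2.trans hτS⟩
  refine iSup₂_le fun t ht => ?_
  have h1 := hn_one_hiPart_le (J := τ⁻¹) hK ha (measurable_mag_time hU) ht
    (mag_le_majStep hmild ⟨ht.1, ht.2.trans hτS⟩)
  have h2 : wnorm (hiWt τ⁻¹) (U t) ^ 2 ≤ c ^ 2 := by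
    calc wnorm (hiWt τ⁻¹) (U t) ^ 2 ≤ 3 * hn 1 (hiPart τ⁻¹ (mag (U t))) := by
          rw [← lintegral_hiWt_sq]
          exact wnorm_sq_le _ _
      _ ≤ 3 * (2 * x + 2 * (symBound α ^ 2 * prodConst * y)) := by
          gcongr 3 * ?_
          refine h1.trans ?_
          gcongr 2 * ?_ + 2 * (symBound α ^ 2 * prodConst * ?_)
          exact (hJ _ hτJ).le
      _ = 6 * x + 6 * (symBound α ^ 2 * prodConst) * y := by ring
      _ ≤ c ^ 2 / 2 + c ^ 2 / 2 := add_le_add hx hy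
      _ = c ^ 2 := ENNReal.add_halves _
  exact (ENNReal.pow_le_pow_left_iff two_ne_zero).1 h2

theorem lamCrit_nonneg (U : ℝ → V3 → Fin 3 → ℂ) (T : ℝ) : 0 ≤ lamCrit U T := Real.sqrt_nonneg _

theorem lamCrit_sq_le_log (U : ℝ → V3 → Fin 3 → ℂ) (T : ℝ) :
    lamCrit U T ^ 2 ≤ 3 * |Real.log T| := by
  unfold lamCrit
  rw [Real.sq_sqrt (by split_ifs <;> positivity)]
  split_ifs
  · exact le_rfl
  · gcongr
    exact min_le_right _ _

theorem lamCrit_sq_le_log_zetaSup {U : ℝ → V3 → Fin 3 → ℂ} {T : ℝ}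
    (h : zetaSup U (T ^ (-(1 : ℝ) / 4)) T ≠ 0) :
    lamCrit U T ^ 2 ≤ 3 * |Real.log (zetaSup U (T ^ (-(1 : ℝ) / 4)) T).toReal| := by
  unfold lamCrit
  rw [Real.sq_sqrt (by split_ifs <;> positivity), if_neg h]
  gcongr
  exact min_le_left _ _

section parameters

variable {lam τ : ℝ}

theorem three_mul_one_add_le_exp (x : ℝ) : 3 * (1 + x) ≤ 144 * Real.exp (x / 48) := by
  have := Real.add_one_le_exp (x / 48)
  linarith [Real.exp_pos (x / 48)]

theorem lam_mul_le_three (hτ : 0 < τ) (hτ' : τ ≤ 1 / 2)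
    (h : lam ^ 2 ≤ 3 * |Real.log (τ ^ 4)|) : lam * τ ≤ 3 := by
  have h1 : 3 * |Real.log (τ ^ 4)| = 12 * Real.log τ⁻¹ := by
    rw [Real.log_pow, Real.log_inv, abs_of_nonpos]
    · push_cast; ring
    · have := Real.log_nonpos hτ.le (by linarith)
      push_cast; linarith
  have h2 : Real.log τ⁻¹ ≤ τ⁻¹ := by
    have := Real.log_le_sub_one_of_pos (inv_pos.2 hτ)
    linarith
  have h3 : (lam * τ) ^ 2 ≤ 6 := by
    calc (lam * τ) ^ 2 = lam ^ 2 * τ ^ 2 := by ring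
      _ ≤ 12 * τ⁻¹ * τ ^ 2 := by
        gcongr
        rw [h1] at h
        linarith
      _ = 12 * τ := by field_simp
      _ ≤ 6 := by linarith
  nlinarith

theorem sq_mul_le_sqrt (hτ : 0 < τ) (hτ' : τ ≤ 1) (h : lam ^ 2 ≤ 3 * |Real.log (τ ^ 4)|) :
    (3 * (1 + lam ^ 2)) ^ 2 * τ ≤ 144 ^ 2 * √τ := by
  have h1 : 3 * |Real.log (τ ^ 4)| = -12 * Real.log τ := by
    rw [Real.log_pow, abs_of_nonpos]
    · push_cast; ring
    · have := Real.log_nonpos hτ.le hτ'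
      push_cast; linarith
  have h2 : Real.exp (lam ^ 2 / 24) * τ ≤ √τ := by
    calc Real.exp (lam ^ 2 / 24) * τ = Real.exp (lam ^ 2 / 24 + Real.log τ) := by
          rw [Real.exp_add, Real.exp_log hτ]
      _ ≤ Real.exp (Real.log τ * (1 / 2)) := Real.exp_le_exp.2 (by linarith)
      _ = √τ := by rw [Real.sqrt_eq_rpow, Real.rpow_def_of_pos hτ]
  calc (3 * (1 + lam ^ 2)) ^ 2 * τ ≤ (144 * Real.exp (lam ^ 2 / 48)) ^ 2 * τ := by
        gcongr ?_ ^ 2 * τ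
        exact three_mul_one_add_le_exp _
    _ = 144 ^ 2 * (Real.exp (lam ^ 2 / 24) * τ) := by
        rw [mul_pow, ← Real.exp_nat_mul]
        push_cast
        ring_nf
    _ ≤ _ := by gcongr

theorem pow_four_mul_exp_mul_sq_le {z : ℝ} (hz : 0 < z) (hz' : z ≤ 1)
    (h : lam ^ 2 ≤ 3 * |Real.log z|) :
    (3 * (1 + lam ^ 2)) ^ 4 * Real.exp (lam ^ 2 / 2) * z ^ 2 ≤ 144 ^ 4 * z ^ ((1 : ℝ) / 4) := by
  have h0 := Real.log_nonpos hz.le hz'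
  rw [abs_of_nonpos h0] at h
  have h2 : Real.exp (lam ^ 2 / 12) * Real.exp (lam ^ 2 / 2) * z ^ 2 ≤ z ^ ((1 : ℝ) / 4) := by
    calc Real.exp (lam ^ 2 / 12) * Real.exp (lam ^ 2 / 2) * z ^ 2
        = Real.exp (lam ^ 2 / 12 + lam ^ 2 / 2 + 2 * Real.log z) := by
          rw [Real.exp_add, Real.exp_add, two_mul, Real.exp_add, Real.exp_log hz, sq z]
      _ ≤ Real.exp (Real.log z * (1 / 4)) := Real.exp_le_exp.2 (by linarith)
      _ = z ^ ((1 : ℝ) / 4) := by rw [Real.rpow_def_of_pos hz]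
  calc (3 * (1 + lam ^ 2)) ^ 4 * Real.exp (lam ^ 2 / 2) * z ^ 2
      ≤ (144 * Real.exp (lam ^ 2 / 48)) ^ 4 * Real.exp (lam ^ 2 / 2) * z ^ 2 := by
        gcongr ?_ ^ 4 * _ * _
        exact three_mul_one_add_le_exp _
    _ = 144 ^ 4 * (Real.exp (lam ^ 2 / 12) * Real.exp (lam ^ 2 / 2) * z ^ 2) := by
        rw [mul_pow, ← Real.exp_nat_mul]
        push_cast
        ring_nf
    _ ≤ _ := by gcongr

end parameters

theorem ENNReal.exists_mul_ofReal_le {A c : ℝ≥0∞} (hA : A ≠ ⊤) (hc : c ≠ 0) :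
    ∃ x : ℝ, 0 < x ∧ x ≤ 1 ∧ A * ENNReal.ofReal x ≤ c := by
  obtain ⟨x, hx0, hx⟩ := ENNReal.exists_mul_le_of_ne_top hA hc
  have hm : min x 1 ≠ ⊤ := ne_top_of_le_ne_top one_ne_top (min_le_right _ _)
  refine ⟨(min x 1).toReal, ENNReal.toReal_pos (lt_min hx0 one_pos).ne' hm, ?_, ?_⟩
  · exact ENNReal.toReal_le_of_le_ofReal zero_le_one (by simp)
  · rw [ENNReal.ofReal_toReal hm]
    exact (mul_le_mul_right (min_le_left _ _) _).trans hx

section quartic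

variable {τ : ℝ}

theorem pow_four_rpow_neg_quarter (hτ : 0 < τ) : (τ ^ 4) ^ (-(1 : ℝ) / 4) = τ⁻¹ := by
  rw [← Real.rpow_natCast, ← Real.rpow_mul hτ.le, ← Real.rpow_neg_one]
  norm_num

theorem sqrt_pow_four : √(τ ^ 4) = τ ^ 2 := by
  rw [show τ ^ 4 = (τ ^ 2) ^ 2 by ring, Real.sqrt_sq (sq_nonneg τ)]

theorem exists_pow_four_eq {T : ℝ} (hT : 0 < T) : ∃ τ : ℝ, 0 < τ ∧ T = τ ^ 4 := by
  refine ⟨T ^ ((1 : ℝ) / 4), by positivity, ?_⟩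
  rw [← Real.rpow_natCast, ← Real.rpow_mul hT.le]
  norm_num

end quartic

/-- The weight of the critical norm, squared, against a vector field. -/
theorem ofReal_weight_sq_mul {δ lam τ t : ℝ} (hτ : 0 < τ) (ht : 0 ≤ t) (f : V3 → Fin 3 → ℂ)
    (ξ : V3) :
    ENNReal.ofReal ((if τ⁻¹ ≤ en ξ then t ^ (δ / 2) * en ξ ^ (δ + 1 / 2) *
      Real.exp (-(lam ^ 2 * t / (4 * τ ^ 4)) + lam * t / τ ^ 2 * en ξ) else 0) ^ 2) * mag f ξ ^ 2
    = (ENNReal.ofReal ((√t * en ξ) ^ δ * √(en ξ)) *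
      (ENNReal.ofReal (Real.exp (-(lam ^ 2 * t / (4 * τ ^ 4)) + lam * t / τ ^ 2 * en ξ)) *
        hiPart τ⁻¹ (mag f) ξ)) ^ 2 := by
  unfold hiPart
  split_ifs with h
  · have hpos : 0 < en ξ := (inv_pos.2 hτ).trans_le h
    have e : t ^ (δ / 2) * en ξ ^ (δ + 1 / 2) = (√t * en ξ) ^ δ * √(en ξ) := by
      rw [Real.mul_rpow (Real.sqrt_nonneg _) hpos.le, Real.rpow_add hpos, Real.sqrt_eq_rpow,
        Real.sqrt_eq_rpow, ← Real.rpow_mul ht]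
      ring_nf
    rw [e, ENNReal.ofReal_pow (by positivity), ENNReal.ofReal_mul (by positivity)]
    ring
  · simp

/-- Smallness of the nonlinear terms at the exponential weight `λ(T)`. -/
theorem ofReal_pow_mul_sq_le {lam x : ℝ} {Z : ℝ≥0∞} (hx : 0 ≤ x) (hx' : x ≤ 1)
    (hZ : Z ≤ ENNReal.ofReal (x ^ 4)) (h : Z ≠ 0 → lam ^ 2 ≤ 3 * |Real.log Z.toReal|) :
    ENNReal.ofReal (3 * (1 + lam ^ 2)) ^ 4 * ENNReal.ofReal (Real.exp (lam ^ 2 / 2)) * Z ^ 2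
      ≤ 144 ^ 4 * ENNReal.ofReal x := by
  rcases eq_or_ne Z 0 with h0 | h0
  · simp [h0]
  have ht : Z ≠ ⊤ := ne_top_of_le_ne_top ENNReal.ofReal_ne_top hZ
  have hz : 0 < Z.toReal := ENNReal.toReal_pos h0 ht
  have hzx : Z.toReal ≤ x ^ 4 := ENNReal.toReal_le_of_le_ofReal (by positivity) hZ
  have hz1 : Z.toReal ≤ 1 := hzx.trans (pow_le_one₀ hx hx')
  have h1 := ENNReal.ofReal_le_ofReal (pow_four_mul_exp_mul_sq_le hz hz1 (h h0))
  have hL : 0 ≤ 3 * (1 + lam ^ 2) := by positivity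
  generalize 3 * (1 + lam ^ 2) = L at h1 hL ⊢
  have h2 : Z.toReal ^ ((1 : ℝ) / 4) ≤ x := by
    refine (Real.rpow_le_rpow hz.le hzx (by norm_num)).trans (le_of_eq ?_)
    rw [← Real.rpow_natCast, ← Real.rpow_mul hx]
    norm_num
  rw [ENNReal.ofReal_mul (by positivity), ENNReal.ofReal_mul (by positivity),
    ENNReal.ofReal_pow (by positivity), ENNReal.ofReal_pow hz.le, ENNReal.ofReal_toReal ht,
    ENNReal.ofReal_mul (by positivity)] at h1
  refine h1.trans ?_
  gcongr
  norm_num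

theorem ofReal_sq_mul_le {lam τ y : ℝ} (hτ : 0 < τ) (hτ' : τ ≤ 1) (hy : 0 ≤ y) (hτy : τ ≤ y ^ 2)
    (h : lam ^ 2 ≤ 3 * |Real.log (τ ^ 4)|) :
    ENNReal.ofReal (3 * (1 + lam ^ 2)) ^ 2 * ENNReal.ofReal τ ≤ 144 ^ 2 * ENNReal.ofReal y := by
  have h1 := ENNReal.ofReal_le_ofReal (sq_mul_le_sqrt hτ hτ' h)
  have hL : 0 ≤ 3 * (1 + lam ^ 2) := by positivity
  generalize 3 * (1 + lam ^ 2) = L at h1 hL ⊢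
  rw [ENNReal.ofReal_mul (by positivity), ENNReal.ofReal_pow (by positivity),
    ENNReal.ofReal_mul (by positivity)] at h1
  refine h1.trans ?_
  gcongr
  · norm_num
  · exact Real.sqrt_le_iff.2 ⟨hy, hτy⟩

section conclusion

variable {α : Coeffs} {U₀ : V3 → Fin 3 → ℂ} {U : ℝ → V3 → Fin 3 → ℂ}

/-- The critical norm is controlled by the high frequencies once the time is small. -/
theorem Ynorm_le_of_small {δ τ t₁ ε x y : ℝ} {M : ℝ≥0∞} (h₀ : ∀ j, Measurable fun ξ => U₀ ξ j)
    (hU : MeasVF U) (hmild : IsMildSol α U₀ U t₁) (hδ : 0 ≤ δ) (hδ' : δ ≤ 1 / 2) (hτ : 0 < τ)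
    (hτ' : τ ≤ 1 / 2) (hτt : τ ^ 4 ≤ t₁) (hx : 0 ≤ x) (hx' : x ≤ 1) (hy : 0 ≤ y) (hy' : y ≤ 1)
    (hτy : τ ≤ y ^ 2) (hM : ∀ s ∈ Icc 0 t₁, hn 1 (mag (U s)) ≤ M)
    (hUε : ∀ s ∈ Ioc 0 t₁, ENNReal.ofReal √s * hn 2 (mag (U s)) ≤ ENNReal.ofReal ε)
    (hZ : zetaSup U τ⁻¹ (τ ^ 4) ≤ ENNReal.ofReal (x ^ 4))
    (hε : enConst (symBound α) * 9 * ENNReal.ofReal ε ≤ 1 / 2 / 2)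
    (hxs : 8 * enConst (symBound α) ^ 2 * 144 ^ 4 * ENNReal.ofReal x ≤ 1 / 2 / 2)
    (hys : 2 * enConst (symBound α) * M * 144 ^ 2 * ENNReal.ofReal y ≤ 1 / 2 / 2) :
    Ynorm δ (τ ^ 4) U
      ≤ ENNReal.ofReal (√(6 * (enConst (symBound α)).toReal) * 30000 *
          Real.exp (1 / 10000 * lamCrit U (τ ^ 4) ^ 2)) * zetaSup U τ⁻¹ (τ ^ 4) := by
  set c := enConst (symBound α) with hc
  have hct : c ≠ ⊤ := enConst_ne_top (symBound_ne_top α)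
  set Z := zetaSup U τ⁻¹ (τ ^ 4) with hZdef
  set lam := lamCrit U (τ ^ 4) with hlam
  set Λ := ENNReal.ofReal (3 * (1 + lam ^ 2)) with hΛ
  set E := ENNReal.ofReal (Real.exp (lam ^ 2 / 2)) with hE
  have hlam0 : 0 ≤ lam := lamCrit_nonneg _ _
  have hlog : lam ^ 2 ≤ 3 * |Real.log (τ ^ 4)| := lamCrit_sq_le_log _ _
  have hlogZ : Z ≠ 0 → lam ^ 2 ≤ 3 * |Real.log Z.toReal| := fun h => by
    have := lamCrit_sq_le_log_zetaSup (U := U) (T := τ ^ 4)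
    rw [pow_four_rpow_neg_quarter hτ] at this
    exact this h
  have hτ1 : τ ≤ 1 := by linarith
  have hsub : ∀ s ∈ Ioc 0 (τ ^ 4), s ∈ Ioc 0 t₁ := fun s hs => ⟨hs.1, hs.2.trans hτt⟩
  have hsub' : ∀ s ∈ Ioc 0 (τ ^ 4), s ∈ Icc 0 t₁ := fun s hs => ⟨hs.1.le, hs.2.trans hτt⟩
  have hza : hn 1 (hiPart τ⁻¹ (mag U₀)) ≤ Z ^ 2 := by
    have h4 : 0 ≤ τ ^ 4 := by positivity
    rw [← hmild.zero_eq (h4.trans hτt)]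
    exact hn_one_hiPart_mag_le ⟨le_rfl, h4⟩
  have hs1 : c * 9 * (ENNReal.ofReal ε + ENNReal.ofReal τ * M) ≤ 1 / 2 := by
    have hτy' : ENNReal.ofReal τ ≤ ENNReal.ofReal y :=
      ENNReal.ofReal_le_ofReal (by nlinarith)
    calc _ = c * 9 * ENNReal.ofReal ε + 9 * (c * M * ENNReal.ofReal τ) := by ring
      _ ≤ 1 / 2 / 2 + (2 * 144 ^ 2) * (c * M * ENNReal.ofReal y) := by
        gcongr
        norm_num
      _ = 1 / 2 / 2 + 2 * c * M * 144 ^ 2 * ENNReal.ofReal y := by ring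
      _ ≤ 1 / 2 / 2 + 1 / 2 / 2 := by gcongr
      _ = 1 / 2 := ENNReal.add_halves _
  have hs2 : c * Λ ^ 2 * (4 * E * (2 * (c * Λ ^ 2 * Z ^ 2)) + 2 * ENNReal.ofReal τ * M)
      ≤ 1 / 2 := by
    calc _ = 8 * c ^ 2 * (Λ ^ 4 * E * Z ^ 2) + 2 * c * M * (Λ ^ 2 * ENNReal.ofReal τ) := by ring
      _ ≤ 8 * c ^ 2 * (144 ^ 4 * ENNReal.ofReal x) +
          2 * c * M * (144 ^ 2 * ENNReal.ofReal y) := by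
        gcongr 8 * c ^ 2 * ?_ + 2 * c * M * ?_
        · exact ofReal_pow_mul_sq_le hx hx' hZ hlogZ
        · exact ofReal_sq_mul_le hτ hτ1 hy hτy hlog
      _ = 8 * c ^ 2 * 144 ^ 4 * ENNReal.ofReal x +
          2 * c * M * 144 ^ 2 * ENNReal.ofReal y := by ring
      _ ≤ 1 / 2 / 2 + 1 / 2 / 2 := by gcongr
      _ = 1 / 2 := ENNReal.add_halves _
  refine iSup₂_le fun t ht => ?_
  have key := critSq_le_of_small (symBound_ne_top α) hlam0 hτ hτ1
    (lam_mul_le_three hτ hτ' hlog) hδ hδ' (measurable_mag h₀) (measurable_mag_time hU)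
    (fun s hs => mag_le_majStep hmild (hsub' s hs))
    (fun s hs => hn_one_hiPart_mag_le ⟨hs.1.le, hs.2⟩) hza (fun s hs => hM s (hsub' s hs))
    ENNReal.ofReal_ne_top (fun s hs => hUε s (hsub s hs)) hs1 rfl hs2 ht
  rw [← lintegral_congr fun ξ => ofReal_weight_sq_mul hτ ht.1.le (U t) ξ] at key
  rw [pow_four_rpow_neg_quarter hτ, sqrt_pow_four]
  refine (ENNReal.pow_le_pow_left_iff two_ne_zero).1
    ((wnorm_sq_le _ _).trans ((mul_le_mul_right key 3).trans ?_))
  rw [mul_pow]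
  have hL : 3 * (1 + lam ^ 2) ≤ 30000 * Real.exp (1 / 10000 * lam ^ 2) := by
    have := Real.add_one_le_exp (1 / 10000 * lam ^ 2)
    nlinarith [sq_nonneg lam]
  calc 3 * (2 * (c * Λ ^ 2 * Z ^ 2)) = 6 * c * Λ ^ 2 * Z ^ 2 := by ring
    _ ≤ ENNReal.ofReal (√(6 * c.toReal)) ^ 2 *
        ENNReal.ofReal (30000 * Real.exp (1 / 10000 * lam ^ 2)) ^ 2 * Z ^ 2 := by
        gcongr ?_ * ?_ ^ 2 * Z ^ 2
        · rw [← ENNReal.ofReal_pow (Real.sqrt_nonneg _), Real.sq_sqrt (by positivity),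
            ENNReal.ofReal_mul (by norm_num), ENNReal.ofReal_toReal hct]
          norm_num
        · exact ENNReal.ofReal_le_ofReal hL
    _ = _ := by
        rw [← mul_pow (ENNReal.ofReal _), ← ENNReal.ofReal_mul (Real.sqrt_nonneg _), mul_assoc √_]

end conclusion

/-- Proposition 3.2: the `Y_T` bound for the critical solution. -/
theorem statement14 (α : Coeffs) (U₀ : V3 → Fin 3 → ℂ)
    (hmeas : ∀ j, Measurable fun ξ => U₀ ξ j) (hreal : RealField U₀)
    (hH : wnorm (wD (1 / 2)) U₀ < ⊤) :
    ∃ δ₀ > (0 : ℝ), ∀ δ : ℝ, 0 < δ → δ < δ₀ →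
      ∃ t₁ > (0 : ℝ), ∃ U : ℝ → V3 → Fin 3 → ℂ, MeasVF U ∧
        (IsMildSol α U₀ U t₁ ∧ ContInW (wD (1 / 2)) U t₁ ∧ MemL2W (wD (3 / 2)) U t₁) ∧
        (∀ W : ℝ → V3 → Fin 3 → ℂ,
          (MeasVF W ∧ IsMildSol α U₀ W t₁ ∧ ContInW (wD (1 / 2)) W t₁ ∧
            MemL2W (wD (3 / 2)) W t₁) →
          ∀ t ∈ Icc (0 : ℝ) t₁, ∀ ξ : V3, ∀ j : Fin 3, W t ξ j = U t ξ j) ∧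
        ∃ C > (0 : ℝ), ∀ T : ℝ, 0 < T → T ≤ t₁ →
          Ynorm δ T U
            ≤ ENNReal.ofReal (C * Real.exp (1 / 10000 * lamCrit U T ^ 2)) *
              ⨆ t ∈ Icc (0 : ℝ) T,
                wnorm (fun ξ => if T ^ (-(1 : ℝ) / 4) ≤ en ξ then en ξ ^ ((1 : ℝ) / 2) else 0)
                  (U t) := by
  set a := mag U₀ with ha_def
  have ha := measurable_mag hmeas
  have hK := symBound_ne_top α
  have hP := prodConst_ne_top
  set K := symBound α with hKdef
  have hc := enConst_ne_top hK
  have hc0 : enConst K ≠ 0 := (zero_lt_one.trans_le (one_le_enConst K)).ne'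
  have hfin : hn 1 a ≠ ⊤ := by
    have h1 : hn 1 a ≤ wnorm (wD (1 / 2)) U₀ ^ 2 := by simpa using hn_mag_le 1 U₀
    exact ne_top_of_le_ne_top (ENNReal.pow_ne_top hH.ne) h1
  have hquarter : (1 / 2 / 2 : ℝ≥0∞) ≠ 0 := by simp
  obtain ⟨ε, hε0, -, hε⟩ := ENNReal.exists_mul_ofReal_le (A := enConst K * 9) (by finiteness)
    hquarter
  obtain ⟨r, hr0, hVfin, hVε⟩ := exists_majSup_small hK ha hfin (ENNReal.ofReal_pos.2 hε0)
  set V := majSup K a with hV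
  have hVm : Measurable (Function.uncurry V) := measurable_majSup ha
  set M := 2 * hn 1 a + 2 * (K ^ 2 * prodConst * ∫⁻ s in Ioc 0 r, hn 2 (V s) ^ 2) with hM
  have hMt : M ≠ ⊤ := by finiteness
  have hVM : ∀ t ∈ Icc 0 r, hn 1 (V t) ≤ M := fun t ht => by
    have h1 : V t = majStep K a V t := funext fun ξ => majSup_eq ha t ξ
    rw [h1]
    refine (hn_one_majStep_le hK ha hVm ht.1).trans ?_
    rw [hM]
    gcongr 2 * hn 1 a + 2 * (K ^ 2 * prodConst * ?_)
    exact lintegral_mono_set (Ioc_subset_Ioc_right ht.2)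
  obtain ⟨x, hx0, hx1, hx⟩ := ENNReal.exists_mul_ofReal_le
    (A := 8 * enConst K ^ 2 * 144 ^ 4) (by finiteness) hquarter
  obtain ⟨y, hy0, hy1, hy⟩ := ENNReal.exists_mul_ofReal_le
    (A := 2 * enConst K * M * 144 ^ 2) (by finiteness) hquarter
  obtain ⟨τ₀, hτ₀, hzeta⟩ := exists_zetaSup_le hmeas hfin hr0 hVfin
    (ENNReal.ofReal_pos.2 (pow_pos hx0 4))
  set σ := min (min (1 / 2) r) (min (y ^ 2) τ₀) with hσ
  have hσ0 : 0 < σ := by positivity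
  have hσ1 : σ ≤ 1 / 2 := (min_le_left _ _).trans (min_le_left _ _)
  have hσr : σ ^ 4 ≤ r :=
    calc σ ^ 4 ≤ σ ^ 1 := pow_le_pow_of_le_one hσ0.le (by linarith) (by norm_num)
      _ = σ := pow_one σ
      _ ≤ r := (min_le_left _ _).trans (min_le_right _ _)
  obtain ⟨U, hU, hmild, hUV⟩ := exists_mild_majorized (α := α) hmeas (T := σ ^ 4) fun t ht =>
    ne_top_of_le_ne_top hMt (hVM t ⟨ht.1, ht.2.trans hσr⟩)
  have h2UV : ∀ s ∈ Icc 0 (σ ^ 4), hn 2 (mag (U s)) ≤ hn 2 (V s) := fun s hs => hn_mono (hUV s hs)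
  have h2U : ∫⁻ s in Ioc 0 (σ ^ 4), hn 2 (mag (U s)) ^ 2 ≠ ⊤ := by
    refine ne_top_of_le_ne_top hVfin ((setLIntegral_mono' measurableSet_Ioc fun s hs => ?_).trans
      (lintegral_mono_set (Ioc_subset_Ioc_right hσr)))
    gcongr
    exact h2UV s ⟨hs.1.le, hs.2⟩
  refine ⟨1 / 2, by norm_num, fun δ hδ hδ' => ⟨σ ^ 4, by positivity, U, hU,
    ⟨hmild, contInW_of_isMildSol hU hmeas hmild hfin h2U,
      memL2W_of_hn_three (lintegral_hn_three_mag_ne_top hU hmeas hmild hfin h2U)⟩,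
    fun W ⟨hW, hmW, hcW, hLW⟩ => IsMildSol.eq_of_lintegral_hn_two hU hW hmild hmW h2U
      (lintegral_hn_two_sq_ne_top_of_memL2W hW hcW hLW),
    √(6 * (enConst K).toReal) * 30000, ?_, fun T hT hTσ => ?_⟩⟩
  · have := ENNReal.toReal_pos hc0 hc
    positivity
  obtain ⟨τ, hτ, rfl⟩ := exists_pow_four_eq hT
  have hτσ : τ ≤ σ := (pow_le_pow_iff_left₀ hτ.le hσ0.le four_ne_zero).1 hTσ
  have h := Ynorm_le_of_small (x := x) (y := y) hmeas hU hmild hδ.le hδ'.le hτ (hτσ.trans hσ1) hTσ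
    hx0.le hx1 hy0.le hy1 (hτσ.trans ((min_le_right _ _).trans (min_le_left _ _)))
    (fun s hs => (hn_mono (hUV s hs)).trans (hVM s ⟨hs.1, hs.2.trans hσr⟩))
    (fun s hs => (mul_le_mul_right (h2UV s ⟨hs.1.le, hs.2⟩) _).trans
      (hVε s ⟨hs.1, hs.2.trans hσr⟩))
    (hzeta U _ hU hmild h2UV τ hτ (hτσ.trans ((min_le_right _ _).trans (min_le_right _ _))) hTσ)
    hε hx hy
  rwa [zetaSup_eq, ← pow_four_rpow_neg_quarter hτ] at h
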